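/- Suppose ℳ and ℳ' are practical for κ, the pair ℳ ⊆ ℳ' has the δ-cover and δ-approximation properties for some regular cardinal δ of ℳ', ℳ and ℳ' have the same ordinals, and ℳ^ω ⊆ ℳ holds in ℳ'. If κ > δ is Ramsey in ℳ', then κ was already Ramsey in ℳ. -/

import Mathlib

noncomputable section

namespace MPaper

open ZFSet

attribute [local instance] Classical.propDecidable

/-! ### Basic set-theoretic vocabulary over `ZFSet` -/

/-- The (external) cardinality of a ZFC set. -/
def zcard (x : ZFSet) : Cardinal := Cardinal.mk x.toSet

/-- `x` is a von Neumann ordinal: a transitive set of transitive sets. -/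
def IsOrd (x : ZFSet) : Prop := x.IsTransitive ∧ ∀ y ∈ x, ZFSet.IsTransitive y

/-- `κ` is a cardinal: an ordinal not equinumerous with any of its members. -/
def IsCard (κ : ZFSet) : Prop := IsOrd κ ∧ ∀ α ∈ κ, zcard α < zcard κ

/-- The ordinal `κ⁺`, the cardinal successor of `κ`. -/
def cardSuccOrd (κ : ZFSet) : Ordinal := (Order.succ (zcard κ)).ord

/-- `f` is a set-coded function with domain `d` (a set of Kuratowski pairs). -/
def IsZFunc (d f : ZFSet) : Prop :=
  (∀ p ∈ f, ∃ a ∈ d, ∃ b, p = ZFSet.pair a b) ∧ ∀ a ∈ d, ∃! b, ZFSet.pair a b ∈ f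

/-- Application of a set-coded function. -/
def fapp (f a : ZFSet) : ZFSet :=
  ⋃₀ (ZFSet.sep (fun b => ZFSet.pair a b ∈ f) (⋃₀ (⋃₀ f)))

/-- `f` maps `d` into `y`. -/
def MapsInto (f d y : ZFSet) : Prop := ∀ a ∈ d, fapp f a ∈ y

/-- `f` maps `d` onto `y`. -/
def SurjOnto (f d y : ZFSet) : Prop := MapsInto f d y ∧ ∀ b ∈ y, ∃ a ∈ d, fapp f a = b

/-- `f` is injective on `d`. -/
def InjOnZ (f d : ZFSet) : Prop := ∀ a ∈ d, ∀ b ∈ d, fapp f a = fapp f b → a = b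

/-- `f` is a bijection from `d` onto `y`. -/
def IsBij (f d y : ZFSet) : Prop := IsZFunc d f ∧ SurjOnto f d y ∧ InjOnZ f d

/-- The tail `κ ∖ α = {ξ ∈ κ | α ≤ ξ}` (for ordinals `α ∈ κ`). -/
def tailSet (κ α : ZFSet) : ZFSet := ZFSet.sep (fun ξ => ξ ∉ α) κ

/-- The relative complement `κ ∖ A`. -/
def compl (κ A : ZFSet) : ZFSet := ZFSet.sep (fun ξ => ξ ∉ A) κ

/-! ### First-order satisfaction in ∈-structures -/

/-- First order formulas in the language of set theory, with variables indexed by `ℕ`. -/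
inductive Fml : Type
  | mem : ℕ → ℕ → Fml
  | eq : ℕ → ℕ → Fml
  | impl : Fml → Fml → Fml
  | neg : Fml → Fml
  | all : ℕ → Fml → Fml

/-- Tarskian satisfaction of a formula in the ∈-structure with domain `D`. -/
def Sat (D : Set ZFSet) : Fml → (ℕ → ZFSet) → Prop
  | .mem i j, v => v i ∈ v j
  | .eq i j, v => v i = v j
  | .impl φ ψ, v => Sat D φ v → Sat D ψ v
  | .neg φ, v => ¬ Sat D φ v
  | .all n φ, v => ∀ x ∈ D, Sat D φ (Function.update v n x)

/-- `D` is an elementary substructure of `E` (as ∈-structures). -/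
def ElemSub (D E : Set ZFSet) : Prop :=
  D ⊆ E ∧ ∀ (φ : Fml) (v : ℕ → ZFSet), (∀ n, v n ∈ D) → (Sat D φ v ↔ Sat E φ v)

/-- `r` is a well-ordering of `x` (coded as a set of Kuratowski pairs). -/
def IsWellOrderOn (x r : ZFSet) : Prop :=
  (∀ p ∈ r, ∃ a ∈ x, ∃ b ∈ x, p = ZFSet.pair a b) ∧
  (∀ a ∈ x, ∀ b ∈ x, a = b ∨ ZFSet.pair a b ∈ r ∨ ZFSet.pair b a ∈ r) ∧
  (∀ a ∈ x, ∀ b ∈ x, ∀ c ∈ x,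
    ZFSet.pair a b ∈ r → ZFSet.pair b c ∈ r → ZFSet.pair a c ∈ r) ∧
  (∀ a ∈ x, ZFSet.pair a a ∉ r) ∧
  (∀ S : Set ZFSet, S ⊆ x.toSet → S.Nonempty → ∃ a ∈ S, ∀ b ∈ S, ZFSet.pair b a ∉ r)

/-- A transitive model of `ZFC⁻` (ZFC minus power set): a transitive set closed under
pairing and union, containing `ω`, satisfying the separation and collection schemes for
first-order formulas, and choice in the guise of the well-ordering principle.
(Extensionality and foundation hold automatically in transitive sets.) -/
def IsTransModel (M : ZFSet) : Prop :=
  M.IsTransitive ∧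
  ZFSet.omega ∈ M ∧
  (∀ x ∈ M, ∀ y ∈ M, ({x, y} : ZFSet) ∈ M) ∧
  (∀ x ∈ M, (⋃₀ x : ZFSet) ∈ M) ∧
  (∀ (φ : Fml) (v : ℕ → ZFSet), (∀ n, v n ∈ M) → ∀ a ∈ M,
    ∃ b ∈ M, ∀ x, x ∈ b ↔ x ∈ a ∧ Sat M.toSet φ (Function.update v 0 x)) ∧
  (∀ (φ : Fml) (v : ℕ → ZFSet), (∀ n, v n ∈ M) → ∀ a ∈ M,
    (∀ x ∈ a, ∃ y ∈ M, Sat M.toSet φ (Function.update (Function.update v 0 x) 1 y)) →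
    ∃ b ∈ M, ∀ x ∈ a, ∃ y ∈ b, Sat M.toSet φ (Function.update (Function.update v 0 x) 1 y)) ∧
  (∀ x ∈ M, ∃ r ∈ M, IsWellOrderOn x r)

/-! ### Weak κ-models, κ-models, M-ultrafilters -/

/-- A weak `κ`-model: a transitive model of ZFC⁻ of size `κ` with `κ ∈ M`. -/
def IsWeakModel (κ M : ZFSet) : Prop :=
  IsTransModel M ∧ κ ∈ M ∧ zcard M = zcard κ

/-- `M` is closed under `<κ`-sequences (of its elements). -/
def SeqClosed (κ M : ZFSet) : Prop :=
  ∀ γ ∈ κ, ∀ f : ZFSet, IsZFunc γ f → (∀ a ∈ γ, fapp f a ∈ M) → f ∈ M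

/-- A `κ`-model: a weak `κ`-model closed under `<κ`-sequences. -/
def IsKappaModel (κ M : ZFSet) : Prop := IsWeakModel κ M ∧ SeqClosed κ M

/-- `U` is an `M`-ultrafilter on `κ`: `⟨M, ∈, U⟩` thinks `U` is a normal ultrafilter on `κ`
containing all tail sets. -/
def IsMUltrafilter (κ M U : ZFSet) : Prop :=
  (∀ A ∈ U, A ∈ M ∧ A ⊆ κ) ∧
  (∀ α ∈ κ, tailSet κ α ∈ U) ∧
  (∅ : ZFSet) ∉ U ∧
  (∀ A ∈ U, ∀ B ∈ U, A ∩ B ∈ U) ∧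
  (∀ A ∈ U, ∀ B, B ∈ M → B ⊆ κ → A ⊆ B → B ∈ U) ∧
  (∀ B, B ∈ M → B ⊆ κ → B ∈ U ∨ compl κ B ∈ U) ∧
  (∀ f ∈ M, IsZFunc κ f → ZFSet.sep (fun ξ => fapp f ξ ∈ ξ) κ ∈ U →
    ∃ γ ∈ κ, ZFSet.sep (fun ξ => fapp f ξ = γ) κ ∈ U)

/-- `U` is weakly amenable for `M`: for every `X ∈ M` of size at most `κ` in `M`,
the intersection `X ∩ U` belongs to `M`. -/
def WeaklyAmenable (κ M U : ZFSet) : Prop :=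
  ∀ X ∈ M, (∃ f ∈ M.toSet, IsZFunc κ f ∧ ∀ y ∈ X, ∃ ξ ∈ κ, fapp f ξ = y) →
    X ∩ U ∈ M

/-- `U` is `ω₁`-intersecting: every countable collection of its members has a common element. -/
def OmegaOneIntersecting (U : ZFSet) : Prop :=
  ∀ s : ℕ → ZFSet, (∀ n, s n ∈ U) → ∃ x, ∀ n, x ∈ s n

/-- `M` contains (its version of) `V_κ`, i.e. the set of all sets of rank `< κ`. -/
def HasVkappa (κ M : ZFSet) : Prop :=
  ∃ v ∈ M.toSet, ∀ x, x ∈ v ↔ ZFSet.rank x < ZFSet.rank κ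

/-! ### Small universe measures and the associated models `M_U`, `N_U` -/

/-- `M` is the minimal model associated to `U` (the collection of Mostowski collapses of
well-founded relations on `κ` coded by sets in `U` and their complements): a weak `κ`-model
with `V_κ ∈ M` for which `U` is an `M`-ultrafilter, contained in every transitive
ZFC⁻-model `M'` with `κ ∈ M'` for which `U` is an `M'`-ultrafilter. -/
def IsMUModel (κ U M : ZFSet) : Prop :=
  IsWeakModel κ M ∧ HasVkappa κ M ∧ IsMUltrafilter κ M U ∧
  ∀ M', IsTransModel M' → κ ∈ M' → IsMUltrafilter κ M' U → M ⊆ M'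

/-- A small universe measure on `κ`: a set `U` of subsets of `κ` of size `κ` whose associated
minimal model `M_U` exists (is a weak `κ`-model with `V_κ ∈ M_U` and `U` an `M_U`-ultrafilter). -/
def IsSUMeasure (κ U : ZFSet) : Prop :=
  zcard U = zcard κ ∧ (∀ A ∈ U, A ⊆ κ) ∧ ∃ M, IsMUModel κ U M

/-- The minimal model `M_U` associated to a small universe measure `U`. -/
def MU (κ U : ZFSet) : ZFSet :=
  if h : ∃ M, IsMUModel κ U M then h.choose else ∅

/-- `j : M → N` is (up to isomorphism) the ultrapower embedding of `M` by the
`M`-ultrafilter `U` on `κ`, with `N` transitive (so the ultrapower is well-founded):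
`j` is elementary, every element of `N` has the form `j(f)(κ)` for `f : κ → M` in `M`,
and `U` is the `M`-ultrafilter derived from `j` with seed `κ`. -/
def IsUltrapowerEmb (κ M U N : ZFSet) (j : ZFSet → ZFSet) : Prop :=
  N.IsTransitive ∧
  (∀ x ∈ M, j x ∈ N) ∧
  (∀ (φ : Fml) (v : ℕ → ZFSet), (∀ n, v n ∈ M) →
    (Sat M.toSet φ v ↔ Sat N.toSet φ (fun n => j (v n)))) ∧
  (∀ a ∈ N, ∃ f ∈ M.toSet, IsZFunc κ f ∧ MapsInto f κ M ∧ fapp (j f) κ = a) ∧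
  (∀ A ∈ M, A ⊆ κ → (A ∈ U ↔ κ ∈ j A))

/-- The ultrapower of `M_U` by `U` is well-founded. -/
def UltrapowerWF (κ U : ZFSet) : Prop :=
  ∃ (N : ZFSet) (j : ZFSet → ZFSet), IsUltrapowerEmb κ (MU κ U) U N j

/-- A choice of transitive collapse of the ultrapower of `M_U` by `U`, with its embedding. -/
def upData (κ U : ZFSet) : ZFSet × (ZFSet → ZFSet) :=
  if h : ∃ p : ZFSet × (ZFSet → ZFSet), IsUltrapowerEmb κ (MU κ U) U p.1 p.2
  then h.choose else (∅, id)

/-- `N_U`: the transitive collapse of the ultrapower of `M_U` by `U` (when well-founded). -/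
def NU (κ U : ZFSet) : ZFSet := (upData κ U).1

/-- The ultrapower embedding `j_U : M_U → N_U`. -/
def jU (κ U : ZFSet) : ZFSet → ZFSet := (upData κ U).2

/-- `M_U⋆ = V_{j(κ)}^{N_U}`, the rank-initial segment of `N_U` below `j_U(κ)`. -/
def MUstar (κ U : ZFSet) : ZFSet :=
  ZFSet.sep (fun x => ZFSet.rank x < ZFSet.rank (jU κ U κ)) (NU κ U)

/-! ### Hereditary size, `H_{κ⁺}`, elementarity -/

/-- `x` has hereditary size at most `κ`. -/
def HeredLE (κ : ZFSet) : ZFSet → Prop :=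
  WellFounded.fix ZFSet.mem_wf
    (fun x ih => zcard x ≤ zcard κ ∧ ∀ y, ∀ h : y ∈ x, ih y h)

/-- The class `H_{κ⁺}` of sets of hereditary size at most `κ`. -/
def Hclass (κ : ZFSet) : Set ZFSet := { x | HeredLE κ x }

/-! ### The measures witnessing Ramsey and Ramsey-like cardinals -/

/-- A Ramsey measure on `κ`: a weakly amenable `ω₁`-intersecting small universe measure. -/
def IsRamseyMeasure (κ U : ZFSet) : Prop :=
  IsSUMeasure κ U ∧ WeaklyAmenable κ (MU κ U) U ∧ OmegaOneIntersecting U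

/-- A strong Ramsey measure on `κ`: a weakly amenable small universe measure whose
minimal model `M_U` is a `κ`-model. -/
def IsStrongRamseyMeasure (κ U : ZFSet) : Prop :=
  IsSUMeasure κ U ∧ WeaklyAmenable κ (MU κ U) U ∧ SeqClosed κ (MU κ U)

/-- A super Ramsey measure on `κ`: a strong Ramsey measure with `M_U ≺ H_{κ⁺}`. -/
def IsSuperRamseyMeasure (κ U : ZFSet) : Prop :=
  IsStrongRamseyMeasure κ U ∧ ElemSub (MU κ U).toSet (Hclass κ)

/-- `I` certifies `U`: `I` is an unbounded subset of `κ` and the sets in `U` are exactly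
the subsets of `κ` in `M_U` containing a tail of `I`. -/
def Certifies (κ U : ZFSet) (I : Set ZFSet) : Prop :=
  (∀ ξ ∈ I, ξ ∈ κ) ∧ (∀ α ∈ κ, ∃ ξ ∈ I, ξ ∉ α) ∧
  ∀ X ∈ (MU κ U).toSet, X ⊆ κ →
    (X ∈ U ↔ ∃ α ∈ κ.toSet, ∀ ξ ∈ I, ξ ∉ α → ξ ∈ X)

/-- A certified Ramsey measure on `κ`: a weakly amenable small universe measure which is
certified by some unbounded `I ⊆ κ`. -/
def IsCertifiedRamseyMeasure (κ U : ZFSet) : Prop :=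
  IsSUMeasure κ U ∧ WeaklyAmenable κ (MU κ U) U ∧ ∃ I : Set ZFSet, Certifies κ U I

/-! ### Relativized (internal) versions of the measure predicates -/

/-- `ω₁`-intersecting from the point of view of the transitive model `N`: every
`ω`-sequence of members of `U` lying in `N` has a common element. -/
def OmegaOneIntersectingIn (N U : ZFSet) : Prop :=
  ∀ f ∈ N.toSet, IsZFunc ZFSet.omega f → (∀ n ∈ ZFSet.omega, fapp f n ∈ U) →
    ∃ x, ∀ n ∈ ZFSet.omega, x ∈ fapp f n

/-- `N ⊨ U is a Ramsey measure on κ`, for a transitive ZFC⁻-model `N`: all components are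
absolute except `ω₁`-intersectingness, which is evaluated using sequences in `N`. -/
def RamseyMeasureIn (N κ U : ZFSet) : Prop :=
  U ∈ N ∧ IsSUMeasure κ U ∧ WeaklyAmenable κ (MU κ U) U ∧ OmegaOneIntersectingIn N U

/-- `N ⊨ U is a strong Ramsey measure on κ`: closure of `M_U` under `<κ`-sequences is
evaluated using the sequences lying in `N`. -/
def StrongRamseyMeasureIn (N κ U : ZFSet) : Prop :=
  U ∈ N ∧ IsSUMeasure κ U ∧ WeaklyAmenable κ (MU κ U) U ∧
  ∀ f ∈ N.toSet, ∀ γ ∈ κ, IsZFunc γ f → (∀ a ∈ γ, fapp f a ∈ MU κ U) → f ∈ MU κ U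

/-- The class `H_{κ⁺}` as computed in `N`. -/
def HclassIn (N κ : ZFSet) : Set ZFSet := { x | x ∈ N ∧ HeredLE κ x }

/-- `N ⊨ U is a super Ramsey measure on κ`. -/
def SuperRamseyMeasureIn (N κ U : ZFSet) : Prop :=
  StrongRamseyMeasureIn N κ U ∧ ElemSub (MU κ U).toSet (HclassIn N κ)

/-- `N ⊨ U is a certified Ramsey measure on κ` (the certifying set is required to lie in `N`). -/
def CertifiedRamseyMeasureIn (N κ U : ZFSet) : Prop :=
  U ∈ N ∧ IsSUMeasure κ U ∧ WeaklyAmenable κ (MU κ U) U ∧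
  ∃ I ∈ N.toSet, Certifies κ U I.toSet

/-! ### Goodness, witness collections, and the M-order -/

/-- `U` is `A`-good: `A ∈ M_U`. -/
def AGood (κ A U : ZFSet) : Prop := A ∈ MU κ U

/-- A witness collection of `Pm`-measures on `κ`: a collection of `Pm`-measures containing
an `A`-good one for every `A ⊆ κ`. -/
def IsWitness (Pm : ZFSet → ZFSet → Prop) (κ : ZFSet) (𝒰 : Set ZFSet) : Prop :=
  (∀ U ∈ 𝒰, Pm κ U) ∧ ∀ A : ZFSet, A ⊆ κ → ∃ U ∈ 𝒰, AGood κ A U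

/-- The M-order on witness collections of `Pm`-measures on `κ`; `PmIn N κ U` is the
relativization `N ⊨ U is a Pm-measure on κ`.  `MOrder Pm PmIn κ 𝒰 𝒲` says `𝒰 ◁ 𝒲`. -/
def MOrder (Pm : ZFSet → ZFSet → Prop) (PmIn : ZFSet → ZFSet → ZFSet → Prop)
    (κ : ZFSet) (𝒰 𝒲 : Set ZFSet) : Prop :=
  IsWitness Pm κ 𝒰 ∧ IsWitness Pm κ 𝒲 ∧
  (∀ W ∈ 𝒲, ∀ A ∈ (NU κ W).toSet, A ⊆ κ →
    ∃ U ∈ 𝒰, U ∈ NU κ W ∧ AGood κ A U ∧ PmIn (NU κ W) κ U) ∧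
  (∀ U ∈ 𝒰, ∃ W ∈ 𝒲, U ∈ NU κ W)

/-! ### Ranks -/

/-- The rank of a point in an arbitrary binary relation (`0` at non-accessible points). -/
def relRank {X : Type*} (r : X → X → Prop) (x : X) : Ordinal :=
  if h : Acc r x then h.rank else 0

/-- The M-rank `o_Pm(κ)`: the strict supremum of the M-ranks of all witness collections of
`Pm`-measures on `κ` (and `0` if there are none). -/
def oRank (Pm : ZFSet → ZFSet → Prop) (PmIn : ZFSet → ZFSet → ZFSet → Prop)
    (κ : ZFSet) : Ordinal :=
  sSup { o : Ordinal |
    ∃ 𝒰 : Set ZFSet, IsWitness Pm κ 𝒰 ∧ o = relRank (MOrder Pm PmIn κ) 𝒰 + 1 }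

/-- `N ⊨ o_Pm(κ) ≥ α`, defined by the recursion: for every `A ⊆ κ` in `N` and every `β < α`
there is an `A`-good `Pm`-measure `W` in `N` (in the sense of `N`) whose ultrapower satisfies
`o_Pm(κ) ≥ β`. -/
def oGEin (PmIn : ZFSet → ZFSet → ZFSet → Prop) (κ : ZFSet) : Ordinal → ZFSet → Prop :=
  WellFounded.fix wellFounded_lt fun α ih N =>
    ∀ A ∈ N.toSet, A ⊆ κ → ∀ β, ∀ h : β < α,
      ∃ W ∈ N.toSet, PmIn N κ W ∧ AGood κ A W ∧ ih β h (NU κ W)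

/-- `N ⊨ o_Pm(κ) = α`. -/
def oEQin (PmIn : ZFSet → ZFSet → ZFSet → Prop) (κ : ZFSet) (α : Ordinal) (N : ZFSet) : Prop :=
  oGEin PmIn κ α N ∧ ¬ oGEin PmIn κ (α + 1) N

/-! ### The M-order and M-rank relativized to a model `ℳ` -/

/-- A witness collection (coded as a set) of `Pm`-measures in the sense of the model `ℳ`. -/
def IsWitnessIn (PmIn : ZFSet → ZFSet → ZFSet → Prop) (ℳ κ 𝒰 : ZFSet) : Prop :=
  𝒰 ∈ ℳ ∧ (∀ U ∈ 𝒰, PmIn ℳ κ U) ∧ ∀ A ∈ ℳ.toSet, A ⊆ κ → ∃ U ∈ 𝒰.toSet, AGood κ A U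

/-- The M-order on witness collections as computed in `ℳ`. -/
def MOrderIn (PmIn : ZFSet → ZFSet → ZFSet → Prop) (ℳ κ : ZFSet) (𝒰 𝒲 : ZFSet) : Prop :=
  IsWitnessIn PmIn ℳ κ 𝒰 ∧ IsWitnessIn PmIn ℳ κ 𝒲 ∧
  (∀ W ∈ 𝒲, ∀ A ∈ (NU κ W).toSet, A ⊆ κ →
    ∃ U ∈ 𝒰.toSet, U ∈ NU κ W ∧ AGood κ A U ∧ PmIn (NU κ W) κ U) ∧
  (∀ U ∈ 𝒰, ∃ W ∈ 𝒲.toSet, U ∈ NU κ W)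

/-- The M-rank `o_Pm(κ)` as computed in `ℳ`. -/
def oRankIn (PmIn : ZFSet → ZFSet → ZFSet → Prop) (ℳ κ : ZFSet) : Ordinal :=
  sSup { o : Ordinal |
    ∃ 𝒰 : ZFSet, IsWitnessIn PmIn ℳ κ 𝒰 ∧ o = relRank (MOrderIn PmIn ℳ κ) 𝒰 + 1 }

/-! ### Practical models, cover and approximation properties -/

/-- `ℳ` is practical for `κ`: a transitive ZFC⁻-model containing `κ` in which
`V_{κ+3}` exists. -/
def Practical (κ ℳ : ZFSet) : Prop :=
  IsTransModel ℳ ∧ κ ∈ ℳ ∧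
  ∃ v ∈ ℳ.toSet, ∀ x, x ∈ v ↔ (x ∈ ℳ ∧ ZFSet.rank x < ZFSet.rank κ + 3)

/-- `x` has size less than `δ` as witnessed inside the class `D`:
some `f ∈ D` injects `x` into an ordinal `γ ∈ δ`. -/
def SizeLTin (D : Set ZFSet) (x δ : ZFSet) : Prop :=
  ∃ γ ∈ δ.toSet, ∃ f ∈ D, IsZFunc x f ∧ MapsInto f x γ ∧ InjOnZ f x

/-- The pair `D ⊆ D'` has the `δ`-cover property. -/
def CoverProperty (δ : ZFSet) (D D' : Set ZFSet) : Prop :=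
  ∀ X ∈ D', X.toSet ⊆ D → SizeLTin D' X δ →
    ∃ Y ∈ D, X ⊆ Y ∧ SizeLTin D Y δ

/-- The pair `D ⊆ D'` has the `δ`-approximation property. -/
def ApproxProperty (δ : ZFSet) (D D' : Set ZFSet) : Prop :=
  ∀ X ∈ D', X.toSet ⊆ D → (∀ x ∈ D, SizeLTin D x δ → X ∩ x ∈ D) → X ∈ D

/-- `δ` is a cardinal from the point of view of the class `D`. -/
def IsCardIn (D : Set ZFSet) (δ : ZFSet) : Prop :=
  IsOrd δ ∧ δ ∈ D ∧ ∀ γ ∈ δ, ¬ ∃ f ∈ D, IsZFunc γ f ∧ SurjOnto f γ δ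

/-- `δ` is a regular (infinite) cardinal from the point of view of the class `D`. -/
def IsRegularIn (D : Set ZFSet) (δ : ZFSet) : Prop :=
  IsCardIn D δ ∧ ZFSet.omega ⊆ δ ∧
  ∀ γ ∈ δ, ∀ f ∈ D, IsZFunc γ f → MapsInto f γ δ →
    ∃ β ∈ δ, ∀ a ∈ γ, fapp f a ∈ β

/-- `H_λ` as computed in the model `V`: the members of `V` having, in `V`,
a transitive superset of size `< λ`. -/
def HIn (V lam : ZFSet) : Set ZFSet :=
  { x | x ∈ V ∧ ∃ t ∈ V.toSet, x ⊆ t ∧ t.IsTransitive ∧ SizeLTin V.toSet t lam }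

/-- `V` and `V'` have the same ordinals. -/
def SameOrdinals (D D' : Set ZFSet) : Prop :=
  ∀ α, IsOrd α → (α ∈ D ↔ α ∈ D')

/-- Every `ω`-sequence of elements of `ℳ` lying in `ℳ'` is an element of `ℳ`. -/
def OmegaSeqClosedPair (ℳ ℳ' : ZFSet) : Prop :=
  ∀ f ∈ ℳ'.toSet, IsZFunc ZFSet.omega f → (∀ n ∈ ZFSet.omega, fapp f n ∈ ℳ) → f ∈ ℳ

/-! ### Large cardinal properties -/

/-- `κ` is Ramsey: every `A ⊆ κ` belongs to a weak `κ`-model `M` carrying a weakly amenable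
`ω₁`-intersecting `M`-ultrafilter on `κ`. -/
def IsRamseyCard (κ : ZFSet) : Prop :=
  IsCard κ ∧ ∀ A : ZFSet, A ⊆ κ →
    ∃ M, IsWeakModel κ M ∧ A ∈ M ∧
      ∃ U, IsMUltrafilter κ M U ∧ WeaklyAmenable κ M U ∧ OmegaOneIntersecting U

/-- `κ` is strongly Ramsey: the model `M` can moreover be taken to be a `κ`-model. -/
def IsStronglyRamseyCard (κ : ZFSet) : Prop :=
  IsCard κ ∧ ∀ A : ZFSet, A ⊆ κ →
    ∃ M, IsKappaModel κ M ∧ A ∈ M ∧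
      ∃ U, IsMUltrafilter κ M U ∧ WeaklyAmenable κ M U ∧ OmegaOneIntersecting U

/-- `κ` is super Ramsey: the model `M` can moreover be taken to be a `κ`-model
elementary in `H_{κ⁺}`. -/
def IsSuperRamseyCard (κ : ZFSet) : Prop :=
  IsCard κ ∧ ∀ A : ZFSet, A ⊆ κ →
    ∃ M, IsKappaModel κ M ∧ ElemSub M.toSet (Hclass κ) ∧ A ∈ M ∧
      ∃ U, IsMUltrafilter κ M U ∧ WeaklyAmenable κ M U ∧ OmegaOneIntersecting U

/-- `κ` is weakly super Ramsey: the model `M` is a weak `κ`-model elementary in `H_{κ⁺}`. -/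
def IsWeaklySuperRamseyCard (κ : ZFSet) : Prop :=
  IsCard κ ∧ ∀ A : ZFSet, A ⊆ κ →
    ∃ M, IsWeakModel κ M ∧ ElemSub M.toSet (Hclass κ) ∧ A ∈ M ∧
      ∃ U, IsMUltrafilter κ M U ∧ WeaklyAmenable κ M U ∧ OmegaOneIntersecting U

/-- `κ` is measurable: there is a `κ`-complete nonprincipal ultrafilter on (all) subsets
of `κ`. -/
def IsMeasurableCard (κ : ZFSet) : Prop :=
  IsCard κ ∧ ZFSet.omega ∈ κ ∧
  ∃ 𝒰 : Set ZFSet,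
    (∀ A ∈ 𝒰, A ⊆ κ) ∧ (∅ : ZFSet) ∉ 𝒰 ∧ κ ∈ 𝒰 ∧
    (∀ A ∈ 𝒰, ∀ B : ZFSet, B ⊆ κ → A ⊆ B → B ∈ 𝒰) ∧
    (∀ A : ZFSet, A ⊆ κ → (A ∈ 𝒰 ∨ compl κ A ∈ 𝒰)) ∧
    (∀ γ ∈ κ.toSet, ∀ s : ZFSet → ZFSet, (∀ i ∈ γ, s i ∈ 𝒰) →
      ZFSet.sep (fun ξ => ∀ i ∈ γ, ξ ∈ s i) κ ∈ 𝒰)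

/-! ### Relativized large-cardinal properties -/

/-- `N ⊨ κ is Ramsey` (for a transitive model `N`): the witnessing models and ultrafilters
lie in `N`, smallness of the models is witnessed in `N`, and `ω₁`-intersectingness is
evaluated using the sequences in `N`. -/
def RamseyCardIn (N κ : ZFSet) : Prop :=
  ∀ A ∈ N.toSet, A ⊆ κ →
    ∃ M ∈ N.toSet, A ∈ M ∧ IsTransModel M ∧ κ ∈ M ∧
      (∃ f ∈ N.toSet, IsZFunc κ f ∧ SurjOnto f κ M) ∧
      ∃ U ∈ N.toSet, IsMUltrafilter κ M U ∧ WeaklyAmenable κ M U ∧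
        OmegaOneIntersectingIn N U

/-- `N ⊨ κ is strongly Ramsey`. -/
def StronglyRamseyCardIn (N κ : ZFSet) : Prop :=
  ∀ A ∈ N.toSet, A ⊆ κ →
    ∃ M ∈ N.toSet, A ∈ M ∧ IsTransModel M ∧ κ ∈ M ∧
      (∃ f ∈ N.toSet, IsZFunc κ f ∧ SurjOnto f κ M) ∧
      (∀ f ∈ N.toSet, ∀ γ ∈ κ, IsZFunc γ f → (∀ a ∈ γ, fapp f a ∈ M) → f ∈ M) ∧
      ∃ U ∈ N.toSet, IsMUltrafilter κ M U ∧ WeaklyAmenable κ M U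

/-- `N ⊨ κ is super Ramsey`. -/
def SuperRamseyCardIn (N κ : ZFSet) : Prop :=
  ∀ A ∈ N.toSet, A ⊆ κ →
    ∃ M ∈ N.toSet, A ∈ M ∧ IsTransModel M ∧ κ ∈ M ∧
      (∃ f ∈ N.toSet, IsZFunc κ f ∧ SurjOnto f κ M) ∧
      (∀ f ∈ N.toSet, ∀ γ ∈ κ, IsZFunc γ f → (∀ a ∈ γ, fapp f a ∈ M) → f ∈ M) ∧
      ElemSub M.toSet (HclassIn N κ) ∧
      ∃ U ∈ N.toSet, IsMUltrafilter κ M U ∧ WeaklyAmenable κ M U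

/-! ### ω-special models -/

/-- A weak `κ`-model `M` is `ω`-special: it is the union of a chain
`M₀ ≺ M₁ ≺ ⋯` of elementary substructures of `M` with each `Mₙ ∈ M` and `|Mₙ|^M = κ`. -/
def OmegaSpecial (κ M : ZFSet) : Prop :=
  ∃ s : ℕ → ZFSet,
    (∀ n, s n ∈ M) ∧
    (∀ n, (s n).toSet ⊆ (s (n + 1)).toSet) ∧
    (∀ n, ElemSub (s n).toSet M.toSet) ∧
    (∀ n, ∃ f ∈ M.toSet, IsBij f κ (s n)) ∧
    (∀ x, x ∈ M ↔ ∃ n, x ∈ s n)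

/-! ### Iterated ultrapowers and α-iterability -/

/-- `U` is an `α`-iterable `M`-ultrafilter on `κ`: there is a coherent system of transitive
models `Mod β` (`β ≤ α`), with commuting elementary embeddings `e β γ : Mod β → Mod γ`,
critical sequence `cr β` and ultrafilter sequence `Us β`, starting at `(M, κ, U)`, where each
successor step is given by an ultrapower and each limit step is a (collapsed) direct limit. -/
def IsAlphaIterable (κ M U : ZFSet) (α : Ordinal) : Prop :=
  ∃ (Mod : Ordinal → ZFSet) (cr : Ordinal → ZFSet) (Us : Ordinal → ZFSet)
    (e : Ordinal → Ordinal → ZFSet → ZFSet),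
    Mod 0 = M ∧ cr 0 = κ ∧ Us 0 = U ∧
    (∀ β ≤ α, (Mod β).IsTransitive) ∧
    (∀ β ≤ α, ∀ x ∈ Mod β, e β β x = x) ∧
    (∀ β γ ρ : Ordinal, β ≤ γ → γ ≤ ρ → ρ ≤ α →
      ∀ x ∈ Mod β, e γ ρ (e β γ x) = e β ρ x) ∧
    (∀ β γ : Ordinal, β ≤ γ → γ ≤ α →
      (∀ x ∈ Mod β, e β γ x ∈ Mod γ) ∧
      ∀ (φ : Fml) (v : ℕ → ZFSet), (∀ n, v n ∈ Mod β) →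
        (Sat (Mod β).toSet φ v ↔ Sat (Mod γ).toSet φ (fun n => e β γ (v n)))) ∧
    (∀ β : Ordinal, β + 1 ≤ α →
      IsUltrapowerEmb (cr β) (Mod β) (Us β) (Mod (β + 1)) (e β (β + 1)) ∧
      cr (β + 1) = e β (β + 1) (cr β) ∧
      (∀ A, A ∈ Us (β + 1) ↔
        ∃ X ∈ (Mod β).toSet, X ∩ Us β ∈ Mod β ∧ A ∈ e β (β + 1) (X ∩ Us β))) ∧
    (∀ lam : Ordinal, lam ≤ α → lam ≠ 0 → (∀ β < lam, β + 1 < lam) →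
      (∀ x ∈ Mod lam, ∃ β < lam, ∃ y ∈ (Mod β).toSet, e β lam y = x) ∧
      cr lam = e 0 lam κ ∧
      (∀ A, A ∈ Us lam ↔ ∃ β < lam, ∃ B, B ∈ Us β ∧ e β lam B = A))

/-- `N ⊨ κ is α-iterable`: every `A ⊆ κ` in `N` belongs to a weak `κ`-model `M ∈ N` for
which there is a weakly amenable `α`-iterable `M`-ultrafilter `U ∈ N` on `κ`. -/
def AlphaIterableCardIn (N κ : ZFSet) (α : Ordinal) : Prop :=
  ∀ A ∈ N.toSet, A ⊆ κ →
    ∃ M ∈ N.toSet, A ∈ M ∧ IsTransModel M ∧ κ ∈ M ∧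
      (∃ f ∈ N.toSet, IsZFunc κ f ∧ SurjOnto f κ M) ∧
      ∃ U ∈ N.toSet, IsMUltrafilter κ M U ∧ WeaklyAmenable κ M U ∧
        IsAlphaIterable κ M U α

/-! ### Forcing -/

/-- `R` codes a partial order (of forcing conditions) on `P`: `pair p q ∈ R` means `p ≤ q`. -/
def IsPoset (P R : ZFSet) : Prop :=
  (∀ p ∈ R, ∃ a ∈ P, ∃ b ∈ P, p = ZFSet.pair a b) ∧
  (∀ p ∈ P, ZFSet.pair p p ∈ R) ∧
  (∀ p ∈ P, ∀ q ∈ P, ∀ r ∈ P,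
    ZFSet.pair p q ∈ R → ZFSet.pair q r ∈ R → ZFSet.pair p r ∈ R)

/-- `G` is an `ℳ`-generic filter on the poset `(P, R)`. -/
def IsGenericFilter (ℳ P R : ZFSet) (G : Set ZFSet) : Prop :=
  G ⊆ P.toSet ∧ G.Nonempty ∧
  (∀ p ∈ G, ∀ q ∈ G, ∃ r ∈ G, ZFSet.pair r p ∈ R ∧ ZFSet.pair r q ∈ R) ∧
  (∀ p ∈ G, ∀ q ∈ P.toSet, ZFSet.pair p q ∈ R → q ∈ G) ∧
  ∀ Dset ∈ ℳ.toSet, Dset ⊆ P →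
    (∀ p ∈ P.toSet, ∃ q ∈ Dset.toSet, ZFSet.pair q p ∈ R) →
    ∃ q ∈ G, q ∈ Dset

/-- `ℳ'` is the generic extension `ℳ[G]`: the least transitive ZFC⁻-model containing `ℳ`
and (a set coding) `G`, with the same ordinals as `ℳ`. -/
def IsGenericExt (ℳ ℳ' : ZFSet) (G : Set ZFSet) : Prop :=
  IsTransModel ℳ' ∧ ℳ ⊆ ℳ' ∧ (∃ g ∈ ℳ'.toSet, g.toSet = G) ∧
  SameOrdinals ℳ.toSet ℳ'.toSet ∧
  ∀ N', IsTransModel N' → ℳ ⊆ N' → (∃ g ∈ N'.toSet, g.toSet = G) → ℳ' ⊆ N'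

/-- `f ∈ D` is a cofinal map from `γ` into the ordinal `α`. -/
def CofinalMapIn (D : Set ZFSet) (γ α f : ZFSet) : Prop :=
  f ∈ D ∧ IsZFunc γ f ∧ MapsInto f γ α ∧
  ∀ b ∈ α, ∃ a ∈ γ, b ∈ fapp f a ∨ b = fapp f a

/-- `γ` is the cofinality of the ordinal `α` as computed in `D`. -/
def IsCofIn (D : Set ZFSet) (α γ : ZFSet) : Prop :=
  IsOrd γ ∧ (∃ f, CofinalMapIn D γ α f) ∧ ∀ γ' ∈ γ, ¬ ∃ f, CofinalMapIn D γ' α f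

/-- The pair `ℳ ⊆ ℳ'` preserves all cofinalities. -/
def PreservesCofinalities (ℳ ℳ' : ZFSet) : Prop :=
  ∀ α ∈ ℳ.toSet, IsOrd α → ∀ γ, (IsCofIn ℳ.toSet α γ ↔ IsCofIn ℳ'.toSet α γ)

set_option linter.all false

universe u

/-! ### Formula toolbox -/

/-- Cons of an element onto a valuation. -/
def vc (x : ZFSet) (v : ℕ → ZFSet) : ℕ → ZFSet
  | 0 => x
  | n + 1 => v n

theorem Sat_bound (φ : Fml) : ∃ B : ℕ, ∀ (D : Set ZFSet.{u}) (v w : ℕ → ZFSet.{u}),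
    (∀ i < B, v i = w i) → (Sat D φ v ↔ Sat D φ w) := by
  induction φ with
  | mem i j =>
    refine ⟨i + j + 1, fun D v w h => ?_⟩
    simp only [Sat, h i (by omega), h j (by omega)]
  | eq i j =>
    refine ⟨i + j + 1, fun D v w h => ?_⟩
    simp only [Sat, h i (by omega), h j (by omega)]
  | impl φ ψ ih1 ih2 =>
    obtain ⟨B, hB⟩ := ih1
    obtain ⟨C, hC⟩ := ih2
    refine ⟨B + C, fun D v w h => ?_⟩
    simp only [Sat, hB D v w (fun i hi => h i (by omega)), hC D v w (fun i hi => h i (by omega))]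
  | neg φ ih =>
    obtain ⟨B, hB⟩ := ih
    refine ⟨B, fun D v w h => ?_⟩
    simp only [Sat, hB D v w h]
  | all n φ ih =>
    obtain ⟨B, hB⟩ := ih
    refine ⟨B, fun D v w h => ?_⟩
    simp only [Sat]
    refine forall₂_congr fun x _ => hB D _ _ fun i hi => ?_
    by_cases hin : i = n
    · subst hin; simp
    · simp [Function.update_of_ne hin, h i hi]

theorem Sat_rename (φ : Fml) : ∀ ρ : ℕ → ℕ, ∃ ψ : Fml, ∀ (D : Set ZFSet.{u}) (v : ℕ → ZFSet.{u}),
    Sat D ψ v ↔ Sat D φ (fun n => v (ρ n)) := by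
  induction φ with
  | mem i j => exact fun ρ => ⟨.mem (ρ i) (ρ j), fun D v => Iff.rfl⟩
  | eq i j => exact fun ρ => ⟨.eq (ρ i) (ρ j), fun D v => Iff.rfl⟩
  | impl φ ψ ih1 ih2 =>
    intro ρ
    obtain ⟨a, ha⟩ := ih1 ρ
    obtain ⟨b, hb⟩ := ih2 ρ
    exact ⟨.impl a b, fun D v => by simp only [Sat, ha, hb]⟩
  | neg φ ih =>
    intro ρ
    obtain ⟨a, ha⟩ := ih ρ
    exact ⟨.neg a, fun D v => by simp only [Sat, ha]⟩
  | all n φ ih =>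
    intro ρ
    obtain ⟨B, hB⟩ := Sat_bound.{u} φ
    set m := (∑ i ∈ Finset.range B, ρ i) + 1 with hm
    have hfresh : ∀ i < B, ρ i < m := fun i hi => by
      have := Finset.single_le_sum (f := ρ) (s := Finset.range B) (fun _ _ => Nat.zero_le _)
        (Finset.mem_range.2 hi)
      omega
    obtain ⟨a, ha⟩ := ih (Function.update ρ n m)
    refine ⟨.all m a, fun D v => ?_⟩
    simp only [Sat, ha]
    refine forall₂_congr fun x _ => hB D _ _ fun i hi => ?_
    by_cases hin : i = n
    · subst hin; simp
    · have := hfresh i hi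
      simp only [Function.update_of_ne hin]
      rw [Function.update_of_ne (by omega)]

theorem Sat_all (ψ : Fml) : ∃ χ : Fml, ∀ (D : Set ZFSet.{u}) (v : ℕ → ZFSet.{u}),
    Sat D χ v ↔ ∀ x ∈ D, Sat D ψ (vc x v) := by
  obtain ⟨B, hB⟩ := Sat_bound.{u} ψ
  obtain ⟨a, ha⟩ := Sat_rename.{u} ψ (fun n => if n = 0 then B else n - 1)
  refine ⟨.all B a, fun D v => ?_⟩
  simp only [Sat, ha]
  refine forall₂_congr fun x _ => hB D _ _ fun i hi => ?_
  cases i with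
  | zero => simp [vc]
  | succ k =>
    simp only [vc, Nat.succ_ne_zero, if_false, Nat.add_sub_cancel]
    rw [Function.update_of_ne (by omega)]

/-- Absolutely definable (bounded) predicates. -/
class D0 (P : (ℕ → ZFSet) → Prop) : Prop where
  out : ∃ φ : Fml, ∀ D : ZFSet, D.IsTransitive → ∀ v : ℕ → ZFSet, (∀ n, v n ∈ D) →
    (Sat D.toSet φ v ↔ P v)

/-- Interleaving of two valuations. -/
def mg (v p : ℕ → ZFSet) (n : ℕ) : ZFSet := if n % 2 = 0 then v (n / 2) else p (n / 2)

theorem mg_even (v p : ℕ → ZFSet) (n : ℕ) : mg v p (2 * n) = v n := by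
  simp [mg]

theorem mg_odd (v p : ℕ → ZFSet) (n : ℕ) : mg v p (2 * n + 1) = p n := by
  have h1 : (2 * n + 1) % 2 = 1 := by omega
  have h2 : (2 * n + 1) / 2 = n := by omega
  simp [mg, h1, h2]

/-- The class of transitive models. -/
class PM (N : ZFSet) : Prop where
  out : IsTransModel N

/-- Predicates definable over `N` with parameters. -/
class Dfn (N : ZFSet) (P : (ℕ → ZFSet) → Prop) : Prop where
  out : ∃ (φ : Fml) (p : ℕ → ZFSet), (∀ n, p n ∈ N) ∧ ∀ v : ℕ → ZFSet, (∀ n, v n ∈ N) →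
    (Sat N.toSet φ (mg v p) ↔ P v)

/-- Terms definable over `N` with parameters. -/
class Tm (N : ZFSet) (t : (ℕ → ZFSet) → ZFSet) : Prop where
  mem : ∀ v : ℕ → ZFSet, (∀ n, v n ∈ N) → t v ∈ N
  gr : Dfn N (fun v => v 0 = t (fun n => v (n + 1)))

theorem vc_mem {N x : ZFSet} {v : ℕ → ZFSet} (hx : x ∈ N) (hv : ∀ n, v n ∈ N) :
    ∀ n, vc x v n ∈ N
  | 0 => hx
  | n + 1 => hv n

section basic
variable {N : ZFSet.{u}}

theorem Dfn.congr {P Q : (ℕ → ZFSet) → Prop} (h : Dfn N P)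
    (hPQ : ∀ v : ℕ → ZFSet, (∀ n, v n ∈ N) → (P v ↔ Q v)) : Dfn N Q := by
  obtain ⟨φ, p, hp, hφ⟩ := h.out
  exact ⟨φ, p, hp, fun v hv => (hφ v hv).trans (hPQ v hv)⟩

theorem mg_split (N : ZFSet.{u}) (φ : Fml) (f : ℕ → ℕ) (g : ℕ → ℕ) :
    ∃ ψ : Fml, ∀ (D : Set ZFSet.{u}) (v : ℕ → ZFSet.{u}), Sat D ψ v ↔ Sat D φ (mg (fun n => v (f n)) (fun n => v (g n))) := by
  obtain ⟨ψ, h⟩ := Sat_rename.{u} φ (fun n => if n % 2 = 0 then f (n / 2) else g (n / 2))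
  refine ⟨ψ, fun D v => (h D v).trans ?_⟩
  have : (fun n => v (if n % 2 = 0 then f (n / 2) else g (n / 2))) =
    mg (fun n => v (f n)) (fun n => v (g n)) := by
    funext n; unfold mg; split_ifs <;> rfl
  rw [this]

theorem Dfn.rename {P : (ℕ → ZFSet) → Prop} (h : Dfn N P) (ρ : ℕ → ℕ) :
    Dfn N (fun v => P (fun n => v (ρ n))) := by
  obtain ⟨φ, p, hp, hφ⟩ := h.out
  obtain ⟨ψ, hψ⟩ := mg_split N φ (fun n => 2 * ρ n) (fun n => 2 * n + 1)
  refine ⟨ψ, p, hp, fun v hv => ?_⟩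
  rw [hψ, ← hφ _ (fun n => hv _)]
  simp only [mg_even, mg_odd]

theorem Dfn.const {P : (ℕ → ZFSet) → Prop} (h : Dfn N P) {c : ZFSet} (hc : c ∈ N) :
    Dfn N (fun v => P (vc c v)) := by
  obtain ⟨φ, p, hp, hφ⟩ := h.out
  obtain ⟨ψ, hψ⟩ := mg_split N φ (fun n => if n = 0 then 1 else 2 * (n - 1))
    (fun n => 2 * (n + 1) + 1)
  refine ⟨ψ, vc c p, vc_mem hc hp, fun v hv => ?_⟩
  rw [hψ, ← hφ _ (vc_mem hc hv)]
  have e : (fun n => mg v (vc c p) (if n = 0 then 1 else 2 * (n - 1))) = vc c v := by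
    funext n
    cases n with
    | zero => exact mg_odd v (vc c p) 0
    | succ k => simp [mg_even, vc]
  rw [e]
  simp only [mg_odd, vc]

instance Dfn.not {P : (ℕ → ZFSet) → Prop} [h : Dfn N P] : Dfn N (fun v => ¬ P v) := by
  obtain ⟨φ, p, hp, hφ⟩ := h.out
  exact ⟨.neg φ, p, hp, fun v hv => by simp only [Sat, hφ v hv]⟩

instance Dfn.imp {P Q : (ℕ → ZFSet) → Prop} [h : Dfn N P] [h' : Dfn N Q] :
    Dfn N (fun v => P v → Q v) := by
  obtain ⟨φ, p, hp, hφ⟩ := h.out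
  obtain ⟨χ, q, hq, hχ⟩ := h'.out
  obtain ⟨ψ, hψ⟩ := mg_split N φ (fun n => 2 * n) (fun n => 2 * (2 * n) + 1)
  obtain ⟨θ, hθ⟩ := mg_split N χ (fun n => 2 * n) (fun n => 2 * (2 * n + 1) + 1)
  refine ⟨.impl ψ θ, mg p q, fun n => ?_, fun v hv => ?_⟩
  · unfold mg; split_ifs; exacts [hp _, hq _]
  · simp only [Sat, hψ, hθ, mg_even, mg_odd, ← hφ v hv, ← hχ v hv]

instance Dfn.and {P Q : (ℕ → ZFSet) → Prop} [h : Dfn N P] [h' : Dfn N Q] :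
    Dfn N (fun v => P v ∧ Q v) :=
  Dfn.congr (P := fun v => ¬ (P v → ¬ Q v)) inferInstance fun v _ => by tauto

instance Dfn.or {P Q : (ℕ → ZFSet) → Prop} [h : Dfn N P] [h' : Dfn N Q] :
    Dfn N (fun v => P v ∨ Q v) :=
  Dfn.congr (P := fun v => ¬ P v → Q v) inferInstance fun v _ => by tauto

instance Dfn.iff {P Q : (ℕ → ZFSet) → Prop} [h : Dfn N P] [h' : Dfn N Q] :
    Dfn N (fun v => P v ↔ Q v) :=
  Dfn.congr (P := fun v => (P v → Q v) ∧ (Q v → P v)) inferInstance fun v _ => by tauto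

instance Dfn.allN {P : ZFSet → (ℕ → ZFSet) → Prop}
    [h : Dfn N (fun v => P (v 0) (fun n => v (n + 1)))] :
    Dfn N (fun v => ∀ x, x ∈ N → P x v) := by
  obtain ⟨φ, p, hp, hφ⟩ := h.out
  obtain ⟨ψ, hψ⟩ := mg_split N φ (fun n => if n = 0 then 0 else 2 * (n - 1) + 1)
    (fun n => 2 * n + 2)
  obtain ⟨χ, hχ⟩ := Sat_all.{u} ψ
  refine ⟨χ, p, hp, fun v hv => ?_⟩
  rw [hχ]
  refine forall₂_congr fun x hx => ?_
  rw [hψ]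
  have := hφ (vc x v) (vc_mem hx hv)
  refine Iff.trans ?_ this
  have e : (fun n => vc x (mg v p) (if n = 0 then 0 else 2 * (n - 1) + 1)) = vc x v := by
    funext n
    cases n with
    | zero => rfl
    | succ k => simp [mg_even, vc]
  rw [e]
  simp only [vc, mg_odd]

instance Dfn.exN {P : ZFSet → (ℕ → ZFSet) → Prop}
    [h : Dfn N (fun v => P (v 0) (fun n => v (n + 1)))] :
    Dfn N (fun v => ∃ x, x ∈ N ∧ P x v) :=
  Dfn.congr (P := fun v => ¬ ∀ x, x ∈ N → ¬ P x v) inferInstance fun v _ => by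
    push Not; rfl

theorem Dfn.var_mem (i j : ℕ) (hN : ∃ x, x ∈ N) : Dfn N (fun v => v i ∈ v j) := by
  obtain ⟨x, hx⟩ := hN
  refine ⟨.mem (2 * i) (2 * j), fun _ => x, fun _ => hx, fun v _ => ?_⟩
  simp only [Sat, mg_even]

theorem Dfn.var_eq (i j : ℕ) (hN : ∃ x, x ∈ N) : Dfn N (fun v => v i = v j) := by
  obtain ⟨x, hx⟩ := hN
  refine ⟨.eq (2 * i) (2 * j), fun _ => x, fun _ => hx, fun v _ => ?_⟩
  simp only [Sat, mg_even]

theorem Dfn.subst1 {P : (ℕ → ZFSet) → Prop} (h : Dfn N P) {t : (ℕ → ZFSet) → ZFSet}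
    (ht : Tm N t) : Dfn N (fun v => P (vc (t v) v)) := by
  have := ht.gr
  have h2 : Dfn N (fun v => P (vc (v 0) (fun n => v (n + 1)))) :=
    h.congr fun v _ => by
      have : vc (v 0) (fun n => v (n + 1)) = v := by funext n; cases n <;> rfl
      rw [this]
  refine Dfn.congr (P := fun v => ∃ x, x ∈ N ∧ (x = t v ∧ P (vc x v))) ?_ ?_
  · have := @Dfn.and _ _ _ this h2
    exact Dfn.exN
  · intro v hv
    exact ⟨fun ⟨x, _, e, h⟩ => e ▸ h, fun h => ⟨_, ht.mem v hv, rfl, h⟩⟩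

theorem Tm.rename {t : (ℕ → ZFSet) → ZFSet} (ht : Tm N t) (ρ : ℕ → ℕ) :
    Tm N (fun v => t (fun n => v (ρ n))) where
  mem v hv := ht.mem _ fun n => hv _
  gr := (ht.gr.rename (fun n => match n with | 0 => 0 | k + 1 => ρ k + 1))

theorem Dfn.comp1 {R : ZFSet → Prop} (h : Dfn N (fun v => R (v 0)))
    {s : (ℕ → ZFSet) → ZFSet} (hs : Tm N s) : Dfn N (fun v => R (s v)) :=
  h.subst1 hs

theorem Dfn.comp2 {R : ZFSet → ZFSet → Prop} (h : Dfn N (fun v => R (v 0) (v 1)))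
    {s t : (ℕ → ZFSet) → ZFSet} (hs : Tm N s) (ht : Tm N t) :
    Dfn N (fun v => R (s v) (t v)) := by
  have h1 := (h.rename (fun n => if n = 0 then 1 else 0)).subst1 (ht.rename Nat.succ)
  have h2 := h1.subst1 hs
  exact h2

theorem Dfn.comp3 {R : ZFSet → ZFSet → ZFSet → Prop}
    (h : Dfn N (fun v => R (v 0) (v 1) (v 2)))
    {s t u : (ℕ → ZFSet) → ZFSet} (hs : Tm N s) (ht : Tm N t) (hu : Tm N u) :
    Dfn N (fun v => R (s v) (t v) (u v)) := by
  have h1 := (h.rename (fun n => if n = 0 then 1 else if n = 1 then 2 else 0)).subst1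
    (hu.rename (fun n => n + 2))
  have h2 := (h1.rename (fun n => if n = 0 then 1 else if n = 1 then 0 else n)).subst1
    (ht.rename Nat.succ)
  exact h2.subst1 hs

theorem Tm.of_graph {t : (ℕ → ZFSet) → ZFSet} (hm : ∀ v : ℕ → ZFSet, (∀ n, v n ∈ N) → t v ∈ N)
    {P : (ℕ → ZFSet) → Prop} (h : Dfn N P)
    (hP : ∀ v : ℕ → ZFSet, (∀ n, v n ∈ N) → (P v ↔ v 0 = t (fun n => v (n + 1)))) : Tm N t :=
  ⟨hm, h.congr hP⟩

theorem Tm.congr {s t : (ℕ → ZFSet) → ZFSet} (h : Tm N s)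
    (hst : ∀ v : ℕ → ZFSet, (∀ n, v n ∈ N) → s v = t v) : Tm N t where
  mem v hv := hst v hv ▸ h.mem v hv
  gr := h.gr.congr fun v hv => by rw [hst _ fun n => hv _]

instance Tm.const {c : ZFSet} [h : Fact (c ∈ N)] : Tm N (fun _ => c) where
  mem v hv := h.out
  gr := ((Dfn.var_eq 1 0 ⟨c, h.out⟩).const h.out)

theorem Tm.out {c : ZFSet} (h : Tm N (fun _ => c)) (hN : ∃ x, x ∈ N) : c ∈ N := by
  obtain ⟨x, hx⟩ := hN
  exact h.mem (fun _ => x) fun _ => hx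

end basic

section model
variable {N : ZFSet.{u}} [hN : PM N]

theorem PM.tr (N : ZFSet) [hN : PM N] : N.IsTransitive := hN.out.1
theorem PM.om (N : ZFSet) [hN : PM N] : omega ∈ N := hN.out.2.1
instance PM.omF : Fact (omega ∈ N) := ⟨hN.out.2.1⟩
theorem PM.ne (N : ZFSet) [hN : PM N] : ∃ x, x ∈ N := ⟨_, PM.om N⟩
theorem PM.mem {x y : ZFSet} (hy : y ∈ N) (hx : x ∈ y) : x ∈ N := PM.tr N _ hy hx

theorem Tm.mem_out {c : ZFSet} (h : Tm N (fun _ => c)) : c ∈ N := h.out (PM.ne N)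

instance Tm.var {i : ℕ} : Tm N (fun v => v i) where
  mem v hv := hv i
  gr := Dfn.var_eq 0 (i + 1) (PM.ne N)

instance Dfn.mem {s t : (ℕ → ZFSet) → ZFSet} [hs : Tm N s] [ht : Tm N t] :
    Dfn N (fun v => s v ∈ t v) :=
  Dfn.comp2 (R := fun a b => a ∈ b) (Dfn.var_mem 0 1 (PM.ne N)) hs ht

instance Dfn.eq {s t : (ℕ → ZFSet) → ZFSet} [hs : Tm N s] [ht : Tm N t] :
    Dfn N (fun v => s v = t v) :=
  Dfn.comp2 (R := fun a b => a = b) (Dfn.var_eq 0 1 (PM.ne N)) hs ht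

instance Dfn.all {t : (ℕ → ZFSet) → ZFSet} {P : ZFSet → (ℕ → ZFSet) → Prop} [ht : Tm N t]
    [h : Dfn N (fun v => P (v 0) (fun n => v (n + 1)))] :
    Dfn N (fun v => ∀ x, x ∈ t v → P x v) := by
  have h1 : Tm N (fun v => t (fun n => v (n + 1))) := ht.rename Nat.succ
  have h2 : Dfn N (fun v => v 0 ∈ t (fun n => v (n + 1)) → P (v 0) (fun n => v (n + 1))) :=
    inferInstance
  refine Dfn.congr (@Dfn.allN N (fun x v => x ∈ t v → P x v) h2) fun v hv => ?_
  exact ⟨fun H x hx => H x (PM.mem (ht.mem v hv) hx) hx, fun H x _ hx => H x hx⟩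

instance Dfn.ex {t : (ℕ → ZFSet) → ZFSet} {P : ZFSet → (ℕ → ZFSet) → Prop} [ht : Tm N t]
    [h : Dfn N (fun v => P (v 0) (fun n => v (n + 1)))] :
    Dfn N (fun v => ∃ x, x ∈ t v ∧ P x v) :=
  Dfn.congr (P := fun v => ¬ ∀ x, x ∈ t v → ¬ P x v) inferInstance fun v _ => by
    push Not; rfl

instance Dfn.sub {s t : (ℕ → ZFSet) → ZFSet} [hs : Tm N s] [ht : Tm N t] :
    Dfn N (fun v => s v ⊆ t v) :=
  haveI := ht.rename Nat.succ
  Dfn.congr (P := fun v => ∀ x, x ∈ s v → x ∈ t v) (Dfn.all (P := fun x v => x ∈ t v)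
    (h := by exact Dfn.mem (t := fun v => t (fun n => v (n + 1))))) fun v _ => Iff.rfl

theorem Tm.of_ext {t : (ℕ → ZFSet) → ZFSet} (hm : ∀ v : ℕ → ZFSet, (∀ n, v n ∈ N) → t v ∈ N)
    {P : ZFSet → (ℕ → ZFSet) → Prop} [h : Dfn N (fun v => P (v 0) (fun n => v (n + 1)))]
    (hP : ∀ v : ℕ → ZFSet, (∀ n, v n ∈ N) → ∀ x ∈ N, (x ∈ t v ↔ P x v)) : Tm N t := by
  have h3 : Dfn N (fun v => P (v 0) (fun n => v (n + 2))) :=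
    h.rename (fun n => match n with | 0 => 0 | k + 1 => k + 2)
  have h4 : Dfn N (fun v => v 0 ∈ v 1 ↔ P (v 0) (fun n => v (n + 2))) := inferInstance
  refine Tm.of_graph hm (@Dfn.allN N (fun x v => x ∈ v 0 ↔ P x (fun n => v (n + 1))) h4) ?_
  intro v hv
  constructor
  · intro H
    ext x
    constructor
    · intro hx
      have hxN := PM.mem (hv 0) hx
      exact (hP _ (fun n => hv _) x hxN).2 ((H x hxN).1 hx)
    · intro hx
      have hxN := PM.mem (hm _ fun n => hv (n + 1)) hx
      exact (H x hxN).2 ((hP _ (fun n => hv _) x hxN).1 hx)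
  · intro e x hx
    rw [e]
    exact hP _ (fun n => hv _) x hx

theorem Tm.comp1 {F : ZFSet → ZFSet} (h : Tm N (fun v => F (v 0)))
    {s : (ℕ → ZFSet) → ZFSet} (hs : Tm N s) : Tm N (fun v => F (s v)) where
  mem v hv := h.mem (fun _ => s v) fun _ => hs.mem v hv
  gr := by
    have hs' : Tm N (fun v => s (fun n => v (n + 1))) := hs.rename Nat.succ
    exact Dfn.comp2 (R := fun a b => a = F b) h.gr Tm.var hs'

theorem Tm.comp2 {F : ZFSet → ZFSet → ZFSet} (h : Tm N (fun v => F (v 0) (v 1)))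
    {s t : (ℕ → ZFSet) → ZFSet} (hs : Tm N s) (ht : Tm N t) : Tm N (fun v => F (s v) (t v)) where
  mem v hv := h.mem (fun n => if n = 0 then s v else t v) fun n => by
    split_ifs; exacts [hs.mem v hv, ht.mem v hv]
  gr := by
    have hs' : Tm N (fun v => s (fun n => v (n + 1))) := hs.rename Nat.succ
    have ht' : Tm N (fun v => t (fun n => v (n + 1))) := ht.rename Nat.succ
    exact Dfn.comp3 (R := fun a b c => a = F b c) h.gr Tm.var hs' ht'

theorem PM.pair2 {x y : ZFSet} (hx : x ∈ N) (hy : y ∈ N) : ({x, y} : ZFSet) ∈ N :=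
  hN.out.2.2.1 x hx y hy

instance Tm.upair {s t : (ℕ → ZFSet) → ZFSet} [hs : Tm N s] [ht : Tm N t] :
    Tm N (fun v => ({s v, t v} : ZFSet)) :=
  Tm.comp2 (F := fun a b => ({a, b} : ZFSet)) (Tm.of_ext (P := fun x v => x = v 0 ∨ x = v 1)
    (fun v hv => PM.pair2 (hv 0) (hv 1)) (fun v hv x hx => by simp)) hs ht

instance Tm.sing {s : (ℕ → ZFSet) → ZFSet} [hs : Tm N s] :
    Tm N (fun v => ({s v} : ZFSet)) :=
  Tm.congr (s := fun v => ({s v, s v} : ZFSet)) inferInstance fun v _ => by simp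

instance Tm.pair {s t : (ℕ → ZFSet) → ZFSet} [hs : Tm N s] [ht : Tm N t] :
    Tm N (fun v => ZFSet.pair (s v) (t v)) :=
  Tm.congr (s := fun v => ({{s v}, {s v, t v}} : ZFSet)) inferInstance fun v _ => rfl

instance Tm.sUnion {s : (ℕ → ZFSet) → ZFSet} [hs : Tm N s] :
    Tm N (fun v => (⋃₀ (s v) : ZFSet)) :=
  Tm.comp1 (F := fun a => (⋃₀ a : ZFSet)) (Tm.of_ext (P := fun x v => ∃ z, z ∈ v 0 ∧ x ∈ z)
    (fun v hv => hN.out.2.2.2.1 _ (hv 0)) (fun v hv x hx => by simp)) hs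

instance Tm.union {s t : (ℕ → ZFSet) → ZFSet} [hs : Tm N s] [ht : Tm N t] :
    Tm N (fun v => s v ∪ t v) :=
  Tm.congr (s := fun v => (⋃₀ {s v, t v} : ZFSet)) inferInstance fun v _ => by
    ext; simp

instance Tm.insert {s t : (ℕ → ZFSet) → ZFSet} [hs : Tm N s] [ht : Tm N t] :
    Tm N (fun v => Insert.insert (s v) (t v)) :=
  Tm.congr (s := fun v => ({s v} : ZFSet) ∪ t v) inferInstance fun v _ => by
    ext; simp

/-- Separation in `N`. -/
theorem PM.sepv {P : ZFSet → (ℕ → ZFSet) → Prop} (h : Dfn N (fun v => P (v 0) (fun n => v (n + 1))))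
    {v : ℕ → ZFSet} (hv : ∀ n, v n ∈ N) {a : ZFSet} (ha : a ∈ N) :
    ZFSet.sep (fun x => P x v) a ∈ N := by
  obtain ⟨φ, p, hp, hφ⟩ := h.out
  have hb := hN.out.2.2.2.2.1 φ (mg (vc a v) p) (fun n => by
    unfold mg; split_ifs; exacts [vc_mem ha hv _, hp _]) a ha
  obtain ⟨b, hb, H⟩ := hb
  convert hb
  ext x
  rw [ZFSet.mem_sep, H x]
  refine and_congr_right fun hx => ?_
  refine Iff.trans (hφ (vc x v) (vc_mem (PM.mem ha hx) hv)).symm ?_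
  have : Function.update (mg (vc a v) p) 0 x = mg (vc x v) p := by
    funext n
    by_cases hn : n = 0
    · subst hn; simp [mg, vc]
    · rw [Function.update_of_ne hn]
      unfold mg
      split_ifs with h2
      · obtain ⟨k, hk⟩ : ∃ k, n / 2 = k + 1 := ⟨n / 2 - 1, by omega⟩
        rw [hk]; rfl
      · rfl
  rw [this]

theorem PM.coll {P : ZFSet → ZFSet → (ℕ → ZFSet) → Prop}
    (h : Dfn N (fun v => P (v 0) (v 1) (fun n => v (n + 2))))
    {v : ℕ → ZFSet} (hv : ∀ n, v n ∈ N) {a : ZFSet} (ha : a ∈ N)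
    (H : ∀ x ∈ a, ∃ y ∈ N, P x y v) : ∃ b ∈ N, ∀ x ∈ a, ∃ y ∈ b, P x y v := by
  obtain ⟨φ, p, hp, hφ⟩ := h.out
  obtain ⟨ψ, hψ⟩ := mg_split N φ (fun n => if n = 0 then 0 else if n = 1 then 1 else 2 * (n - 1))
    (fun n => 2 * n + 3)
  have key : ∀ x ∈ N, ∀ y ∈ N, (Sat N.toSet ψ (Function.update (Function.update
      (mg (vc a v) (vc a p)) 0 x) 1 y) ↔ P x y v) := by
    intro x hx y hy
    rw [hψ]
    refine Iff.trans ?_ (hφ (vc x (vc y v)) (vc_mem hx (vc_mem hy hv)))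
    have e1 : (fun n => (Function.update (Function.update
      (mg (vc a v) (vc a p)) 0 x) 1 y) (if n = 0 then 0 else if n = 1 then 1 else 2 * (n - 1)))
      = vc x (vc y v) := by
      funext n
      match n with
      | 0 => simp [vc]
      | 1 => simp [vc]
      | k + 2 =>
        have h0 : k + 2 ≠ 0 := by omega
        have h1 : k + 2 ≠ 1 := by omega
        simp only [h0, h1, if_false]
        rw [Function.update_of_ne (by omega), Function.update_of_ne (by omega), mg_even]
        rfl
    have e2 : (fun n => (Function.update (Function.update
      (mg (vc a v) (vc a p)) 0 x) 1 y) (2 * n + 3)) = p := by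
      funext n
      rw [Function.update_of_ne (by omega), Function.update_of_ne (by omega)]
      have : 2 * n + 3 = 2 * (n + 1) + 1 := by ring
      rw [this, mg_odd]; rfl
    rw [e1, e2]
  obtain ⟨b, hb, H2⟩ := hN.out.2.2.2.2.2.1 ψ (mg (vc a v) (vc a p)) (fun n => by
    unfold mg; split_ifs; exacts [vc_mem ha hv _, vc_mem ha hp _]) a ha (by
      intro x hx
      obtain ⟨y, hy, h⟩ := H x hx
      exact ⟨y, hy, (key x (PM.mem ha hx) y hy).2 h⟩)
  refine ⟨b, hb, fun x hx => ?_⟩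
  obtain ⟨y, hy, h⟩ := H2 x hx
  exact ⟨y, hy, (key x (PM.mem ha hx) y (PM.mem hb hy)).1 h⟩

instance Tm.sep {t : (ℕ → ZFSet) → ZFSet} {P : ZFSet → (ℕ → ZFSet) → Prop} [ht : Tm N t]
    [h : Dfn N (fun v => P (v 0) (fun n => v (n + 1)))] :
    Tm N (fun v => ZFSet.sep (fun x => P x v) (t v)) := by
  have h1 : Tm N (fun v => t (fun n => v (n + 1))) := ht.rename Nat.succ
  refine Tm.of_ext (P := fun x v => x ∈ t v ∧ P x v) (fun v hv => PM.sepv h hv (ht.mem v hv)) ?_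
  intro v hv x hx
  simp

instance Tm.inter {s t : (ℕ → ZFSet) → ZFSet} [hs : Tm N s] [ht : Tm N t] :
    Tm N (fun v => s v ∩ t v) := by
  have h1 : Tm N (fun v => t (fun n => v (n + 1))) := ht.rename Nat.succ
  exact Tm.congr (s := fun v => ZFSet.sep (fun x => x ∈ t v) (s v)) inferInstance fun v _ => by
    ext; simp

instance Tm.fapp {s t : (ℕ → ZFSet) → ZFSet} [hs : Tm N s] [ht : Tm N t] :
    Tm N (fun v => MPaper.fapp (s v) (t v)) :=
  Tm.comp2 (F := MPaper.fapp) (by unfold MPaper.fapp; infer_instance) hs ht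

/-- Image of a set under a class function. -/
def img (F : ZFSet.{u} → ZFSet.{u}) (s : ZFSet.{u}) : ZFSet.{u} :=
  ZFSet.range (fun x : s => F x.1)

theorem mem_img {F : ZFSet → ZFSet} {s y : ZFSet} : y ∈ img F s ↔ ∃ x ∈ s, F x = y := by
  unfold img
  rw [ZFSet.mem_range]
  exact ⟨fun ⟨x, h⟩ => ⟨x.1, x.2, h⟩, fun ⟨x, hx, h⟩ => ⟨⟨x, hx⟩, h⟩⟩

instance Tm.img {t : (ℕ → ZFSet) → ZFSet} {F : ZFSet → (ℕ → ZFSet) → ZFSet} [ht : Tm N t]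
    [h : Tm N (fun v => F (v 0) (fun n => v (n + 1)))] :
    Tm N (fun v => MPaper.img (fun x => F x v) (t v)) := by
  have h1 : Tm N (fun v => t (fun n => v (n + 1))) := ht.rename Nat.succ
  have hmem : ∀ v : ℕ → ZFSet, (∀ n, v n ∈ N) → ∀ x ∈ N, F x v ∈ N := fun v hv x hx =>
    h.mem (vc x v) (vc_mem hx hv)
  have h5 : Tm N (fun v => F (v 0) (fun n => v (n + 2))) :=
    h.rename (fun n => match n with | 0 => 0 | k + 1 => k + 2)
  have h6 : Dfn N (fun v => v 1 = F (v 0) (fun n => v (n + 2))) := inferInstance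
  refine Tm.of_ext (P := fun y v => ∃ x, x ∈ t v ∧ F x v = y) (fun v hv => ?_) ?_
  · obtain ⟨b, hb, H⟩ := PM.coll (P := fun x y v => y = F x v) h6 hv (ht.mem v hv)
      (fun x hx => ⟨_, hmem v hv x (PM.mem (ht.mem v hv) hx), rfl⟩)
    have hh : Dfn N (fun v => ∃ x, x ∈ t (fun n => v (n + 1)) ∧
        v 0 = F x (fun n => v (n + 1))) := by
      have : Dfn N (fun v => v 1 = F (v 0) (fun n => v (n + 2))) := h6
      exact Dfn.ex (t := fun v => t (fun n => v (n + 1)))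
        (P := fun x v => v 0 = F x (fun n => v (n + 1))) (h := h6)
    have := PM.sepv (P := fun y v => ∃ x, x ∈ t v ∧ y = F x v) hh hv hb
    convert this
    ext y
    rw [mem_img, ZFSet.mem_sep]
    constructor
    · rintro ⟨x, hx, rfl⟩
      obtain ⟨y, hy, e⟩ := H x hx
      exact ⟨e ▸ hy, x, hx, rfl⟩
    · rintro ⟨_, x, hx, e⟩
      exact ⟨x, hx, e.symm⟩
  · intro v hv x hx
    rw [mem_img]

/-- Set-coded function with domain `s`. -/
def lam (s : ZFSet.{u}) (F : ZFSet.{u} → ZFSet.{u}) : ZFSet.{u} := img (fun x => ZFSet.pair x (F x)) s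

instance Tm.lam {t : (ℕ → ZFSet) → ZFSet} {F : ZFSet → (ℕ → ZFSet) → ZFSet} [ht : Tm N t]
    [h : Tm N (fun v => F (v 0) (fun n => v (n + 1)))] :
    Tm N (fun v => MPaper.lam (t v) (fun x => F x v)) := by
  unfold MPaper.lam; infer_instance

instance Tm.prod {s t : (ℕ → ZFSet) → ZFSet} [hs : Tm N s] [ht : Tm N t] :
    Tm N (fun v => ZFSet.prod (s v) (t v)) := by
  have h1 : Tm N (fun v => t (fun n => v (n + 1))) := ht.rename Nat.succ
  refine Tm.congr (s := fun v => (⋃₀ (MPaper.img (fun x => MPaper.img (fun y => ZFSet.pair x y) (t v)) (s v)) : ZFSet))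
    ?_ ?_
  · infer_instance
  · intro v _
    ext z
    simp only [ZFSet.mem_sUnion, mem_img, ZFSet.mem_prod]
    constructor
    · rintro ⟨_, ⟨x, hx, rfl⟩, h⟩
      obtain ⟨y, hy, rfl⟩ := mem_img.1 h
      exact ⟨x, hx, y, hy, rfl⟩
    · rintro ⟨x, hx, y, hy, rfl⟩
      exact ⟨_, ⟨x, hx, rfl⟩, mem_img.2 ⟨y, hy, rfl⟩⟩

instance Tm.ite {s t : (ℕ → ZFSet) → ZFSet} {P : (ℕ → ZFSet) → Prop} [hs : Tm N s] [ht : Tm N t]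
    [h : Dfn N P] {inst : ∀ v, Decidable (P v)} :
    Tm N (fun v => @_root_.ite _ (P v) (inst v) (s v) (t v)) := by
  have h1 : Tm N (fun v => t (fun n => v (n + 1))) := ht.rename Nat.succ
  have h2 : Tm N (fun v => s (fun n => v (n + 1))) := hs.rename Nat.succ
  have h3 : Dfn N (fun v => P (fun n => v (n + 1))) := h.rename Nat.succ
  refine Tm.of_ext (P := fun x v => (P v ∧ x ∈ s v) ∨ (¬ P v ∧ x ∈ t v)) (fun v hv => ?_) ?_
  · split_ifs; exacts [hs.mem v hv, ht.mem v hv]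
  · intro v _ x _; split_ifs with hP <;> simp [hP]

instance Dfn.true : Dfn N (fun _ => True) :=
  Dfn.congr (P := fun v => v 0 = v 0) inferInstance fun v _ => by simp
instance Dfn.false : Dfn N (fun _ => False) :=
  Dfn.congr (P := fun v => ¬ (v 0 = v 0)) inferInstance fun v _ => by simp

theorem PM.empty (N : ZFSet) [hN : PM N] : (∅ : ZFSet) ∈ N := PM.mem (PM.om N) ZFSet.omega_zero
instance PM.emptyF : Fact ((∅ : ZFSet) ∈ N) := ⟨PM.empty N⟩

end model

/-! ### Functions, ordinals, recursion -/

theorem fapp_of {f a b : ZFSet.{u}} (h : ZFSet.pair a b ∈ f)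
    (uq : ∀ c, ZFSet.pair a c ∈ f → c = b) : fapp f a = b := by
  unfold fapp
  have : ZFSet.sep (fun b => ZFSet.pair a b ∈ f) (⋃₀ (⋃₀ f)) = ({b} : ZFSet) := by
    ext c
    rw [ZFSet.mem_sep, ZFSet.mem_singleton]
    constructor
    · rintro ⟨_, hc⟩; exact uq c hc
    · rintro rfl
      refine ⟨?_, h⟩
      simp only [ZFSet.mem_sUnion]
      refine ⟨{a, c}, ⟨_, h, ?_⟩, ?_⟩
      · simp [ZFSet.pair]
      · simp
  rw [this, ZFSet.sUnion_singleton]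

theorem fapp_none {f a : ZFSet.{u}} (h : ∀ c, ZFSet.pair a c ∉ f) : fapp f a = ∅ := by
  unfold fapp
  have : ZFSet.sep (fun b => ZFSet.pair a b ∈ f) (⋃₀ (⋃₀ f)) = (∅ : ZFSet) := by
    ext c
    simp [h c]
  rw [this, ZFSet.sUnion_empty]

theorem IsZFunc.mem {d f a : ZFSet.{u}} (h : IsZFunc d f) (ha : a ∈ d) :
    ZFSet.pair a (fapp f a) ∈ f := by
  obtain ⟨b, hb, uq⟩ := h.2 a ha
  rw [fapp_of hb uq]; exact hb

theorem IsZFunc.eq {d f a b : ZFSet.{u}} (h : IsZFunc d f) (hb : ZFSet.pair a b ∈ f) :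
    a ∈ d ∧ fapp f a = b := by
  obtain ⟨a', ha, b', e⟩ := h.1 _ hb
  obtain ⟨rfl, rfl⟩ := ZFSet.pair_inj.1 e
  obtain ⟨c, hc, uq⟩ := h.2 a ha
  refine ⟨ha, fapp_of hb fun c' hc' => ?_⟩
  rw [uq _ hc', uq _ hb]

theorem pair_mem_lam {s a b : ZFSet.{u}} {F : ZFSet.{u} → ZFSet.{u}} :
    ZFSet.pair a b ∈ lam s F ↔ a ∈ s ∧ b = F a := by
  unfold lam
  rw [mem_img]
  constructor
  · rintro ⟨x, hx, e⟩
    obtain ⟨rfl, rfl⟩ := ZFSet.pair_inj.1 e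
    exact ⟨hx, rfl⟩
  · rintro ⟨ha, rfl⟩
    exact ⟨a, ha, rfl⟩

theorem mem_lam {s p : ZFSet.{u}} {F : ZFSet.{u} → ZFSet.{u}} :
    p ∈ lam s F ↔ ∃ x ∈ s, p = ZFSet.pair x (F x) := by
  unfold lam
  rw [mem_img]
  exact exists_congr fun x => and_congr_right fun _ => eq_comm

theorem fapp_lam {s a : ZFSet.{u}} {F : ZFSet.{u} → ZFSet.{u}} (ha : a ∈ s) :
    fapp (lam s F) a = F a :=
  fapp_of (pair_mem_lam.2 ⟨ha, rfl⟩) fun _ hc => (pair_mem_lam.1 hc).2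

theorem isZFunc_lam (s : ZFSet.{u}) (F : ZFSet.{u} → ZFSet.{u}) : IsZFunc s (lam s F) := by
  constructor
  · intro p hp
    obtain ⟨x, hx, rfl⟩ := mem_lam.1 hp
    exact ⟨x, hx, _, rfl⟩
  · intro a ha
    exact ⟨F a, pair_mem_lam.2 ⟨ha, rfl⟩, fun c hc => (pair_mem_lam.1 hc).2⟩

theorem lam_congr {s : ZFSet.{u}} {F G : ZFSet.{u} → ZFSet.{u}} (h : ∀ x ∈ s, F x = G x) :
    lam s F = lam s G := by
  ext p
  simp only [mem_lam]
  exact exists_congr fun x => and_congr_right fun hx => by rw [h x hx]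

theorem img_congr {s : ZFSet.{u}} {F G : ZFSet.{u} → ZFSet.{u}} (h : ∀ x ∈ s, F x = G x) :
    img F s = img G s := by
  ext p
  simp only [mem_img]
  exact exists_congr fun x => and_congr_right fun hx => by rw [h x hx]

theorem IsZFunc.eta {d f : ZFSet.{u}} (h : IsZFunc d f) : f = lam d (fapp f) := by
  ext p
  rw [mem_lam]
  constructor
  · intro hp
    obtain ⟨a, ha, b, rfl⟩ := h.1 p hp
    exact ⟨a, ha, by rw [(h.eq hp).2]⟩
  · rintro ⟨x, hx, rfl⟩
    exact h.mem hx

theorem isZFunc_iff {d f : ZFSet.{u}} : IsZFunc d f ↔ f = lam d (fapp f) :=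
  ⟨IsZFunc.eta, fun h => h ▸ isZFunc_lam _ _⟩

theorem IsZFunc.ext {d f g : ZFSet.{u}} (hf : IsZFunc d f) (hg : IsZFunc d g)
    (h : ∀ x ∈ d, fapp f x = fapp g x) : f = g := by
  rw [hf.eta, hg.eta]; exact lam_congr h

theorem IsZFunc.off {d f a : ZFSet.{u}} (hf : IsZFunc d f) (h : a ∉ d) : fapp f a = ∅ :=
  fapp_none fun _ hc => h (hf.eq hc).1

section
variable {N : ZFSet.{u}} [hN : PM N]

instance Dfn.isZFunc {s t : (ℕ → ZFSet) → ZFSet} [hs : Tm N s] [ht : Tm N t] :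
    Dfn N (fun v => IsZFunc (s v) (t v)) :=
  Dfn.comp2 (R := IsZFunc) (Dfn.congr (P := fun v => v 1 = MPaper.lam (v 0) (fun x => fapp (v 1) x))
    inferInstance fun v _ => isZFunc_iff.symm) hs ht

instance Dfn.isTransitive {s : (ℕ → ZFSet) → ZFSet} [hs : Tm N s] :
    Dfn N (fun v => (s v).IsTransitive) :=
  Dfn.comp1 (R := fun x => x.IsTransitive) (by unfold ZFSet.IsTransitive; infer_instance) hs

instance Dfn.isOrd {s : (ℕ → ZFSet) → ZFSet} [hs : Tm N s] :
    Dfn N (fun v => IsOrd (s v)) :=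
  Dfn.comp1 (R := fun x => IsOrd x) (by unfold IsOrd; infer_instance) hs

end

theorem IsOrd.ord {x : ZFSet.{u}} (h : IsOrd x) : x.IsOrdinal :=
  ZFSet.isOrdinal_iff_forall_mem_isTransitive.2 h

theorem _root_.ZFSet.IsOrdinal.isOrd {x : ZFSet.{u}} (h : x.IsOrdinal) : IsOrd x :=
  ZFSet.isOrdinal_iff_forall_mem_isTransitive.1 h

theorem IsOrd.mem {x y : ZFSet.{u}} (h : IsOrd x) (hy : y ∈ x) : IsOrd y := (h.ord.mem hy).isOrd

theorem IsOrd.trans {x y z : ZFSet.{u}} (h : IsOrd x) (hy : y ∈ x) (hz : z ∈ y) : z ∈ x :=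
  h.1 y hy hz

theorem IsOrd.tri {x y : ZFSet.{u}} (h : IsOrd x) (h' : IsOrd y) : x ∈ y ∨ x = y ∨ y ∈ x :=
  h.ord.mem_trichotomous h'.ord

theorem IsOrd.sub_iff {x y : ZFSet.{u}} (h : IsOrd x) (h' : IsOrd y) : x ⊆ y ↔ x = y ∨ x ∈ y :=
  h.ord.subset_iff_eq_or_mem h'.ord

theorem IsOrd.mem_or_sub {x y : ZFSet.{u}} (h : IsOrd x) (h' : IsOrd y) : x ∈ y ∨ y ⊆ x :=
  h.ord.mem_or_subset h'.ord

theorem IsOrd.succ {x : ZFSet.{u}} (h : IsOrd x) : IsOrd (insert x x) :=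
  (ZFSet.isOrdinal_succ h.ord).isOrd

theorem IsOrd.empty : IsOrd (∅ : ZFSet.{u}) := ZFSet.isOrdinal_empty.isOrd

theorem IsOrd.sUnion {x : ZFSet.{u}} (h : ∀ y ∈ x, IsOrd y) : IsOrd (⋃₀ x : ZFSet) := by
  constructor
  · exact ZFSet.IsTransitive.sUnion' fun y hy => (h y hy).1
  · intro z hz
    obtain ⟨y, hy, hz⟩ := ZFSet.mem_sUnion.1 hz
    exact (h y hy).2 z hz

/-- Finite ordinals. -/
def nn : ℕ → ZFSet.{u}
  | 0 => ∅
  | n + 1 => insert (nn n) (nn n)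

theorem nn_mem_omega : ∀ n, nn.{u} n ∈ omega.{u}
  | 0 => ZFSet.omega_zero
  | n + 1 => ZFSet.omega_succ (nn_mem_omega n)

theorem nn_eq_mk (n : ℕ) : nn.{u} n = ZFSet.mk (PSet.ofNat n) := by
  induction n with
  | zero => rfl
  | succ n ih => rw [nn, ih]; rfl

theorem mem_omega {x : ZFSet.{u}} : x ∈ omega.{u} ↔ ∃ n, x = nn n := by
  constructor
  · refine Quotient.inductionOn x fun y => ?_
    rintro ⟨⟨n⟩, h⟩
    refine ⟨n, ?_⟩
    rw [nn_eq_mk]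
    exact ZFSet.sound h
  · rintro ⟨n, rfl⟩; exact nn_mem_omega n

theorem mem_nn {x : ZFSet.{u}} {n : ℕ} : x ∈ nn n ↔ ∃ k < n, x = nn k := by
  induction n with
  | zero => simp [nn]
  | succ n ih =>
    rw [nn, ZFSet.mem_insert_iff, ih]
    constructor
    · rintro (rfl | ⟨k, hk, rfl⟩)
      exacts [⟨n, by omega, rfl⟩, ⟨k, by omega, rfl⟩]
    · rintro ⟨k, hk, rfl⟩
      rcases Nat.lt_succ_iff_lt_or_eq.1 hk with h | rfl
      exacts [Or.inr ⟨k, h, rfl⟩, Or.inl rfl]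

theorem isOrd_nn (n : ℕ) : IsOrd (nn.{u} n) := by
  induction n with
  | zero => exact IsOrd.empty
  | succ n ih => exact ih.succ

theorem isOrd_omega : IsOrd omega.{u} := by
  constructor
  · intro x hx y hy
    obtain ⟨n, rfl⟩ := mem_omega.1 hx
    obtain ⟨k, _, rfl⟩ := mem_nn.1 hy
    exact nn_mem_omega k
  · intro x hx
    obtain ⟨n, rfl⟩ := mem_omega.1 hx
    exact (isOrd_nn n).1

theorem nn_mem_nn {k n : ℕ} : nn.{u} k ∈ nn n ↔ k < n := by
  constructor
  · intro h
    by_contra hkn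
    rcases Nat.lt_or_eq_of_le (Nat.le_of_not_lt hkn) with h' | rfl
    · exact ZFSet.mem_asymm h (mem_nn.2 ⟨n, h', rfl⟩)
    · exact ZFSet.mem_irrefl _ h
  · intro h; exact mem_nn.2 ⟨k, h, rfl⟩

theorem nn_inj {k n : ℕ} (h : nn.{u} k = nn n) : k = n := by
  rcases Nat.lt_trichotomy k n with h' | h' | h'
  · exact absurd (nn_mem_nn.2 h') (h ▸ ZFSet.mem_irrefl _)
  · exact h'
  · exact absurd (nn_mem_nn.2 h') (h ▸ ZFSet.mem_irrefl _)

instance isOrd_omegaF : Fact (IsOrd omega.{u}) := ⟨isOrd_omega⟩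
instance nnF {N : ZFSet.{u}} [PM N] {n : ℕ} : Fact (nn n ∈ N) :=
  ⟨PM.mem (PM.om N) (nn_mem_omega n)⟩

/-- ∈-recursion. -/
def zrec (Φ : ZFSet.{u} → ZFSet.{u} → ZFSet.{u}) : ZFSet.{u} → ZFSet.{u} :=
  WellFounded.fix ZFSet.mem_wf (fun x ih => Φ x (lam x (fun y => if h : y ∈ x then ih y h else ∅)))

theorem zrec_eq (Φ : ZFSet.{u} → ZFSet.{u} → ZFSet.{u}) (x : ZFSet.{u}) :
    zrec Φ x = Φ x (lam x (zrec Φ)) := by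
  unfold zrec
  rw [WellFounded.fix_eq]
  congr 1
  exact lam_congr fun y hy => by rw [dif_pos hy]

/-- The recursively defined function on `θ`. -/
def recF (θ : ZFSet.{u}) (Φ : ZFSet.{u} → ZFSet.{u} → ZFSet.{u}) : ZFSet.{u} := lam θ (zrec Φ)

theorem recF_unique {θ g : ZFSet.{u}} (hθ : θ.IsTransitive) {Φ : ZFSet.{u} → ZFSet.{u} → ZFSet.{u}}
    (hg : IsZFunc θ g) (h : ∀ x ∈ θ, fapp g x = Φ x (lam x (fapp g))) : g = recF θ Φ := by
  refine hg.ext (isZFunc_lam _ _) fun x => ?_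
  refine ZFSet.inductionOn x fun x ih hx => ?_
  rw [recF, fapp_lam hx, h x hx, zrec_eq]
  congr 1
  refine lam_congr fun y hy => ?_
  have hy' := hθ x hx hy
  rw [ih y hy hy', recF, fapp_lam hy']

theorem recF_fapp {θ x : ZFSet.{u}} (hθ : θ.IsTransitive) {Φ : ZFSet.{u} → ZFSet.{u} → ZFSet.{u}}
    (hx : x ∈ θ) : fapp (recF θ Φ) x = Φ x (lam x (fapp (recF θ Φ))) := by
  unfold recF
  rw [fapp_lam hx, zrec_eq]
  congr 1
  refine lam_congr fun y hy => ?_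
  rw [fapp_lam (hθ x hx hy)]

theorem recF_isZFunc (θ : ZFSet.{u}) (Φ : ZFSet.{u} → ZFSet.{u} → ZFSet.{u}) :
    IsZFunc θ (recF θ Φ) := isZFunc_lam _ _

theorem recF_iff {θ g : ZFSet.{u}} (hθ : θ.IsTransitive) {Φ : ZFSet.{u} → ZFSet.{u} → ZFSet.{u}} :
    (IsZFunc θ g ∧ ∀ x, x ∈ θ → fapp g x = Φ x (lam x (fapp g))) ↔ g = recF θ Φ :=
  ⟨fun h => recF_unique hθ h.1 h.2, fun h => h ▸ ⟨recF_isZFunc _ _, fun x hx => recF_fapp hθ hx⟩⟩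

section
variable {N : ZFSet.{u}} [hN : PM N]

theorem recF_mem {Φ : ZFSet → ZFSet → (ℕ → ZFSet) → ZFSet}
    (h : Tm N (fun v => Φ (v 0) (v 1) (fun n => v (n + 2)))) {v : ℕ → ZFSet.{u}}
    (hv : ∀ n, v n ∈ N) : ∀ θ : ZFSet.{u}, IsOrd θ → θ ∈ N → recF θ (fun x g => Φ x g v) ∈ N := by
  have hΦ : ∀ x ∈ N, ∀ g ∈ N, Φ x g v ∈ N := fun x hx g hg =>
    h.mem (vc x (vc g v)) (vc_mem hx (vc_mem hg hv))
  intro θ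
  refine ZFSet.inductionOn θ fun θ ih hθ hθN => ?_
  have hz : ∀ x ∈ θ, zrec (fun x g => Φ x g v) x ∈ N := fun x hx => by
    have hxN := PM.mem hθN hx
    rw [zrec_eq]
    exact hΦ x hxN _ (ih x hx (hθ.mem hx) hxN)
  let Q : ZFSet.{u} → ZFSet.{u} → (ℕ → ZFSet.{u}) → Prop := fun x y v => ∃ g, g ∈ N ∧
    ((IsZFunc x g ∧ ∀ z, z ∈ x → fapp g z = Φ z (lam z (fun w => fapp g w)) v) ∧ y = Φ x g v)
  have hQ : ∀ x ∈ θ, ∀ y, Q x y v ↔ y = zrec (fun x g => Φ x g v) x := by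
    intro x hx y
    have hxt := (hθ.mem hx).1
    constructor
    · rintro ⟨g, hg, h1, rfl⟩
      have := (recF_iff (Φ := fun x g => Φ x g v) hxt).1 h1
      rw [zrec_eq, this]; rfl
    · rintro rfl
      refine ⟨_, ih x hx (hθ.mem hx) (PM.mem hθN hx),
        (recF_iff (Φ := fun x g => Φ x g v) hxt).2 rfl, ?_⟩
      rw [zrec_eq]; rfl
  have t1 : Tm N (fun v => Φ (v 1) (v 0) (fun n => v (n + 3))) :=
    h.rename (fun n => match n with | 0 => 1 | 1 => 0 | k + 2 => k + 3)
  have t2 : Tm N (fun v => Φ (v 0) (MPaper.lam (v 0) (fun w => fapp (v 1) w)) (fun n => v (n + 4))) := by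
    have t3 : Tm N (fun v => Φ (v 1) (v 0) (fun n => v (n + 5))) :=
      h.rename (fun n => match n with | 0 => 1 | 1 => 0 | k + 2 => k + 5)
    have l : Tm N (fun v => MPaper.lam (v 0) (fun w => fapp (v 1) w)) := inferInstance
    refine ⟨fun v hv => h.mem (vc (v 0) (vc (MPaper.lam (v 0) (fun w => fapp (v 1) w))
      (fun n => v (n + 4)))) (vc_mem (hv 0) (vc_mem (l.mem v hv) fun n => hv _)), ?_⟩
    have d : Dfn N (fun v => v 1 = Φ (v 2) (v 0) (fun n => v (n + 6))) :=
      h.gr.rename (fun n => match n with | 0 => 1 | 1 => 2 | 2 => 0 | k + 3 => k + 6)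
    exact d.subst1 (l.rename Nat.succ)
  have dQ : Dfn N (fun v => Q (v 0) (v 1) (fun n => v (n + 2))) := by
    have a1 : Tm N (fun v => Φ (v 0) (MPaper.lam (v 0) (fun w => fapp (v 1) w)) (fun n => v (n + 4))) := t2
    have a2 : Dfn N (fun v => ∀ z, z ∈ v 1 → fapp (v 0) z =
        Φ z (MPaper.lam z (fun w => fapp (v 0) w)) (fun n => v (n + 3))) :=
      Dfn.all (P := fun z v => fapp (v 0) z =
        Φ z (MPaper.lam z (fun w => fapp (v 0) w)) (fun n => v (n + 3)))
        (h := Dfn.eq (ht := a1))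
    have a3 : Dfn N (fun v => v 2 = Φ (v 1) (v 0) (fun n => v (n + 3))) := Dfn.eq (ht := t1)
    have a4 := @Dfn.and N _ _ (@Dfn.and N _ _ (Dfn.isZFunc (N := N) (s := fun v => v 1)
      (t := fun v => v 0)) a2) a3
    exact @Dfn.exN N (fun g v => (IsZFunc (v 0) g ∧ ∀ z, z ∈ v 0 → fapp g z =
        Φ z (MPaper.lam z (fun w => fapp g w)) (fun n => v (n + 2))) ∧
        v 1 = Φ (v 0) g (fun n => v (n + 2))) a4
  obtain ⟨b, hb, H⟩ := PM.coll dQ hv hθN (fun x hx => ⟨_, hz x hx, (hQ x hx _).2 rfl⟩)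
  have dR : Dfn N (fun v => ∃ x, x ∈ v 2 ∧ ∃ y, y ∈ v 1 ∧ (v 0 = ZFSet.pair x y ∧ Q x y (fun n => v (n + 3)))) := by
    have b1 : Dfn N (fun v => v 2 = ZFSet.pair (v 1) (v 0)) := inferInstance
    have b2 : Dfn N (fun v => Q (v 1) (v 0) (fun n => v (n + 5))) :=
      dQ.rename (fun n => match n with | 0 => 1 | 1 => 0 | k + 2 => k + 5)
    have b3 := @Dfn.and N _ _ b1 b2
    have b4 : Dfn N (fun v => ∃ y, y ∈ v 2 ∧ (v 1 = ZFSet.pair (v 0) y ∧ Q (v 0) y (fun n => v (n + 4)))) :=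
      Dfn.ex (P := fun y v => v 1 = ZFSet.pair (v 0) y ∧ Q (v 0) y (fun n => v (n + 4))) (h := b3)
    exact Dfn.ex (P := fun x v => ∃ y, y ∈ v 1 ∧ (v 0 = ZFSet.pair x y ∧ Q x y (fun n => v (n + 3)))) (h := b4)
  have tp : (ZFSet.prod θ b) ∈ N := by
    haveI : Fact (θ ∈ N) := ⟨hθN⟩
    haveI : Fact (b ∈ N) := ⟨hb⟩
    exact Tm.mem_out (N := N) inferInstance
  have := PM.sepv (P := fun p v => ∃ x, x ∈ v 1 ∧ ∃ y, y ∈ v 0 ∧ (p = ZFSet.pair x y ∧ Q x y (fun n => v (n + 2))))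
    dR (vc_mem hb (vc_mem hθN hv)) tp
  convert this
  ext p
  rw [recF, mem_lam, ZFSet.mem_sep]
  constructor
  · rintro ⟨x, hx, rfl⟩
    obtain ⟨y, hy, hq⟩ := H x hx
    have := (hQ x hx y).1 hq
    subst this
    exact ⟨ZFSet.pair_mem_prod.2 ⟨hx, hy⟩, x, hx, _, hy, rfl, hq⟩
  · rintro ⟨_, x, hx, y, hy, rfl, hq⟩
    exact ⟨x, hx, by rw [(hQ x hx y).1 hq]⟩

instance Tm.recF {Φ : ZFSet → ZFSet → (ℕ → ZFSet) → ZFSet} {θ : ZFSet.{u}} [hθ : Fact (IsOrd θ)]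
    [hθN : Fact (θ ∈ N)] [h : Tm N (fun v => Φ (v 0) (v 1) (fun n => v (n + 2)))] :
    Tm N (fun v => MPaper.recF θ (fun x g => Φ x g v)) := by
  have t2 : Tm N (fun v => Φ (v 0) (MPaper.lam (v 0) (fun w => MPaper.fapp (v 1) w)) (fun n => v (n + 2))) := by
    have l : Tm N (fun v => MPaper.lam (v 0) (fun w => MPaper.fapp (v 1) w)) := inferInstance
    refine ⟨fun v hv => h.mem (vc (v 0) (vc (MPaper.lam (v 0) (fun w => MPaper.fapp (v 1) w))
      (fun n => v (n + 2)))) (vc_mem (hv 0) (vc_mem (l.mem v hv) fun n => hv _)), ?_⟩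
    have d : Dfn N (fun v => v 1 = Φ (v 2) (v 0) (fun n => v (n + 4))) :=
      h.gr.rename (fun n => match n with | 0 => 1 | 1 => 2 | 2 => 0 | k + 3 => k + 4)
    exact d.subst1 (l.rename Nat.succ)
  have a2 : Dfn N (fun v => ∀ z, z ∈ θ → MPaper.fapp (v 0) z =
        Φ z (MPaper.lam z (fun w => MPaper.fapp (v 0) w)) (fun n => v (n + 1))) :=
      Dfn.all (P := fun z v => MPaper.fapp (v 0) z =
        Φ z (MPaper.lam z (fun w => MPaper.fapp (v 0) w)) (fun n => v (n + 1)))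
        (h := Dfn.eq (ht := t2))
  refine Tm.of_graph (P := fun v => IsZFunc θ (v 0) ∧ ∀ z, z ∈ θ → MPaper.fapp (v 0) z =
        Φ z (MPaper.lam z (fun w => MPaper.fapp (v 0) w)) (fun n => v (n + 1)))
    (fun v hv => recF_mem h hv θ hθ.out hθN.out) inferInstance fun v hv => ?_
  exact recF_iff (Φ := fun x g => Φ x g (fun n => v (n + 1))) hθ.out.1

end

/-- Least element of `θ` with property `Q` (`θ` if none). -/
def mu (θ : ZFSet.{u}) (Q : ZFSet.{u} → Prop) : ZFSet.{u} :=
  ZFSet.sep (fun i => ∀ j, j ∈ insert i i → ¬ Q j) θ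

instance Tm.mu {N : ZFSet.{u}} [hN : PM N] {t : (ℕ → ZFSet) → ZFSet}
    {P : ZFSet → (ℕ → ZFSet) → Prop} [ht : Tm N t]
    [h : Dfn N (fun v => P (v 0) (fun n => v (n + 1)))] :
    Tm N (fun v => MPaper.mu (t v) (fun x => P x v)) := by
  unfold MPaper.mu
  have : Dfn N (fun v => P (v 0) (fun n => v (n + 2))) :=
    h.rename (fun n => match n with | 0 => 0 | k + 1 => k + 2)
  infer_instance

theorem ord_least {θ : ZFSet.{u}} (Q : ZFSet.{u} → Prop) {i : ZFSet.{u}} (hi : i ∈ θ)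
    (hQ : Q i) : ∃ j ∈ θ, Q j ∧ ∀ k ∈ θ, k ∈ j → ¬ Q k := by
  obtain ⟨j, ⟨hj, hq⟩, hm⟩ := ZFSet.mem_wf.has_min {j | j ∈ θ ∧ Q j} ⟨i, hi, hQ⟩
  exact ⟨j, hj, hq, fun k hk hkj hqk => hm k ⟨hk, hqk⟩ hkj⟩

theorem mu_eq {θ : ZFSet.{u}} (hθ : IsOrd θ) {Q : ZFSet.{u} → Prop} {j : ZFSet.{u}} (hj : j ∈ θ)
    (hq : Q j) (hm : ∀ k ∈ j, ¬ Q k) : mu θ Q = j := by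
  have hjo := hθ.mem hj
  ext i
  unfold mu
  rw [ZFSet.mem_sep]
  constructor
  · rintro ⟨hi, h⟩
    have hio := hθ.mem hi
    rcases hio.tri hjo with h1 | rfl | h1
    · exact h1
    · exact absurd hq (h _ (ZFSet.mem_insert_iff.2 (Or.inl rfl)))
    · exact absurd hq (h _ (ZFSet.mem_insert_iff.2 (Or.inr h1)))
  · intro hi
    refine ⟨hθ.trans hj hi, fun k hk => ?_⟩
    rcases ZFSet.mem_insert_iff.1 hk with rfl | hk
    · exact hm _ hi
    · exact hm _ (hjo.trans hi hk)

theorem mu_spec {θ : ZFSet.{u}} (hθ : IsOrd θ) {Q : ZFSet.{u} → Prop} {i : ZFSet.{u}} (hi : i ∈ θ)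
    (hQ : Q i) : mu θ Q ∈ θ ∧ Q (mu θ Q) ∧ ∀ k ∈ mu θ Q, ¬ Q k := by
  obtain ⟨j, hj, hq, hm⟩ := ord_least Q hi hQ
  have hm' : ∀ k ∈ j, ¬ Q k := fun k hk => hm k (hθ.trans hj hk) hk
  rw [mu_eq hθ hj hq hm']
  exact ⟨hj, hq, hm'⟩

theorem mu_none {θ : ZFSet.{u}} {Q : ZFSet.{u} → Prop} (hθ : IsOrd θ) (h : ∀ i ∈ θ, ¬ Q i) :
    mu θ Q = θ := by
  ext i
  unfold mu
  rw [ZFSet.mem_sep]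
  refine ⟨fun h => h.1, fun hi => ⟨hi, fun k hk => ?_⟩⟩
  rcases ZFSet.mem_insert_iff.1 hk with rfl | hk
  · exact h _ hi
  · exact h _ (hθ.trans hi hk)

/-! ### Mostowski collapse inside a model -/

/-- The set of `E`-predecessors of `x` in `D`. -/
def prd (D E x : ZFSet.{u}) : ZFSet.{u} := ZFSet.sep (fun y => ZFSet.pair y x ∈ E) D

theorem mem_prd {D E x y : ZFSet.{u}} : y ∈ prd D E x ↔ y ∈ D ∧ ZFSet.pair y x ∈ E :=
  ZFSet.mem_sep

instance Tm.prd {N : ZFSet.{u}} [hN : PM N] {r s t : (ℕ → ZFSet) → ZFSet} [hr : Tm N r]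
    [hs : Tm N s] [ht : Tm N t] : Tm N (fun v => MPaper.prd (r v) (s v) (t v)) := by
  have hs' : Tm N (fun v => s (fun n => v (n + 1))) := hs.rename Nat.succ
  have ht' : Tm N (fun v => t (fun n => v (n + 1))) := ht.rename Nat.succ
  unfold MPaper.prd; infer_instance

/-- Partial collapses. -/
def App (D E d p : ZFSet.{u}) : Prop :=
  d ⊆ D ∧ (∀ x, x ∈ d → prd D E x ⊆ d) ∧ IsZFunc d p ∧
    ∀ x, x ∈ d → fapp p x = img (fapp p) (prd D E x)

/-- `π` is the Mostowski collapse of `(D,E)`. -/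
def IsCollapse (D E p : ZFSet.{u}) : Prop :=
  IsZFunc D p ∧ ∀ x, x ∈ D → fapp p x = img (fapp p) (prd D E x)

/-- internal well-foundedness -/
def IWF (N D E : ZFSet.{u}) : Prop :=
  ∀ X, X ∈ N → X ⊆ D → X ≠ ∅ → ∃ x ∈ X, ∀ y ∈ X, ZFSet.pair y x ∉ E

instance Dfn.isApp {N : ZFSet.{u}} [hN : PM N] {D E : ZFSet.{u}} [hD : Fact (D ∈ N)] [hE : Fact (E ∈ N)]
    {s t : (ℕ → ZFSet) → ZFSet} [hs : Tm N s]
    [ht : Tm N t] : Dfn N (fun v => App D E (s v) (t v)) := by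
  refine Dfn.comp2 (R := App D E) ?_ hs ht
  show Dfn N (fun v => v 0 ⊆ D ∧ (∀ x, x ∈ v 0 → MPaper.prd D E x ⊆ v 0) ∧ IsZFunc (v 0) (v 1) ∧
    ∀ x, x ∈ v 0 → MPaper.fapp (v 1) x = MPaper.img (fun y => MPaper.fapp (v 1) y) (MPaper.prd D E x))
  infer_instance

instance Dfn.isCollapse {N : ZFSet.{u}} [hN : PM N]
    {r s t : (ℕ → ZFSet) → ZFSet} [hr : Tm N r] [hs : Tm N s]
    [ht : Tm N t] : Dfn N (fun v => IsCollapse (r v) (s v) (t v)) := by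
  refine Dfn.comp3 (R := IsCollapse) ?_ hr hs ht
  show Dfn N (fun v => IsZFunc (v 0) (v 2) ∧
    ∀ x, x ∈ v 0 → MPaper.fapp (v 2) x = MPaper.img (fun y => MPaper.fapp (v 2) y) (MPaper.prd (v 0) (v 1) x))
  infer_instance

section
variable {N : ZFSet.{u}} [hN : PM N] {D E : ZFSet.{u}}

theorem IWF.ind (hD : D ∈ N) (hw : IWF N D E)
    {P : ZFSet.{u} → (ℕ → ZFSet.{u}) → Prop} (dP : Dfn N (fun v => P (v 0) (fun n => v (n + 1))))
    {v : ℕ → ZFSet.{u}} (hv : ∀ n, v n ∈ N)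
    (h : ∀ x ∈ D, (∀ y ∈ prd D E x, P y v) → P x v) : ∀ x ∈ D, P x v := by
  intro x hx
  by_contra hc
  obtain ⟨y, hy, hm⟩ := hw _ (PM.sepv (P := fun x v => ¬ P x v) inferInstance hv hD)
    (fun z hz => (ZFSet.mem_sep.1 hz).1)
    (fun h0 => ZFSet.notMem_empty x (h0 ▸ ZFSet.mem_sep.2 ⟨hx, hc⟩))
  obtain ⟨hyD, hyP⟩ := ZFSet.mem_sep.1 hy
  refine hyP (h y hyD fun z hz => ?_)
  obtain ⟨hzD, hzE⟩ := mem_prd.1 hz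
  by_contra hzP
  exact hm z (ZFSet.mem_sep.2 ⟨hzD, hzP⟩) hzE

theorem App.agree (hD : D ∈ N) (hw : IWF N D E) {d p d' p' : ZFSet.{u}}
    (hd : d ∈ N) (hp : p ∈ N) (hd' : d' ∈ N) (hp' : p' ∈ N) (h : App D E d p) (h' : App D E d' p') :
    ∀ x ∈ d, x ∈ d' → fapp p x = fapp p' x := by
  have := hw.ind hD (P := fun x v => x ∈ v 0 → x ∈ v 2 → fapp (v 1) x = fapp (v 3) x)
    inferInstance (v := vc d (vc p (vc d' (vc p' (fun _ => d)))))
    (vc_mem hd (vc_mem hp (vc_mem hd' (vc_mem hp' fun _ => hd)))) ?_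
  · exact fun x hx hx' => this x (h.1 hx) hx hx'
  · intro x hx ih h1 h2
    change x ∈ d at h1; change x ∈ d' at h2
    change fapp p x = fapp p' x
    rw [h.2.2.2 x h1, h'.2.2.2 x h2]
    exact img_congr fun y hy => ih y hy (h.2.1 x h1 hy) (h'.2.1 x h2 hy)

theorem App.union (hD : D ∈ N) (hE : E ∈ N) (hw : IWF N D E) {b : ZFSet.{u}} (hb : b ∈ N) :
    ∃ d ∈ N, ∃ p ∈ N, App D E d p ∧
      ∀ x ∈ D, (∃ q ∈ b, ∃ e ∈ N, App D E e q ∧ x ∈ e) → x ∈ d := by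
  haveI : Fact (D ∈ N) := ⟨hD⟩
  haveI : Fact (E ∈ N) := ⟨hE⟩
  haveI : Fact (b ∈ N) := ⟨hb⟩
  let B := ZFSet.sep (fun p => ∃ d, d ∈ N ∧ App D E d p) b
  have hB : B ∈ N := Tm.mem_out (N := N) inferInstance
  haveI : Fact (B ∈ N) := ⟨hB⟩
  let dU := ZFSet.sep (fun x => ∃ p, p ∈ B ∧ ∃ d, d ∈ N ∧ (App D E d p ∧ x ∈ d)) D
  have hdU : dU ∈ N := Tm.mem_out (N := N) inferInstance
  have hpU : (⋃₀ B : ZFSet) ∈ N := Tm.mem_out (N := N) inferInstance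
  have key : ∀ p ∈ B, ∀ d ∈ N, App D E d p → ∀ x ∈ d, ∀ z, ZFSet.pair x z ∈ (⋃₀ B : ZFSet) →
      z = fapp p x := by
    intro p hp d hd hA x hx z hz
    obtain ⟨p', hp', hz⟩ := ZFSet.mem_sUnion.1 hz
    obtain ⟨hb', d', hd', hA'⟩ := ZFSet.mem_sep.1 hp'
    obtain ⟨hx', rfl⟩ := hA'.2.2.1.eq hz
    exact App.agree hD hw hd' (PM.mem hb hb') hd (PM.mem hb (ZFSet.mem_sep.1 hp).1) hA' hA x hx' hx
  have key2 : ∀ p ∈ B, ∀ d ∈ N, App D E d p → ∀ x ∈ d, fapp (⋃₀ B : ZFSet) x = fapp p x := by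
    intro p hp d hd hA x hx
    exact fapp_of (ZFSet.mem_sUnion.2 ⟨p, hp, hA.2.2.1.mem hx⟩) (key p hp d hd hA x hx)
  refine ⟨dU, hdU, _, hpU, ⟨fun x hx => (ZFSet.mem_sep.1 hx).1, ?_, ⟨?_, ?_⟩, ?_⟩, ?_⟩
  · intro x hx y hy
    obtain ⟨hxD, p, hp, d, hd, hA, hxd⟩ := ZFSet.mem_sep.1 hx
    exact ZFSet.mem_sep.2 ⟨(mem_prd.1 hy).1, p, hp, d, hd, hA, hA.2.1 x hxd hy⟩
  · intro q hq
    obtain ⟨p, hp, hq⟩ := ZFSet.mem_sUnion.1 hq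
    obtain ⟨hb', d, hd, hA⟩ := ZFSet.mem_sep.1 hp
    obtain ⟨a, ha, z, rfl⟩ := hA.2.2.1.1 q hq
    exact ⟨a, ZFSet.mem_sep.2 ⟨hA.1 ha, p, hp, d, hd, hA, ha⟩, z, rfl⟩
  · intro x hx
    obtain ⟨hxD, p, hp, d, hd, hA, hxd⟩ := ZFSet.mem_sep.1 hx
    exact ⟨fapp p x, ZFSet.mem_sUnion.2 ⟨p, hp, hA.2.2.1.mem hxd⟩, key p hp d hd hA x hxd⟩
  · intro x hx
    obtain ⟨hxD, p, hp, d, hd, hA, hxd⟩ := ZFSet.mem_sep.1 hx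
    rw [key2 p hp d hd hA x hxd, hA.2.2.2 x hxd]
    exact img_congr fun y hy => (key2 p hp d hd hA y (hA.2.1 x hxd hy)).symm
  · rintro x hx ⟨q, hq, e, he, hA, hxe⟩
    exact ZFSet.mem_sep.2 ⟨hx, q, ZFSet.mem_sep.2 ⟨hq, e, he, hA⟩, e, he, hA, hxe⟩

theorem App.extend (hD : D ∈ N) (hE : E ∈ N) {d p x : ZFSet.{u}} (hd : d ∈ N) (hp : p ∈ N)
    (h : App D E d p) (hx : x ∈ D) (hxd : prd D E x ⊆ d) :
    ∃ d' ∈ N, ∃ p' ∈ N, App D E d' p' ∧ x ∈ d' := by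
  haveI : Fact (D ∈ N) := ⟨hD⟩
  haveI : Fact (E ∈ N) := ⟨hE⟩
  haveI : Fact (d ∈ N) := ⟨hd⟩
  haveI : Fact (p ∈ N) := ⟨hp⟩
  haveI : Fact (x ∈ N) := ⟨PM.mem hD hx⟩
  let d' := insert x d
  have hd' : d' ∈ N := Tm.mem_out (N := N) inferInstance
  haveI : Fact (d' ∈ N) := ⟨hd'⟩
  let p' := lam d' (fun y => img (fun z => fapp p z) (prd D E y))
  have hp' : p' ∈ N := Tm.mem_out (N := N) inferInstance
  have hsub : ∀ y ∈ d', prd D E y ⊆ d := by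
    intro y hy
    rcases ZFSet.mem_insert_iff.1 hy with rfl | hy
    · exact hxd
    · exact h.2.1 y hy
  have e1 : ∀ y ∈ d, fapp p' y = fapp p y := fun y hy => by
    rw [fapp_lam (ZFSet.mem_insert_iff.2 (Or.inr hy)), h.2.2.2 y hy]
  refine ⟨d', hd', p', hp', ⟨?_, ?_, isZFunc_lam _ _, ?_⟩, ZFSet.mem_insert_iff.2 (Or.inl rfl)⟩
  · intro y hy
    rcases ZFSet.mem_insert_iff.1 hy with rfl | hy
    exacts [hx, h.1 hy]
  · exact fun y hy z hz => ZFSet.mem_insert_iff.2 (Or.inr (hsub y hy hz))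
  · intro y hy
    rw [fapp_lam hy]
    exact img_congr fun z hz => (e1 z (hsub y hy hz)).symm

theorem exists_collapse (hD : D ∈ N) (hE : E ∈ N) (hw : IWF N D E) :
    ∃ p ∈ N, IsCollapse D E p := by
  haveI : Fact (D ∈ N) := ⟨hD⟩
  haveI : Fact (E ∈ N) := ⟨hE⟩
  have step : ∀ x ∈ N, (∀ y ∈ x, ∃ q ∈ N, ∃ e, e ∈ N ∧ (App D E e q ∧ y ∈ e)) →
      ∃ d ∈ N, ∃ p ∈ N, App D E d p ∧ ∀ y ∈ x, y ∈ d := by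
    intro x hx h
    obtain ⟨b, hb, H⟩ := PM.coll (P := fun y q v => ∃ e, e ∈ N ∧ (App D E e q ∧ y ∈ e))
      inferInstance (v := fun _ => D) (fun _ => hD) hx h
    obtain ⟨d, hd, p, hp, hA, hU⟩ := App.union hD hE hw hb
    refine ⟨d, hd, p, hp, hA, fun y hy => ?_⟩
    obtain ⟨q, hq, e, he, hA', hye⟩ := H y hy
    exact hU y (hA'.1 hye) ⟨q, hq, e, he, hA', hye⟩
  have all : ∀ x ∈ D, ∃ q, q ∈ N ∧ ∃ e, e ∈ N ∧ (App D E e q ∧ x ∈ e) := by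
    refine hw.ind hD (P := fun x v => ∃ q, q ∈ N ∧ ∃ e, e ∈ N ∧ (App D E e q ∧ x ∈ e))
      inferInstance (v := fun _ => D) (fun _ => hD) fun x hx ih => ?_
    haveI : Fact (x ∈ N) := ⟨PM.mem hD hx⟩
    obtain ⟨d, hd, p, hp, hA, hs⟩ := step (prd D E x) (Tm.mem_out (N := N) inferInstance) ih
    obtain ⟨d', hd', p', hp', hA', hx'⟩ := hA.extend hD hE hd hp hx hs
    exact ⟨p', hp', d', hd', hA', hx'⟩
  obtain ⟨d, hd, p, hp, hA, hs⟩ := step D hD all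
  have : d = D := by
    ext z; exact ⟨fun h => hA.1 h, hs z⟩
  subst this
  exact ⟨p, hp, hA.2.2.1, hA.2.2.2⟩

theorem IsCollapse.mem_of {p x y : ZFSet.{u}} (h : IsCollapse D E p) (hx : x ∈ D) (hy : y ∈ D)
    (hE : ZFSet.pair y x ∈ E) : fapp p y ∈ fapp p x := by
  rw [h.2 x hx]; exact mem_img.2 ⟨y, mem_prd.2 ⟨hy, hE⟩, rfl⟩

theorem IsCollapse.exists_of {p x z : ZFSet.{u}} (h : IsCollapse D E p) (hx : x ∈ D)
    (hz : z ∈ fapp p x) : ∃ y ∈ D, ZFSet.pair y x ∈ E ∧ fapp p y = z := by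
  rw [h.2 x hx] at hz
  obtain ⟨y, hy, rfl⟩ := mem_img.1 hz
  obtain ⟨h1, h2⟩ := mem_prd.1 hy
  exact ⟨y, h1, h2, rfl⟩

theorem IsCollapse.wf {p : ZFSet.{u}} (h : IsCollapse D E p) {P : ZFSet.{u} → Prop}
    (ih : ∀ x ∈ D, (∀ y ∈ D, ZFSet.pair y x ∈ E → P y) → P x) : ∀ x ∈ D, P x := by
  have : ∀ a : ZFSet.{u}, ∀ x ∈ D, fapp p x = a → P x := fun a => by
    refine ZFSet.inductionOn a fun a iha x hx e => ?_
    refine ih x hx fun y hy hyx => iha (fapp p y) ?_ y hy rfl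
    rw [← e]; exact h.mem_of hx hy hyx
  exact fun x hx => this _ x hx rfl

theorem IsCollapse.unique {p q : ZFSet.{u}} (h : IsCollapse D E p) (h' : IsCollapse D E q) :
    p = q := by
  refine h.1.ext h'.1 (h.wf fun x hx ih => ?_)
  rw [h.2 x hx, h'.2 x hx]
  exact img_congr fun y hy => ih y (mem_prd.1 hy).1 (mem_prd.1 hy).2

/-- injectivity for extensional (e.g. linear) relations -/
theorem IsCollapse.inj {p : ZFSet.{u}} (h : IsCollapse D E p)
    (hl : ∀ x ∈ D, ∀ y ∈ D, x = y ∨ ZFSet.pair x y ∈ E ∨ ZFSet.pair y x ∈ E) : InjOnZ p D := by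
  intro x hx y hy e
  rcases hl x hx y hy with h1 | h1 | h1
  · exact h1
  · exact absurd (h.mem_of hy hx h1) (e ▸ ZFSet.mem_irrefl _)
  · exact absurd (h.mem_of hx hy h1) (e ▸ ZFSet.mem_irrefl _)

theorem IsCollapse.isOrd {p : ZFSet.{u}} (h : IsCollapse D E p)
    (ht : ∀ x ∈ D, ∀ y ∈ D, ∀ z ∈ D, ZFSet.pair x y ∈ E → ZFSet.pair y z ∈ E → ZFSet.pair x z ∈ E) :
    ∀ x ∈ D, IsOrd (fapp p x) := by
  refine h.wf fun x hx ih => ⟨?_, ?_⟩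
  · intro a ha b hb
    obtain ⟨y, hy, hyx, rfl⟩ := h.exists_of hx ha
    obtain ⟨z, hz, hzy, rfl⟩ := h.exists_of hy hb
    exact h.mem_of hx hz (ht z hz y hy x hx hzy hyx)
  · intro a ha
    obtain ⟨y, hy, hyx, rfl⟩ := h.exists_of hx ha
    exact (ih y hy hyx).1

theorem IsCollapse.img_trans {p : ZFSet.{u}} (h : IsCollapse D E p) :
    (img (fapp p) D).IsTransitive := by
  intro a ha b hb
  obtain ⟨x, hx, rfl⟩ := mem_img.1 ha
  obtain ⟨y, hy, _, rfl⟩ := h.exists_of hx hb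
  exact mem_img.2 ⟨y, hy, rfl⟩

theorem IsCollapse.img_ord {p : ZFSet.{u}} (h : IsCollapse D E p)
    (ht : ∀ x ∈ D, ∀ y ∈ D, ∀ z ∈ D, ZFSet.pair x y ∈ E → ZFSet.pair y z ∈ E → ZFSet.pair x z ∈ E) :
    IsOrd (img (fapp p) D) :=
  ⟨h.img_trans, fun a ha => by
    obtain ⟨x, hx, rfl⟩ := mem_img.1 ha
    exact (h.isOrd ht x hx).1⟩

/-- The inverse of `f` on `d`, evaluated at `y`. -/
def inv (f d y : ZFSet.{u}) : ZFSet.{u} := ⋃₀ (ZFSet.sep (fun x => fapp f x = y) d)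

theorem inv_eq {f d x : ZFSet.{u}} (hf : InjOnZ f d) (hx : x ∈ d) : inv f d (fapp f x) = x := by
  unfold inv
  have : ZFSet.sep (fun z => fapp f z = fapp f x) d = ({x} : ZFSet) := by
    ext z
    rw [ZFSet.mem_sep, ZFSet.mem_singleton]
    exact ⟨fun ⟨h1, h2⟩ => hf z h1 x hx h2, fun h => by subst h; exact ⟨hx, rfl⟩⟩
  rw [this, ZFSet.sUnion_singleton]

instance Tm.inv {r s t : (ℕ → ZFSet) → ZFSet} [hr : Tm N r]
    [hs : Tm N s] [ht : Tm N t] : Tm N (fun v => MPaper.inv (r v) (s v) (t v)) := by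
  have hr' : Tm N (fun v => r (fun n => v (n + 1))) := hr.rename Nat.succ
  have ht' : Tm N (fun v => t (fun n => v (n + 1))) := ht.rename Nat.succ
  unfold MPaper.inv; infer_instance

theorem IsWellOrderOn.iwf {x r : ZFSet.{u}} (h : IsWellOrderOn x r) : IWF N x r := by
  intro X _ hX hne
  obtain ⟨y, hy⟩ : ∃ y, y ∈ X := by
    by_contra h0
    exact hne ((ZFSet.eq_empty X).2 fun y hy => h0 ⟨y, hy⟩)
  obtain ⟨a, ha, hm⟩ := h.2.2.2.2 X.toSet (fun z hz => hX hz) ⟨y, hy⟩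
  exact ⟨a, ha, fun b hb => hm b hb⟩

/-- Every set of the model is enumerated by an ordinal. -/
theorem PM.enum {x : ZFSet.{u}} (hx : x ∈ N) :
    ∃ θ ∈ N, IsOrd θ ∧ ∃ f ∈ N, IsZFunc θ f ∧ SurjOnto f θ x ∧ InjOnZ f θ := by
  obtain ⟨r, hr, hw⟩ := hN.out.2.2.2.2.2.2 x hx
  obtain ⟨p, hp, hc⟩ := exists_collapse hx hr hw.iwf
  haveI : Fact (x ∈ N) := ⟨hx⟩
  haveI : Fact (p ∈ N) := ⟨hp⟩
  have hinj := hc.inj hw.2.1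
  let θ := img (fun y => fapp p y) x
  have hθ : θ ∈ N := Tm.mem_out (N := N) inferInstance
  haveI : Fact (θ ∈ N) := ⟨hθ⟩
  let f := lam θ (fun y => inv p x y)
  have hf : f ∈ N := Tm.mem_out (N := N) inferInstance
  have e : ∀ y ∈ x, fapp f (fapp p y) = y := fun y hy => by
    rw [fapp_lam (mem_img.2 ⟨y, hy, rfl⟩), inv_eq hinj hy]
  refine ⟨θ, hθ, hc.img_ord hw.2.2.1, f, hf, isZFunc_lam _ _, ⟨?_, ?_⟩, ?_⟩
  · intro a ha
    obtain ⟨y, hy, rfl⟩ := mem_img.1 ha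
    show fapp f (fapp p y) ∈ x
    rw [e y hy]; exact hy
  · intro b hb
    exact ⟨fapp p b, mem_img.2 ⟨b, hb, rfl⟩, e b hb⟩
  · intro a ha b hb hab
    obtain ⟨y, hy, rfl⟩ := mem_img.1 ha
    obtain ⟨z, hz, rfl⟩ := mem_img.1 hb
    change fapp f (fapp p y) = fapp f (fapp p z) at hab
    rw [e y hy, e z hz] at hab
    rw [hab]

instance Dfn.mapsInto {r s t : (ℕ → ZFSet) → ZFSet} [hr : Tm N r]
    [hs : Tm N s] [ht : Tm N t] : Dfn N (fun v => MapsInto (r v) (s v) (t v)) :=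
  Dfn.comp3 (R := MapsInto) (by unfold MapsInto; infer_instance) hr hs ht

instance Dfn.surjOnto {r s t : (ℕ → ZFSet) → ZFSet} [hr : Tm N r]
    [hs : Tm N s] [ht : Tm N t] : Dfn N (fun v => SurjOnto (r v) (s v) (t v)) :=
  Dfn.comp3 (R := SurjOnto) (by unfold SurjOnto; infer_instance) hr hs ht

theorem relSat {K : ZFSet.{u}} [hK : Fact (K ∈ N)] (φ : Fml) :
    ∀ s : ℕ → (ℕ → ZFSet.{u}) → ZFSet.{u}, (∀ n, Tm N (s n)) →
      Dfn N (fun v => Sat K.toSet φ (fun n => s n v)) := by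
  induction φ with
  | mem i j => intro s hs; have := hs i; have := hs j; simp only [Sat]; infer_instance
  | eq i j => intro s hs; have := hs i; have := hs j; simp only [Sat]; infer_instance
  | impl φ ψ h1 h2 => intro s hs; have := h1 s hs; have := h2 s hs; simp only [Sat]; infer_instance
  | neg φ h1 => intro s hs; have := h1 s hs; simp only [Sat]; infer_instance
  | all i φ h1 =>
    intro s hs
    have := h1 (fun n v => if n = i then v 0 else s n (fun m => v (m + 1))) (fun n => by
      by_cases h : n = i
      · simp only [h, if_true]; infer_instance
      · simp only [h, if_false]; exact (hs n).rename Nat.succ)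
    refine Dfn.congr (P := fun v => ∀ x, x ∈ K → Sat K.toSet φ
      (fun n => if n = i then x else s n v)) (Dfn.all (P := fun x v => Sat K.toSet φ
      (fun n => if n = i then x else s n v)) (h := this)) fun v hv => ?_
    simp only [Sat]
    refine forall_congr' fun x => forall_congr' fun hx => ?_
    have : (fun n => if n = i then x else s n v) = Function.update (fun n => s n v) i x := by
      funext n; simp [Function.update_apply]
    rw [this]

end

/-! ### Gödel pairing -/

/-- standing assumptions on `κ` -/
class KK (κ : ZFSet.{u}) : Prop where
  card : IsCard κ
  om : omega ∈ κ
  ex : ∃ N, IsTransModel N ∧ κ ∈ N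

theorem zcard_img_le (F : ZFSet.{u} → ZFSet.{u}) (s : ZFSet.{u}) : zcard (img F s) ≤ zcard s := by
  unfold zcard
  have : (img F s).toSet = F '' s.toSet := by
    ext y; exact mem_img
  rw [this]; exact Cardinal.mk_image_le

theorem zcard_mono {s t : ZFSet.{u}} (h : s ⊆ t) : zcard s ≤ zcard t :=
  Cardinal.mk_le_mk_of_subset (fun x hx => h hx)

theorem zcard_prod (s t : ZFSet.{u}) : zcard (ZFSet.prod s t) ≤ zcard s * zcard t := by
  unfold zcard
  rw [Cardinal.mul_def]
  refine Cardinal.mk_le_of_surjective (f := fun q : s.toSet × t.toSet =>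
    (⟨ZFSet.pair q.1.1 q.2.1, ZFSet.pair_mem_prod.2 ⟨q.1.2, q.2.2⟩⟩ : (ZFSet.prod s t).toSet)) ?_
  rintro ⟨p, hp⟩
  obtain ⟨a, ha, b, hb, rfl⟩ := ZFSet.mem_prod.1 hp
  exact ⟨(⟨a, ha⟩, ⟨b, hb⟩), rfl⟩

theorem zcard_insert (a s : ZFSet.{u}) : zcard (insert a s) ≤ zcard s + 1 := by
  unfold zcard
  have : (insert a s : ZFSet).toSet = insert a s.toSet := by
    ext y; exact ZFSet.mem_insert_iff
  rw [this]; exact Cardinal.mk_insert_le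

theorem aleph0_le_zcard_omega : Cardinal.aleph0 ≤ zcard omega.{u} := by
  unfold zcard
  rw [Cardinal.aleph0_le_mk_iff]
  exact Infinite.of_injective (fun n => (⟨nn n, nn_mem_omega n⟩ : omega.{u}.toSet))
    fun a b h => nn_inj (congrArg Subtype.val h)

section
variable {κ : ZFSet.{u}} [hk : KK κ]

variable (κ) in
theorem KK.ord : IsOrd κ := hk.card.1

instance KK.ordF : Fact (IsOrd κ) := ⟨KK.ord κ⟩

theorem KK.inf : Cardinal.aleph0 ≤ zcard κ :=
  aleph0_le_zcard_omega.trans (zcard_mono ((KK.ord κ).1 _ hk.om))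

theorem KK.mem_of_card {o : ZFSet.{u}} (ho : IsOrd o) (h : zcard o < zcard κ) : o ∈ κ := by
  rcases ho.mem_or_sub (KK.ord κ) with h1 | h1
  · exact h1
  · exact absurd h (not_lt.2 (zcard_mono h1))

theorem KK.succ {α : ZFSet.{u}} (h : α ∈ κ) : insert α α ∈ κ :=
  KK.mem_of_card ((KK.ord κ).mem h).succ ((zcard_insert _ _).trans_lt
    (Cardinal.add_lt_of_lt KK.inf (hk.card.2 α h) (Cardinal.one_lt_aleph0.trans_le KK.inf)))

theorem KK.nn (n : ℕ) : nn n ∈ κ := (KK.ord κ).trans hk.om (nn_mem_omega n)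

theorem ord_union {κ : ZFSet.{u}} (hκ : IsOrd κ) {α β : ZFSet.{u}} (hα : α ∈ κ) (hβ : β ∈ κ) :
    α ∪ β ∈ κ ∧ (α ∪ β = α ∨ α ∪ β = β) := by
  have h : α ∪ β = α ∨ α ∪ β = β := by
    rcases (hκ.mem hα).mem_or_sub (hκ.mem hβ) with h | h
    · right; ext z; rw [ZFSet.mem_union]
      exact ⟨fun h' => h'.elim (fun h'' => (hκ.mem hβ).trans h h'') id, Or.inr⟩
    · left; ext z; rw [ZFSet.mem_union]
      exact ⟨fun h' => h'.elim id (fun h'' => h h''), Or.inl⟩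
  refine ⟨?_, h⟩
  rcases h with h | h <;> rw [h] <;> assumption

end

def gless (a b c d : ZFSet.{u}) : Prop :=
  a ∪ b ∈ c ∪ d ∨ (a ∪ b = c ∪ d ∧ (a ∈ c ∨ (a = c ∧ b ∈ d)))

def gE (κ : ZFSet.{u}) : ZFSet.{u} :=
  ZFSet.sep (fun q => ∃ a, a ∈ κ ∧ ∃ b, b ∈ κ ∧ ∃ c, c ∈ κ ∧ ∃ d, d ∈ κ ∧
    (q = ZFSet.pair (ZFSet.pair a b) (ZFSet.pair c d) ∧ gless a b c d))
    (ZFSet.prod (ZFSet.prod κ κ) (ZFSet.prod κ κ))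

theorem mem_gE {κ a b c d : ZFSet.{u}} (ha : a ∈ κ) (hb : b ∈ κ) (hc : c ∈ κ) (hd : d ∈ κ) :
    ZFSet.pair (ZFSet.pair a b) (ZFSet.pair c d) ∈ gE κ ↔ gless a b c d := by
  unfold gE
  rw [ZFSet.mem_sep]
  constructor
  · rintro ⟨_, a', _, b', _, c', _, d', _, e, h⟩
    obtain ⟨e1, e2⟩ := ZFSet.pair_inj.1 e
    obtain ⟨rfl, rfl⟩ := ZFSet.pair_inj.1 e1
    obtain ⟨rfl, rfl⟩ := ZFSet.pair_inj.1 e2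
    exact h
  · intro h
    exact ⟨by simp [ha, hb, hc, hd], a, ha, b, hb, c, hc, d, hd, rfl, h⟩

instance gE_mem {κ N : ZFSet.{u}} [PM N] [Fact (κ ∈ N)] : Fact (gE κ ∈ N) :=
  ⟨Tm.mem_out (N := N) (by unfold gE gless; infer_instance)⟩

theorem gE_total {κ : ZFSet.{u}} (hκ : IsOrd κ) : ∀ x ∈ ZFSet.prod κ κ, ∀ y ∈ ZFSet.prod κ κ,
    x = y ∨ ZFSet.pair x y ∈ gE κ ∨ ZFSet.pair y x ∈ gE κ := by
  intro x hx y hy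
  obtain ⟨a, ha, b, hb, rfl⟩ := ZFSet.mem_prod.1 hx
  obtain ⟨c, hc, d, hd, rfl⟩ := ZFSet.mem_prod.1 hy
  rw [mem_gE ha hb hc hd, mem_gE hc hd ha hb, ZFSet.pair_inj]
  unfold gless
  have h1 := (hκ.mem (ord_union hκ ha hb).1).tri (hκ.mem (ord_union hκ hc hd).1)
  have h2 := (hκ.mem ha).tri (hκ.mem hc)
  have h3 := (hκ.mem hb).tri (hκ.mem hd)
  rcases h1 with h1 | h1 | h1 <;> rcases h2 with h2 | h2 | h2 <;> rcases h3 with h3 | h3 | h3 <;>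
    simp_all

theorem gE_trans {κ : ZFSet.{u}} (hκ : IsOrd κ) : ∀ x ∈ ZFSet.prod κ κ, ∀ y ∈ ZFSet.prod κ κ,
    ∀ z ∈ ZFSet.prod κ κ,
    ZFSet.pair x y ∈ gE κ → ZFSet.pair y z ∈ gE κ → ZFSet.pair x z ∈ gE κ := by
  intro x hx y hy z hz
  obtain ⟨a, ha, b, hb, rfl⟩ := ZFSet.mem_prod.1 hx
  obtain ⟨c, hc, d, hd, rfl⟩ := ZFSet.mem_prod.1 hy
  obtain ⟨e, he, f, hf, rfl⟩ := ZFSet.mem_prod.1 hz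
  rw [mem_gE ha hb hc hd, mem_gE hc hd he hf, mem_gE ha hb he hf]
  unfold gless
  have h1 := @IsOrd.trans _ (c ∪ d) (a ∪ b) (hκ.mem (ord_union hκ he hf).1)
  have h2 := @IsOrd.trans _ c a (hκ.mem he)
  have h3 := @IsOrd.trans _ d b (hκ.mem hf)
  rintro (h | ⟨h, g | ⟨rfl, g⟩⟩) (h' | ⟨h', g' | ⟨rfl, g'⟩⟩)
  · exact Or.inl (h1 h' h)
  · exact Or.inl (h' ▸ h)
  · exact Or.inl (h' ▸ h)
  · exact Or.inl (h ▸ h')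
  · exact Or.inr ⟨h.trans h', Or.inl (h2 g' g)⟩
  · exact Or.inr ⟨h.trans h', Or.inl g⟩
  · exact Or.inl (h ▸ h')
  · exact Or.inr ⟨h.trans h', Or.inl g'⟩
  · exact Or.inr ⟨h.trans h', Or.inr ⟨rfl, h3 g' g⟩⟩

theorem gE_iwf {κ N : ZFSet.{u}} : IWF N (ZFSet.prod κ κ) (gE κ) := by
  intro X _ hX hne
  obtain ⟨x, hx⟩ : ∃ y, y ∈ X := by
    by_contra h0
    exact hne ((ZFSet.eq_empty X).2 fun y hy => h0 ⟨y, hy⟩)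
  obtain ⟨a, ha, b, hb, rfl⟩ := ZFSet.mem_prod.1 (hX hx)
  obtain ⟨m, ⟨a, b, h1, rfl⟩, hm⟩ := ZFSet.mem_wf.has_min {m | ∃ a b, ZFSet.pair a b ∈ X ∧ m = a ∪ b}
    ⟨_, a, b, hx, rfl⟩
  obtain ⟨c, ⟨d, h2, e2⟩, hc⟩ := ZFSet.mem_wf.has_min
    {c | ∃ d, ZFSet.pair c d ∈ X ∧ c ∪ d = a ∪ b} ⟨a, b, h1, rfl⟩
  obtain ⟨d, ⟨h3, e3⟩, hd⟩ := ZFSet.mem_wf.has_min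
    {d | ZFSet.pair c d ∈ X ∧ c ∪ d = a ∪ b} ⟨d, h2, e2⟩
  refine ⟨_, h3, fun y hy hyE => ?_⟩
  obtain ⟨p, hp, q, hq, rfl⟩ := ZFSet.mem_prod.1 (hX hy)
  obtain ⟨hc1, hd1⟩ := ZFSet.pair_mem_prod.1 (hX h3)
  rcases (mem_gE hp hq hc1 hd1).1 hyE with h | ⟨h, h' | ⟨rfl, h'⟩⟩
  · exact hm _ ⟨p, q, hy, rfl⟩ (e3 ▸ h)
  · exact hc _ ⟨q, hy, h.trans e3⟩ h'
  · exact hd _ ⟨hy, h.trans e3⟩ h'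

/-- The pairing function, as a set. -/
def GP (κ : ZFSet.{u}) : ZFSet.{u} :=
  if h : ∃ p, IsCollapse (ZFSet.prod κ κ) (gE κ) p then h.choose else ∅

section
variable {κ : ZFSet.{u}}

instance GP_mem {N : ZFSet.{u}} [PM N] [h : Fact (κ ∈ N)] : Fact (GP κ ∈ N) := by
  obtain ⟨p, hp, hc⟩ := exists_collapse (N := N) (D := ZFSet.prod κ κ) (E := gE κ)
    (Tm.mem_out (N := N) inferInstance) gE_mem.out gE_iwf
  have hex : ∃ p, IsCollapse (ZFSet.prod κ κ) (gE κ) p := ⟨p, hc⟩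
  refine ⟨?_⟩
  unfold GP
  rw [dif_pos hex, hex.choose_spec.unique hc]
  exact hp

/-- pairing -/
def pr (κ a b : ZFSet.{u}) : ZFSet.{u} := fapp (GP κ) (ZFSet.pair a b)
/-- first projection -/
def pl (κ c : ZFSet.{u}) : ZFSet.{u} := ⋃₀ (ZFSet.sep (fun a => ∃ b, b ∈ κ ∧ pr κ a b = c) κ)
/-- second projection -/
def pR (κ c : ZFSet.{u}) : ZFSet.{u} := ⋃₀ (ZFSet.sep (fun b => ∃ a, a ∈ κ ∧ pr κ a b = c) κ)

instance Tm.pr {N : ZFSet.{u}} [PM N] [h : Fact (κ ∈ N)] {s t : (ℕ → ZFSet) → ZFSet}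
    [hs : Tm N s] [ht : Tm N t] : Tm N (fun v => MPaper.pr κ (s v) (t v)) := by
  unfold MPaper.pr; infer_instance

instance Tm.pl {N : ZFSet.{u}} [PM N] [h : Fact (κ ∈ N)] {s : (ℕ → ZFSet) → ZFSet}
    [hs : Tm N s] : Tm N (fun v => MPaper.pl κ (s v)) :=
  Tm.comp1 (F := MPaper.pl κ) (by unfold MPaper.pl; infer_instance) hs

instance Tm.pR {N : ZFSet.{u}} [PM N] [h : Fact (κ ∈ N)] {s : (ℕ → ZFSet) → ZFSet}
    [hs : Tm N s] : Tm N (fun v => MPaper.pR κ (s v)) :=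
  Tm.comp1 (F := MPaper.pR κ) (by unfold MPaper.pR; infer_instance) hs

variable [hk : KK κ]

variable (κ) in
theorem GP_coll : IsCollapse (ZFSet.prod κ κ) (gE κ) (GP κ) := by
  obtain ⟨N, hN, hκN⟩ := hk.ex
  haveI : PM N := ⟨hN⟩
  haveI : Fact (κ ∈ N) := ⟨hκN⟩
  obtain ⟨p, hp, hc⟩ := exists_collapse (N := N) (D := ZFSet.prod κ κ) (E := gE κ)
    (Tm.mem_out (N := N) inferInstance) gE_mem.out gE_iwf
  have hex : ∃ p, IsCollapse (ZFSet.prod κ κ) (gE κ) p := ⟨p, hc⟩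
  unfold GP
  rw [dif_pos hex]
  exact hex.choose_spec

theorem pr_ord {a b : ZFSet.{u}} (ha : a ∈ κ) (hb : b ∈ κ) : IsOrd (pr κ a b) :=
  (GP_coll κ).isOrd (gE_trans (KK.ord κ)) _ (ZFSet.pair_mem_prod.2 ⟨ha, hb⟩)

theorem pr_lt {a b c d : ZFSet.{u}} (ha : a ∈ κ) (hb : b ∈ κ) (hc : c ∈ κ) (hd : d ∈ κ)
    (h : gless a b c d) : pr κ a b ∈ pr κ c d :=
  (GP_coll κ).mem_of (ZFSet.pair_mem_prod.2 ⟨hc, hd⟩) (ZFSet.pair_mem_prod.2 ⟨ha, hb⟩)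
    ((mem_gE ha hb hc hd).2 h)

theorem pr_inj {a b c d : ZFSet.{u}} (ha : a ∈ κ) (hb : b ∈ κ) (hc : c ∈ κ) (hd : d ∈ κ)
    (h : pr κ a b = pr κ c d) : a = c ∧ b = d :=
  ZFSet.pair_inj.1 ((GP_coll κ).inj (gE_total (KK.ord κ)) _ (ZFSet.pair_mem_prod.2 ⟨ha, hb⟩) _
    (ZFSet.pair_mem_prod.2 ⟨hc, hd⟩) h)

theorem pr_mem {a b : ZFSet.{u}} (ha : a ∈ κ) (hb : b ∈ κ) : pr κ a b ∈ κ := by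
  have hκ := KK.ord κ
  refine KK.mem_of_card (pr_ord ha hb) ?_
  have hm := (ord_union hκ ha hb).1
  set m := a ∪ b with hmd
  have h1 : pr κ a b = img (fapp (GP κ)) (prd (ZFSet.prod κ κ) (gE κ) (ZFSet.pair a b)) :=
    (GP_coll κ).2 _ (ZFSet.pair_mem_prod.2 ⟨ha, hb⟩)
  have h2 : prd (ZFSet.prod κ κ) (gE κ) (ZFSet.pair a b) ⊆ ZFSet.prod (insert m m) (insert m m) := by
    intro x hx
    obtain ⟨hx, hE⟩ := mem_prd.1 hx
    obtain ⟨c, hc, d, hd, rfl⟩ := ZFSet.mem_prod.1 hx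
    have h3 := (mem_gE hc hd ha hb).1 hE
    have hu := (ord_union hκ hc hd).1
    have h4 : c ∪ d ⊆ m := by
      rcases h3 with h3 | h3
      · exact (hκ.mem hm).1 _ h3
      · rw [h3.1]
    have h5 : ∀ z ∈ κ, z ⊆ m → z ∈ insert m m := fun z hz hzm => by
      rw [ZFSet.mem_insert_iff]; exact ((hκ.mem hz).sub_iff (hκ.mem hm)).1 hzm
    refine ZFSet.pair_mem_prod.2 ⟨h5 c hc fun z hz => h4 (ZFSet.mem_union.2 (Or.inl hz)),
      h5 d hd fun z hz => h4 (ZFSet.mem_union.2 (Or.inr hz))⟩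
  rw [h1]
  refine ((zcard_img_le _ _).trans ((zcard_mono h2).trans (zcard_prod _ _))).trans_lt ?_
  have := hk.card.2 _ (KK.succ hm)
  exact Cardinal.mul_lt_of_lt KK.inf this this

theorem pl_pr {a b : ZFSet.{u}} (ha : a ∈ κ) (hb : b ∈ κ) : pl κ (pr κ a b) = a := by
  unfold pl
  have : ZFSet.sep (fun x => ∃ y, y ∈ κ ∧ pr κ x y = pr κ a b) κ = ({a} : ZFSet) := by
    ext z
    rw [ZFSet.mem_sep, ZFSet.mem_singleton]
    constructor
    · rintro ⟨hz, y, hy, e⟩; exact (pr_inj hz hy ha hb e).1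
    · rintro rfl; exact ⟨ha, b, hb, rfl⟩
  rw [this, ZFSet.sUnion_singleton]

theorem pR_pr {a b : ZFSet.{u}} (ha : a ∈ κ) (hb : b ∈ κ) : pR κ (pr κ a b) = b := by
  unfold pR
  have : ZFSet.sep (fun y => ∃ x, x ∈ κ ∧ pr κ x y = pr κ a b) κ = ({b} : ZFSet) := by
    ext z
    rw [ZFSet.mem_sep, ZFSet.mem_singleton]
    constructor
    · rintro ⟨hz, y, hy, e⟩; exact (pr_inj hy hz ha hb e).2
    · rintro rfl; exact ⟨hb, a, ha, rfl⟩
  rw [this, ZFSet.sUnion_singleton]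

theorem sub_pr {a b : ZFSet.{u}} (ha : a ∈ κ) (hb : b ∈ κ) : a ∪ b ⊆ pr κ a b := by
  have hκ := KK.ord κ
  have key : ∀ c : ZFSet.{u}, ∀ a ∈ κ, ∀ b ∈ κ, c ∈ a ∪ b → c ∈ pr κ a b := by
    intro c
    refine ZFSet.inductionOn c fun c ih a ha b hb hc => ?_
    have hcκ : c ∈ κ := hκ.trans (ord_union hκ ha hb).1 hc
    have h0 : (∅ : ZFSet) ∈ κ := KK.nn 0
    have h1 : c ∪ (∅ : ZFSet) = c := by ext z; simp
    have h2 : pr κ c ∅ ∈ pr κ a b := pr_lt hcκ h0 ha hb (Or.inl (by rw [h1]; exact hc))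
    have h3 : c ⊆ pr κ c ∅ := fun z hz => ih z hz c hcκ ∅ h0 (by rw [h1]; exact hz)
    rcases ((hκ.mem hcκ).sub_iff (pr_ord hcκ h0)).1 h3 with h4 | h4
    · rw [h4]; exact h2
    · exact (pr_ord ha hb).trans h2 h4
  exact fun c hc => key c a ha b hb hc

theorem right_mem_pr {a b : ZFSet.{u}} (ha : a ∈ κ) (hb : b ∈ κ) (h0 : a ≠ ∅) : b ∈ pr κ a b := by
  have hκ := KK.ord κ
  have hz : (∅ : ZFSet) ∈ κ := KK.nn 0
  have h0a : (∅ : ZFSet) ∈ a := by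
    rcases IsOrd.empty.tri (hκ.mem ha) with h | h | h
    · exact h
    · exact absurd h.symm h0
    · exact absurd h (ZFSet.notMem_empty _)
  have e : (∅ : ZFSet) ∪ b = b := by ext z; simp
  have h1 : pr κ ∅ b ∈ pr κ a b := by
    refine pr_lt hz hb ha hb ?_
    unfold gless
    rw [e]
    rcases (hκ.mem hb).mem_or_sub (hκ.mem ha) with h | h
    · exact Or.inl (ZFSet.mem_union.2 (Or.inl h))
    · refine Or.inr ⟨?_, Or.inl h0a⟩
      ext z; rw [ZFSet.mem_union]
      exact ⟨Or.inr, fun h' => h'.elim (fun h'' => h h'') id⟩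
  have h2 : b ⊆ pr κ ∅ b := by
    intro z hz'
    exact sub_pr hz hb (by rw [e]; exact hz')
  rcases ((hκ.mem hb).sub_iff (pr_ord hz hb)).1 h2 with h4 | h4
  · rw [← h4] at h1; exact h1
  · exact (pr_ord ha hb).trans h1 h4

theorem mem_pr3 {t i j : ZFSet.{u}} (ht : t ∈ κ) (hi : i ∈ κ) (hj : j ∈ κ) (h0 : t ≠ ∅) :
    i ∈ pr κ t (pr κ i j) ∧ j ∈ pr κ t (pr κ i j) := by
  have hκ := KK.ord κ
  have h1 := right_mem_pr ht (pr_mem hi hj) h0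
  have key : ∀ k ∈ κ, k ⊆ i ∪ j → k ∈ pr κ t (pr κ i j) := fun k hk' hs => by
    have h2 : k ⊆ pr κ i j := fun z hz => sub_pr hi hj (hs hz)
    rcases ((hκ.mem hk').sub_iff (pr_ord hi hj)).1 h2 with h4 | h4
    · rw [h4]; exact h1
    · exact (pr_ord ht (pr_mem hi hj)).trans h1 h4
  exact ⟨key i hi fun z hz => ZFSet.mem_union.2 (Or.inl hz),
    key j hj fun z hz => ZFSet.mem_union.2 (Or.inr hz)⟩

/-- closure points of pairing -/
theorem pr_lt_diag {a b c : ZFSet.{u}} (hc : c ∈ κ) (ha : a ∈ c) (hb : b ∈ c) :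
    pr κ a b ∈ pr κ c c := by
  have hκ := KK.ord κ
  refine pr_lt (hκ.trans hc ha) (hκ.trans hc hb) hc hc (Or.inl ?_)
  have e : c ∪ c = c := by ext z; simp
  rw [e]
  exact (ord_union (hκ.mem hc) ha hb).1

end

/-! ### Good models -/

/-- `(M, U)` is a Ramsey witness lying in `N`. -/
structure Good (κ N M U : ZFSet.{u}) : Prop where
  MN : M ∈ N
  UN : U ∈ N
  surj : ∃ f ∈ N, IsZFunc κ f ∧ SurjOnto f κ M
  uf : IsMUltrafilter κ M U
  wa : WeaklyAmenable κ M U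
  oi : OmegaOneIntersectingIn N U

section
variable {κ N M U : ZFSet.{u}} [hk : KK κ] [hN : PM N] [hκN : Fact (κ ∈ N)]
  [hM : PM M] [hκM : Fact (κ ∈ M)]

theorem Good.sub (g : Good κ N M U) {x : ZFSet.{u}} (hx : x ∈ M) : x ∈ N := PM.mem g.MN hx

theorem Good.inter (g : Good κ N M U) {A B : ZFSet.{u}} (hA : A ∈ U) (hB : B ∈ U) : A ∩ B ∈ U :=
  g.uf.2.2.2.1 A hA B hB

theorem Good.ne (g : Good κ N M U) {A : ZFSet.{u}} (hA : A ∈ U) : ∃ ξ ∈ κ, ξ ∈ A := by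
  by_contra h
  have : A = ∅ := (ZFSet.eq_empty A).2 fun y hy => h ⟨y, (g.uf.1 A hA).2 hy, hy⟩
  exact g.uf.2.2.1 (this ▸ hA)

theorem Good.up (g : Good κ N M U) {A B : ZFSet.{u}} (hA : A ∈ U) (hB : B ∈ M) (hBκ : B ⊆ κ)
    (h : A ⊆ B) : B ∈ U := g.uf.2.2.2.2.1 A hA B hB hBκ h

theorem Good.tail (g : Good κ N M U) {α : ZFSet.{u}} (hα : α ∈ κ) :
    ZFSet.sep (fun ξ => ξ ∉ α) κ ∈ U := g.uf.2.1 α hα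

/-- `P` holds almost everywhere. -/
def ae (κ U : ZFSet.{u}) (P : ZFSet.{u} → Prop) : Prop := ZFSet.sep P κ ∈ U

instance Dfn.ae {N : ZFSet.{u}} [PM N] [Fact (κ ∈ N)] [Fact (U ∈ N)]
    {P : ZFSet → (ℕ → ZFSet) → Prop}
    [h : Dfn N (fun v => P (v 0) (fun n => v (n + 1)))] :
    Dfn N (fun v => MPaper.ae κ U (fun x => P x v)) := by
  unfold MPaper.ae; infer_instance

theorem Good.sepM {P : ZFSet.{u} → Prop} (h : Dfn M (fun v => P (v 0))) :
    ZFSet.sep P κ ∈ M := by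
  have : Dfn M (fun v => (fun x (_ : ℕ → ZFSet.{u}) => P x) (v 0) (fun n => v (n + 1))) := h
  exact PM.sepv (P := fun x _ => P x) this (v := fun _ => κ) (fun _ => hκM.out) hκM.out

theorem Good.mono (g : Good κ N M U) {P Q : ZFSet.{u} → Prop} (hQ : Dfn M (fun v => Q (v 0)))
    (h : ∀ ξ ∈ κ, P ξ → Q ξ) (hP : ae κ U P) : ae κ U Q :=
  g.up hP (Good.sepM hQ) (fun z hz => (ZFSet.mem_sep.1 hz).1) fun z hz => by
    obtain ⟨h1, h2⟩ := ZFSet.mem_sep.1 hz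
    exact ZFSet.mem_sep.2 ⟨h1, h z h1 h2⟩

theorem Good.and (g : Good κ N M U) {P Q : ZFSet.{u} → Prop} (hP : ae κ U P) (hQ : ae κ U Q) :
    ae κ U (fun ξ => P ξ ∧ Q ξ) := by
  have := g.inter hP hQ
  unfold ae
  convert this using 1
  ext z
  simp only [ZFSet.mem_sep, ZFSet.mem_inter]
  tauto

theorem Good.aetail (g : Good κ N M U) {α : ZFSet.{u}} (hα : α ∈ κ) : ae κ U (fun ξ => α ∈ ξ) := by
  have h := g.tail (KK.succ hα)
  unfold ae
  convert h using 1
  ext z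
  simp only [ZFSet.mem_sep, ZFSet.mem_insert_iff]
  refine and_congr_right fun hz => ?_
  have hκ := KK.ord κ
  constructor
  · rintro h (rfl | h')
    · exact ZFSet.mem_irrefl _ h
    · exact ZFSet.mem_asymm h h'
  · intro h
    rcases (hκ.mem hα).tri (hκ.mem hz) with h1 | h1 | h1
    · exact h1
    · exact absurd (Or.inl h1.symm) h
    · exact absurd (Or.inr h1) h

theorem Good.exists_of (g : Good κ N M U) {P : ZFSet.{u} → Prop} (hP : ae κ U P) : ∃ ξ ∈ κ, P ξ := by
  obtain ⟨ξ, h1, h2⟩ := g.ne hP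
  exact ⟨ξ, h1, (ZFSet.mem_sep.1 h2).2⟩

theorem Good.all (g : Good κ N M U) {P : ZFSet.{u} → Prop} (hP : Dfn M (fun v => P (v 0)))
    (h : ∀ ξ ∈ κ, P ξ) : ae κ U P :=
  g.mono hP (fun ξ hξ _ => h ξ hξ) (g.aetail (KK.nn 0))

theorem Good.em (g : Good κ N M U) {P : ZFSet.{u} → Prop} (hP : Dfn M (fun v => P (v 0)))
    (h : ¬ ae κ U P) : ae κ U (fun ξ => ¬ P ξ) := by
  rcases g.uf.2.2.2.2.2.1 _ (Good.sepM (κ := κ) hP) (fun z hz => (ZFSet.mem_sep.1 hz).1) with h1 | h1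
  · exact absurd h1 h
  · unfold ae
    convert h1 using 1
    unfold compl
    ext z
    simp only [ZFSet.mem_sep]
    tauto

theorem Good.not_iff (g : Good κ N M U) {P : ZFSet.{u} → Prop} (hP : Dfn M (fun v => P (v 0))) :
    ae κ U (fun ξ => ¬ P ξ) ↔ ¬ ae κ U P := by
  refine ⟨fun h h' => ?_, g.em hP⟩
  obtain ⟨ξ, _, h1, h2⟩ := g.exists_of (g.and h h')
  exact h1 h2

theorem Good.normal (g : Good κ N M U) {c : ZFSet.{u} → ZFSet.{u}} (hc : Tm M (fun v => c (v 0)))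
    (h : ae κ U (fun ξ => c ξ ∈ ξ)) : ∃ γ ∈ κ, ae κ U (fun ξ => c ξ = γ) := by
  have hf : lam κ c ∈ M := by
    have : Tm M (fun v => (fun x (_ : ℕ → ZFSet.{u}) => c x) (v 0) (fun n => v (n + 1))) := hc
    exact Tm.mem_out (N := M) (Tm.lam (t := fun _ => κ) (F := fun x _ => c x) (h := this))
  have e : ∀ Q : ZFSet.{u} → ZFSet.{u} → Prop,
      ZFSet.sep (fun ξ => Q (fapp (lam κ c) ξ) ξ) κ = ZFSet.sep (fun ξ => Q (c ξ) ξ) κ := by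
    intro Q
    ext z
    simp only [ZFSet.mem_sep]
    exact and_congr_right fun hz => by rw [fapp_lam hz]
  obtain ⟨γ, hγ, h2⟩ := g.uf.2.2.2.2.2.2 _ hf (isZFunc_lam _ _) (by
    rw [e (fun a b => a ∈ b)]; exact h)
  rw [e (fun a b => a = γ)] at h2
  exact ⟨γ, hγ, h2⟩

theorem Good.pigeon (g : Good κ N M U) {c : ZFSet.{u} → ZFSet.{u}} (hc : Tm M (fun v => c (v 0)))
    {ν : ZFSet.{u}} (hν : ν ∈ κ)
    (h : ae κ U (fun ξ => c ξ ∈ ν)) : ∃ γ ∈ ν, ae κ U (fun ξ => c ξ = γ) := by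
  have hκ := KK.ord κ
  have h1 : ae κ U (fun ξ => c ξ ∈ ξ) :=
    g.mono inferInstance (fun ξ hξ hx => (hκ.mem hξ).trans hx.2 hx.1) (g.and h (g.aetail hν))
  obtain ⟨γ, hγ, h2⟩ := g.normal hc h1
  obtain ⟨ξ, _, h3, h4⟩ := g.exists_of (g.and h h2)
  exact ⟨γ, h4 ▸ h3, h2⟩

theorem Good.comp (g : Good κ N M U) {P : ZFSet.{u} → ZFSet.{u} → Prop}
    (hP : Dfn M (fun v => P (v 0) (v 1))) {ν : ZFSet.{u}} (hν : ν ∈ κ)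
    (h : ∀ i ∈ ν, ae κ U (fun ξ => P i ξ)) : ae κ U (fun ξ => ∀ i, i ∈ ν → P i ξ) := by
  haveI : Fact (ν ∈ M) := ⟨PM.mem hκM.out hν⟩
  have hP' : ∀ i j, Dfn M (fun v => P (v i) (v j)) := fun i j =>
    hP.rename (fun n => if n = 0 then i else j)
  have d : Dfn M (fun v => ∀ i, i ∈ ν → P i (v 0)) :=
    Dfn.all (t := fun _ => ν) (P := fun i v => P i (v 0)) (h := hP' 0 1)
  by_contra hc
  have h1 := g.em d hc
  have hν' := (KK.ord κ).mem hν
  have d' : Dfn M (fun v => ¬ P (v 0) (v 1)) := @Dfn.not _ _ (hP' 0 1)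
  have tm : Tm M (fun v => mu ν (fun i => ¬ P i (v 0))) :=
    Tm.mu (t := fun _ => ν) (P := fun i v => ¬ P i (v 0)) (h := d')
  have h2 : ae κ U (fun ξ => mu ν (fun i => ¬ P i ξ) ∈ ν) := by
    refine g.mono (Dfn.mem (hs := tm)) (fun ξ hξ hx => ?_) h1
    push Not at hx
    obtain ⟨i, hi, hx⟩ := hx
    exact (mu_spec hν' (Q := fun i => ¬ P i ξ) hi hx).1
  obtain ⟨γ, hγ, h3⟩ := g.pigeon (c := fun ξ => mu ν (fun i => ¬ P i ξ)) tm hν h2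
  obtain ⟨ξ, hξ, ⟨h4, h5⟩, h6⟩ := g.exists_of (g.and (g.and h1 h3) (h γ hγ))
  push Not at h4
  obtain ⟨i, hi, hx⟩ := h4
  have := (mu_spec hν' (Q := fun i => ¬ P i ξ) hi hx).2.1
  rw [h5] at this
  exact this h6

theorem Good.uq (g : Good κ N M U) {P : ZFSet.{u} → ZFSet.{u} → Prop}
    (hP : Dfn M (fun v => P (v 0) (v 1))) : ZFSet.sep (fun i => ae κ U (fun ξ => P i ξ)) κ ∈ M := by
  have hP' : ∀ i j, Dfn M (fun v => P (v i) (v j)) := fun i j =>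
    hP.rename (fun n => if n = 0 then i else j)
  have t1 : Tm M (fun v => ZFSet.sep (fun ξ => P (v 0) ξ) κ) :=
    Tm.sep (t := fun _ => κ) (P := fun ξ v => P (v 0) ξ) (h := hP' 1 0)
  let s : ZFSet.{u} → ZFSet.{u} := fun i => ZFSet.sep (fun ξ => P i ξ) κ
  have hX : img s κ ∈ M := Tm.mem_out (N := M) (Tm.img (t := fun _ => κ) (F := fun x _ => s x) (h := t1))
  have hf : lam κ s ∈ M := Tm.mem_out (N := M) (Tm.lam (t := fun _ => κ) (F := fun x _ => s x) (h := t1))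
  have hXU : img s κ ∩ U ∈ M := g.wa _ hX ⟨_, hf, isZFunc_lam _ _, fun y hy => by
    obtain ⟨x, hx, rfl⟩ := mem_img.1 hy
    exact ⟨x, hx, fapp_lam hx⟩⟩
  haveI : Fact (img s κ ∩ U ∈ M) := ⟨hXU⟩
  have : ZFSet.sep (fun i => s i ∈ img s κ ∩ U) κ ∈ M :=
    Tm.mem_out (N := M) (Tm.sep (t := fun _ => κ) (P := fun i _ => s i ∈ img s κ ∩ U)
      (h := Dfn.mem (hs := t1)))
  convert this using 1
  ext z
  simp only [ZFSet.mem_sep, ZFSet.mem_inter]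
  exact and_congr_right fun hz => ⟨fun h => ⟨mem_img.2 ⟨z, hz, rfl⟩, h⟩, fun h => h.2⟩

/-- the ultrafilter section set is decided below `ν` by a single point -/
theorem Good.decide (g : Good κ N M U) {P : ZFSet.{u} → ZFSet.{u} → Prop}
    (hP : Dfn M (fun v => P (v 0) (v 1))) {ν : ZFSet.{u}} (hν : ν ∈ κ) :
    ae κ U (fun η => ∀ i, i ∈ ν → (i ∈ ZFSet.sep (fun i => ae κ U (fun ξ => P i ξ)) κ ↔ P i η)) := by
  have hκ := KK.ord κ
  haveI : Fact (ZFSet.sep (fun i => ae κ U (fun ξ => P i ξ)) κ ∈ M) := ⟨g.uq hP⟩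
  have d : Dfn M (fun v => v 0 ∈ ZFSet.sep (fun i => ae κ U (fun ξ => P i ξ)) κ) := inferInstance
  refine g.comp (P := fun i η => i ∈ ZFSet.sep (fun i => ae κ U (fun ξ => P i ξ)) κ ↔ P i η)
    (@Dfn.iff _ _ _ d hP) hν fun i hi => ?_
  have hiκ := hκ.trans hν hi
  haveI : Fact (i ∈ M) := ⟨PM.mem hκM.out hiκ⟩
  have dPi : Dfn M (fun v => P i (v 0)) := hP.const (PM.mem hκM.out hiκ)
  have dd : Dfn M (fun v => i ∈ ZFSet.sep (fun i => ae κ U (fun ξ => P i ξ)) κ ↔ P i (v 0)) :=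
    @Dfn.iff _ _ _ inferInstance dPi
  by_cases h : ae κ U (fun ξ => P i ξ)
  · exact g.mono dd (fun ξ hξ hx => ⟨fun _ => hx, fun _ => ZFSet.mem_sep.2 ⟨hiκ, h⟩⟩) h
  · exact g.mono dd (fun ξ hξ hx => ⟨fun h' => absurd (ZFSet.mem_sep.1 h').2 h,
      fun h' => absurd h' hx⟩) (g.em dPi h)

theorem exists_good (hR : RamseyCardIn N κ) {A : ZFSet.{u}} (hA : A ∈ N) (hAκ : A ⊆ κ) :
    ∃ M U, PM M ∧ Fact (κ ∈ M) ∧ Good κ N M U ∧ A ∈ M := by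
  obtain ⟨M, hM, hAM, hT, hκ, ⟨f, hf, hf1, hf2⟩, U, hU, h1, h2, h3⟩ := hR A hA hAκ
  exact ⟨M, U, ⟨hT⟩, ⟨hκ⟩, ⟨hM, hU, ⟨f, hf, hf1, hf2⟩, h1, h2, h3⟩, hAM⟩

theorem exists_good3 (hR : RamseyCardIn N κ) {A R1 R2 : ZFSet.{u}} (hA : A ∈ N) (hAκ : A ⊆ κ)
    (h1 : R1 ∈ N) (h1κ : R1 ⊆ ZFSet.prod κ κ) (h2 : R2 ∈ N) (h2κ : R2 ⊆ ZFSet.prod κ κ) :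
    ∃ M U, PM M ∧ Fact (κ ∈ M) ∧ Good κ N M U ∧ A ∈ M ∧ R1 ∈ M ∧ R2 ∈ M := by
  haveI : Fact (A ∈ N) := ⟨hA⟩
  haveI : Fact (R1 ∈ N) := ⟨h1⟩
  haveI : Fact (R2 ∈ N) := ⟨h2⟩
  let C := ZFSet.sep (fun γ => (pl κ γ = nn 0 ∧ ZFSet.pair (pl κ (pR κ γ)) (pR κ (pR κ γ)) ∈ R1) ∨
    (pl κ γ = nn 1 ∧ ZFSet.pair (pl κ (pR κ γ)) (pR κ (pR κ γ)) ∈ R2) ∨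
    (pl κ γ = nn 2 ∧ pR κ γ ∈ A)) κ
  have hC : C ∈ N := Tm.mem_out (N := N) inferInstance
  obtain ⟨M, U, hM, hκM, g, hCM⟩ := exists_good hR hC (fun z hz => (ZFSet.mem_sep.1 hz).1)
  haveI : Fact (C ∈ M) := ⟨hCM⟩
  have n01 : ∀ {k l : ℕ}, nn.{u} k = nn l → k = l := fun h => nn_inj h
  have nk : ∀ k, nn.{u} k ∈ κ := fun k => KK.nn k
  refine ⟨M, U, hM, hκM, g, ?_, ?_, ?_⟩
  · have : ZFSet.sep (fun a => pr κ (nn 2) a ∈ C) κ ∈ M := Tm.mem_out (N := M) inferInstance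
    convert this using 1
    ext z
    rw [ZFSet.mem_sep]
    constructor
    · intro hz
      have hzκ := hAκ hz
      refine ⟨hzκ, ZFSet.mem_sep.2 ⟨pr_mem (nk 2) hzκ, Or.inr (Or.inr ?_)⟩⟩
      rw [pl_pr (nk 2) hzκ, pR_pr (nk 2) hzκ]; exact ⟨rfl, hz⟩
    · rintro ⟨hz, h⟩
      have := (ZFSet.mem_sep.1 h).2
      rw [pl_pr (nk 2) hz, pR_pr (nk 2) hz] at this
      rcases this with h | h | h
      · exact absurd (n01 h.1) (by omega)
      · exact absurd (n01 h.1) (by omega)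
      · exact h.2
  · have : ZFSet.sep (fun q => ∃ a, a ∈ κ ∧ ∃ b, b ∈ κ ∧ (q = ZFSet.pair a b ∧ pr κ (nn 0) (pr κ a b) ∈ C))
      (ZFSet.prod κ κ) ∈ M := Tm.mem_out (N := M) inferInstance
    convert this using 1
    ext z
    rw [ZFSet.mem_sep]
    constructor
    · intro hz
      refine ⟨h1κ hz, ?_⟩
      obtain ⟨a, ha, b, hb, rfl⟩ := ZFSet.mem_prod.1 (h1κ hz)
      refine ⟨a, ha, b, hb, rfl, ZFSet.mem_sep.2 ⟨pr_mem (nk 0) (pr_mem ha hb), Or.inl ?_⟩⟩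
      rw [pl_pr (nk 0) (pr_mem ha hb), pR_pr (nk 0) (pr_mem ha hb), pl_pr ha hb, pR_pr ha hb]
      exact ⟨rfl, hz⟩
    · rintro ⟨_, a, ha, b, hb, rfl, h⟩
      have := (ZFSet.mem_sep.1 h).2
      rw [pl_pr (nk 0) (pr_mem ha hb), pR_pr (nk 0) (pr_mem ha hb), pl_pr ha hb, pR_pr ha hb] at this
      rcases this with h | h | h
      · exact h.2
      · exact absurd (n01 h.1) (by omega)
      · exact absurd (n01 h.1) (by omega)
  · have : ZFSet.sep (fun q => ∃ a, a ∈ κ ∧ ∃ b, b ∈ κ ∧ (q = ZFSet.pair a b ∧ pr κ (nn 1) (pr κ a b) ∈ C))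
      (ZFSet.prod κ κ) ∈ M := Tm.mem_out (N := M) inferInstance
    convert this using 1
    ext z
    rw [ZFSet.mem_sep]
    constructor
    · intro hz
      refine ⟨h2κ hz, ?_⟩
      obtain ⟨a, ha, b, hb, rfl⟩ := ZFSet.mem_prod.1 (h2κ hz)
      refine ⟨a, ha, b, hb, rfl, ZFSet.mem_sep.2 ⟨pr_mem (nk 1) (pr_mem ha hb), Or.inr (Or.inl ?_)⟩⟩
      rw [pl_pr (nk 1) (pr_mem ha hb), pR_pr (nk 1) (pr_mem ha hb), pl_pr ha hb, pR_pr ha hb]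
      exact ⟨rfl, hz⟩
    · rintro ⟨_, a, ha, b, hb, rfl, h⟩
      have := (ZFSet.mem_sep.1 h).2
      rw [pl_pr (nk 1) (pr_mem ha hb), pR_pr (nk 1) (pr_mem ha hb), pl_pr ha hb, pR_pr ha hb] at this
      rcases this with h | h | h
      · exact absurd (n01 h.1) (by omega)
      · exact h.2
      · exact absurd (n01 h.1) (by omega)

/-- `κ` is regular in `N`. -/
theorem reg (hR : RamseyCardIn N κ) {c : ZFSet.{u} → ZFSet.{u}} (hc : Tm N (fun v => c (v 0)))
    {γ : ZFSet.{u}} (hγ : γ ∈ κ) (hm : ∀ a ∈ γ, c a ∈ κ) : ∃ β ∈ κ, ∀ a ∈ γ, c a ∈ β := by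
  have hκ := KK.ord κ
  haveI : Fact (γ ∈ N) := ⟨PM.mem hκN.out hγ⟩
  let R := ZFSet.sep (fun q => ∃ a, a ∈ κ ∧ ∃ b, b ∈ κ ∧ (q = ZFSet.pair a b ∧ b ∈ c a)) (ZFSet.prod κ κ)
  have hRN : R ∈ N := by
    haveI : Tm N (fun v => c (v 1)) := hc.rename (fun _ => 1)
    exact Tm.mem_out (N := N) inferInstance
  have hE : (∅ : ZFSet) ∈ N := PM.empty N
  obtain ⟨M, U, hM, hκM, g, -, hRM, -⟩ := exists_good3 hR hE (ZFSet.empty_subset _) hRN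
    (fun z hz => (ZFSet.mem_sep.1 hz).1) hE (ZFSet.empty_subset _)
  haveI : Fact (R ∈ M) := ⟨hRM⟩
  haveI : Fact (γ ∈ M) := ⟨PM.mem hκM.out hγ⟩
  have hRm : ∀ a ∈ γ, ∀ b ∈ κ, (ZFSet.pair a b ∈ R ↔ b ∈ c a) := by
    intro a ha b hb
    have haκ := hκ.trans hγ ha
    constructor
    · intro h
      obtain ⟨_, a', _, b', _, e, h⟩ := ZFSet.mem_sep.1 h
      obtain ⟨rfl, rfl⟩ := ZFSet.pair_inj.1 e
      exact h
    · intro h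
      exact ZFSet.mem_sep.2 ⟨ZFSet.pair_mem_prod.2 ⟨haκ, hb⟩, a, haκ, b, hb, rfl, h⟩
  by_contra hcon
  push Not at hcon
  -- for each `ξ` some `a ∈ γ` with `ξ ⊆ c a`
  have key : ∀ ξ ∈ κ, ∃ a ∈ γ, ∀ b, b ∈ ξ → ZFSet.pair a b ∈ R := by
    intro ξ hξ
    obtain ⟨a, ha, h⟩ := hcon ξ hξ
    refine ⟨a, ha, fun b hb => (hRm a ha b (hκ.trans hξ hb)).2 ?_⟩
    rcases (hκ.mem (hm a ha)).mem_or_sub (hκ.mem hξ) with h' | h'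
    · exact absurd h' h
    · exact h' hb
  have hγo := hκ.mem hγ
  let f : ZFSet.{u} → ZFSet.{u} := fun ξ => mu γ (fun a => ∀ b, b ∈ ξ → ZFSet.pair a b ∈ R)
  have tf : Tm M (fun v => f (v 0)) := by
    show Tm M (fun v => mu γ (fun a => ∀ b, b ∈ v 0 → ZFSet.pair a b ∈ R))
    infer_instance
  have sp : ∀ ξ ∈ κ, f ξ ∈ γ ∧ ∀ b, b ∈ ξ → ZFSet.pair (f ξ) b ∈ R := by
    intro ξ hξ
    obtain ⟨a, ha, h⟩ := key ξ hξ
    have := mu_spec hγo (Q := fun a => ∀ b, b ∈ ξ → ZFSet.pair a b ∈ R) ha h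
    exact ⟨this.1, this.2.1⟩
  obtain ⟨a, ha, h1⟩ := g.pigeon tf hγ (g.all (Dfn.mem (hs := tf)) fun ξ hξ => (sp ξ hξ).1)
  obtain ⟨ξ, hξ, h2, h3⟩ := g.exists_of (g.and h1 (g.aetail (hm a ha)))
  have h4 := (sp ξ hξ).2 _ h3
  rw [h2] at h4
  exact ZFSet.mem_irrefl _ ((hRm a ha _ (hm a ha)).1 h4)

/-- `κ` is a strong limit in `N`, in the form needed. -/
theorem no_inj (hR : RamseyCardIn N κ) {c : ZFSet.{u} → ZFSet.{u}} (hc : Tm N (fun v => c (v 0)))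
    {ν : ZFSet.{u}} (hν : ν ∈ κ) (hm : ∀ α ∈ κ, c α ⊆ ν)
    (hinj : ∀ α ∈ κ, ∀ β ∈ κ, c α = c β → α = β) : False := by
  have hκ := KK.ord κ
  let R := ZFSet.sep (fun q => ∃ a, a ∈ κ ∧ ∃ b, b ∈ κ ∧ (q = ZFSet.pair a b ∧ a ∈ c b)) (ZFSet.prod κ κ)
  have hRN : R ∈ N := by
    haveI : Tm N (fun v => c (v 0)) := hc
    exact Tm.mem_out (N := N) inferInstance
  have hE : (∅ : ZFSet) ∈ N := PM.empty N
  obtain ⟨M, U, hM, hκM, g, -, hRM, -⟩ := exists_good3 hR hE (ZFSet.empty_subset _) hRN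
    (fun z hz => (ZFSet.mem_sep.1 hz).1) hE (ZFSet.empty_subset _)
  haveI : Fact (R ∈ M) := ⟨hRM⟩
  have hRm : ∀ a ∈ ν, ∀ b ∈ κ, (ZFSet.pair a b ∈ R ↔ a ∈ c b) := by
    intro a ha b hb
    have haκ := hκ.trans hν ha
    constructor
    · intro h
      obtain ⟨_, a', _, b', _, e, h⟩ := ZFSet.mem_sep.1 h
      obtain ⟨rfl, rfl⟩ := ZFSet.pair_inj.1 e
      exact h
    · intro h
      exact ZFSet.mem_sep.2 ⟨ZFSet.pair_mem_prod.2 ⟨haκ, hb⟩, a, haκ, b, hb, rfl, h⟩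
  have h1 := g.decide (P := fun a b => ZFSet.pair a b ∈ R) inferInstance hν
  obtain ⟨ξ, hξ, h2⟩ := g.exists_of h1
  obtain ⟨η, hη, h3, h4⟩ := g.exists_of (g.and h1 (g.aetail hξ))
  have : c ξ = c η := by
    ext a
    constructor
    · intro h
      have ha := hm ξ hξ h
      exact (hRm a ha η hη).1 ((h3 a ha).1 ((h2 a ha).2 ((hRm a ha ξ hξ).2 h)))
    · intro h
      have ha := hm η hη h
      exact (hRm a ha ξ hξ).1 ((h2 a ha).1 ((h3 a ha).2 ((hRm a ha η hη).2 h)))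
  have := hinj ξ hξ η hη this
  exact ZFSet.mem_irrefl _ (this ▸ h4)

/-- The approximation argument. -/
theorem Good.sa {V δ : ZFSet.{u}} [hV : PM V] [hκV : Fact (κ ∈ V)] (hVN : V ⊆ N)
    (happ : ApproxProperty δ V.toSet N.toSet) (hδ : δ ∈ κ) (hR : RamseyCardIn N κ)
    (g : Good κ N M U) {P : ZFSet.{u} → ZFSet.{u} → Prop}
    (hP : Dfn M (fun v => P (v 0) (v 1))) (hPV : Dfn V (fun v => P (v 0) (v 1))) :
    ZFSet.sep (fun i => ae κ U (fun ξ => P i ξ)) κ ∈ V := by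
  have hκ := KK.ord κ
  set S := ZFSet.sep (fun i => ae κ U (fun ξ => P i ξ)) κ with hS
  have hSM : S ∈ M := g.uq hP
  refine happ S (g.sub hSM) (fun z hz => PM.mem hκV.out (ZFSet.mem_sep.1 hz).1) ?_
  rintro x hx ⟨γ, hγ, f, hf, hf1, hf2, hf3⟩
  have hγκ := hκ.trans hδ hγ
  haveI : Fact (x ∈ V) := ⟨hx⟩
  haveI : Fact (x ∈ N) := ⟨hVN hx⟩
  haveI : Fact (f ∈ N) := ⟨hVN hf⟩
  let h : ZFSet.{u} → ZFSet.{u} := fun a => ⋃₀ (ZFSet.sep (fun y => y ∈ κ ∧ fapp f y = a) x)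
  have th : Tm N (fun v => h (v 0)) := by
    show Tm N (fun v => (⋃₀ (ZFSet.sep (fun y => y ∈ κ ∧ fapp f y = v 0) x) : ZFSet))
    infer_instance
  have h1 : ∀ y ∈ x, y ∈ κ → h (fapp f y) = y := by
    intro y hy hyκ
    have : ZFSet.sep (fun z => z ∈ κ ∧ fapp f z = fapp f y) x = ({y} : ZFSet) := by
      ext z
      rw [ZFSet.mem_sep, ZFSet.mem_singleton]
      constructor
      · rintro ⟨hz, _, e⟩; exact hf3 z hz y hy e
      · rintro rfl; exact ⟨hy, hyκ, rfl⟩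
    show (⋃₀ (ZFSet.sep (fun z => z ∈ κ ∧ fapp f z = fapp f y) x) : ZFSet) = y
    rw [this, ZFSet.sUnion_singleton]
  have h2 : ∀ a ∈ γ, h a ∈ κ := by
    intro a _
    by_cases hex : ∃ y ∈ x, y ∈ κ ∧ fapp f y = a
    · obtain ⟨y, hy, hyκ, rfl⟩ := hex
      rw [h1 y hy hyκ]; exact hyκ
    · have : ZFSet.sep (fun z => z ∈ κ ∧ fapp f z = a) x = (∅ : ZFSet) :=
        (ZFSet.eq_empty _).2 fun y hy => hex ⟨y, (ZFSet.mem_sep.1 hy).1, (ZFSet.mem_sep.1 hy).2⟩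
      show (⋃₀ (ZFSet.sep (fun z => z ∈ κ ∧ fapp f z = a) x) : ZFSet) ∈ κ
      rw [this, ZFSet.sUnion_empty]; exact KK.nn 0
  obtain ⟨β, hβ, h3⟩ := reg hR th hγκ h2
  obtain ⟨η, hη, h4⟩ := g.exists_of (g.decide hP hβ)
  have dη : Dfn V (fun v => P (v 0) η) :=
    (hPV.rename (fun n => if n = 0 then 1 else 0)).const (PM.mem hκV.out hη)
  haveI : Fact (β ∈ V) := ⟨PM.mem hκV.out hβ⟩
  have dd : Dfn V (fun v => v 0 ∈ β ∧ P (v 0) η) := @Dfn.and _ _ _ inferInstance dη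
  have : ZFSet.sep (fun i => i ∈ β ∧ P i η) x ∈ V :=
    PM.sepv (P := fun i _ => i ∈ β ∧ P i η) dd (v := fun _ => κ) (fun _ => hκV.out) hx
  have e : S ∩ x = ZFSet.sep (fun i => i ∈ β ∧ P i η) x := by
   ext z
   rw [ZFSet.mem_inter, @ZFSet.mem_sep _ x]
   constructor
   · rintro ⟨hz, hzx⟩
     have hzκ := (ZFSet.mem_sep.1 hz).1
     have hzβ : z ∈ β := by
       have := h3 _ (hf2 z hzx)
       rwa [h1 z hzx hzκ] at this
     exact ⟨hzx, hzβ, (h4 z hzβ).1 hz⟩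
   · rintro ⟨hzx, hzβ, hp⟩
     exact ⟨(h4 z hzβ).2 hp, hzx⟩
  exact e ▸ this

end

/-- The context: `V ⊆ N`, `κ` Ramsey in `N`, and `w = V_{κ+3}` of `V`. -/
structure HV (κ V N w : ZFSet.{u}) : Prop where
  sub : V ⊆ N
  R : RamseyCardIn N κ
  wV : w ∈ V
  iff : ∀ x, x ∈ w ↔ (x ∈ V ∧ ZFSet.rank x < ZFSet.rank κ + 3)

/-- `x` is covered by a small function in `V`. -/
def Small (κ V x : ZFSet.{u}) : Prop := ∃ ν ∈ κ, ∃ f, f ∈ V ∧ ∀ y ∈ x, ∃ i ∈ ν, fapp f i = y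

section
variable {κ V N w : ZFSet.{u}} [hk : KK κ] [hN : PM N] [hκN : Fact (κ ∈ N)]
  [hV : PM V] [hκV : Fact (κ ∈ V)]

theorem small_or {x : ZFSet.{u}} (hx : x ∈ V) :
    (∃ θ ∈ κ, ∃ f ∈ V, IsZFunc θ f ∧ SurjOnto f θ x ∧ InjOnZ f θ) ∨
    ∃ f ∈ V, InjOnZ f κ ∧ ∀ i ∈ κ, fapp f i ∈ x := by
  obtain ⟨θ, hθ, ho, f, hf, h1, h2, h3⟩ := PM.enum (N := V) hx
  rcases ho.mem_or_sub (KK.ord κ) with h | h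
  · exact Or.inl ⟨θ, h, f, hf, h1, h2, h3⟩
  · exact Or.inr ⟨f, hf, fun a ha b hb => h3 a (h ha) b (h hb), fun i hi => h2.1 i (h hi)⟩

theorem HV.small_pow (H : HV κ V N w) {y : ZFSet.{u}} (hy : Small κ V y)
    {g : ZFSet.{u}} (hg : g ∈ V) (hinj : InjOnZ g κ) (hsub : ∀ i ∈ κ, fapp g i ⊆ y) : False := by
  obtain ⟨ν, hν, f, hf, hs⟩ := hy
  haveI : Fact (g ∈ N) := ⟨H.sub hg⟩
  haveI : Fact (f ∈ N) := ⟨H.sub hf⟩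
  haveI : Fact (ν ∈ N) := ⟨PM.mem hκN.out hν⟩
  refine no_inj H.R (c := fun i => ZFSet.sep (fun j => fapp f j ∈ fapp g i) ν) inferInstance hν
    (fun α hα z hz => (ZFSet.mem_sep.1 hz).1) ?_
  intro α hα β hβ e
  refine hinj α hα β hβ ?_
  have key : ∀ a b, a ∈ κ → b ∈ κ → ZFSet.sep (fun j => fapp f j ∈ fapp g a) ν =
      ZFSet.sep (fun j => fapp f j ∈ fapp g b) ν → fapp g a ⊆ fapp g b := by
    intro a b ha hb e z hz
    obtain ⟨i, hi, rfl⟩ := hs z (hsub a ha hz)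
    have : i ∈ ZFSet.sep (fun j => fapp f j ∈ fapp g a) ν := ZFSet.mem_sep.2 ⟨hi, hz⟩
    rw [e] at this
    exact (ZFSet.mem_sep.1 this).2
  exact le_antisymm (key α β hα hβ e) (key β α hβ hα e.symm)

/-- A small function has values bounded on pre-images. -/
theorem HV.small_un (H : HV κ V N w) {g : ZFSet.{u}} (hg : g ∈ V) (hinj : InjOnZ g κ)
    {α : ZFSet.{u}} (hα : α ∈ κ)
    {c : ZFSet.{u} → ZFSet.{u}} [hc : Tm N (fun v => c (v 0))] (hcα : ∀ i ∈ κ, c i ∈ α)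
    (hs : ∀ β ∈ α, ∃ P, Small κ V P ∧ ∀ i ∈ κ, c i = β → fapp g i ∈ P) : False := by
  have hκ := KK.ord κ
  haveI : Fact (g ∈ N) := ⟨H.sub hg⟩
  have claim : ∀ β ∈ α, ∃ ν ∈ κ, ∀ i, i ∈ κ → c i = β → i ∈ ν := by
    intro β hβ
    obtain ⟨P, ⟨ν, hν, f, hf, hs⟩, hP⟩ := hs β hβ
    haveI : Fact (f ∈ N) := ⟨H.sub hf⟩
    obtain ⟨μ, hμ, hb⟩ := reg H.R (c := fun j => if ∃ i, i ∈ κ ∧ fapp g i = fapp f j then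
      mu κ (fun i => fapp g i = fapp f j) else κ ∩ ∅) inferInstance hν (by
        intro j hj
        split_ifs with h
        · obtain ⟨i, hi, e⟩ := h
          exact (mu_spec hκ hi e).1
        · have : κ ∩ (∅ : ZFSet.{u}) = ∅ := (ZFSet.eq_empty _).2 fun y hy =>
            ZFSet.notMem_empty _ (ZFSet.mem_inter.1 hy).2
          rw [this]; exact KK.nn 0)
    refine ⟨μ, hμ, fun i hi hci => ?_⟩
    obtain ⟨j, hj, e⟩ := hs _ (hP i hi hci)
    have h1 := hb j hj
    have h2 : ∃ i, i ∈ κ ∧ fapp g i = fapp f j := ⟨i, hi, e.symm⟩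
    rw [if_pos h2] at h1
    have h3 := mu_spec hκ (Q := fun i => fapp g i = fapp f j) hi e.symm
    have : mu κ (fun i => fapp g i = fapp f j) = i := hinj _ h3.1 _ hi (h3.2.1.trans e)
    rwa [this] at h1
  have tc : ∀ k, Tm N (fun v => c (v k)) := fun k => hc.rename (fun _ => k)
  obtain ⟨ν, hν, hb⟩ := reg H.R (c := fun β => mu κ (fun ν => ∀ i, i ∈ κ → c i = β → i ∈ ν))
    (by
      have := tc 0
      infer_instance) hα (by
      intro β hβ
      obtain ⟨ν, hν, h⟩ := claim β hβ
      exact (mu_spec hκ hν h).1)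
  have h1 := hb _ (hcα ν hν)
  obtain ⟨ν', hν', h⟩ := claim _ (hcα ν hν)
  have h2 := (mu_spec hκ (Q := fun μ => ∀ i, i ∈ κ → c i = c ν → i ∈ μ) hν' h)
  have h3 := h2.2.1 ν hν rfl
  exact (ZFSet.mem_asymm h1 h3)

/-- The cumulative hierarchy of `V` below `κ`. -/
def Vh (κ w : ZFSet.{u}) : ZFSet.{u} :=
  recF κ (fun x g => ZFSet.sep (fun y => ∃ β, β ∈ x ∧ y ⊆ fapp g β) w)

/-- The levels. -/
def Va (κ w α : ZFSet.{u}) : ZFSet.{u} := fapp (Vh κ w) α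

theorem mem_Va {α y : ZFSet.{u}} (hα : α ∈ κ) :
    y ∈ Va κ w α ↔ y ∈ w ∧ ∃ β ∈ α, y ⊆ Va κ w β := by
  unfold Va
  conv_lhs => rw [Vh, recF_fapp (KK.ord κ).1 hα, ZFSet.mem_sep]
  refine and_congr_right fun _ => exists_congr fun β => and_congr_right fun hβ => ?_
  rw [fapp_lam hβ, Vh]

theorem Vh_mem (hw : w ∈ V) : Vh κ w ∈ V := by
  haveI : Fact (w ∈ V) := ⟨hw⟩
  haveI : Fact (IsOrd κ) := ⟨KK.ord κ⟩
  unfold Vh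
  exact Tm.mem_out (N := V) inferInstance

theorem Va_mono {α β : ZFSet.{u}} (hα : α ∈ κ) (hβ : β ∈ α) : Va κ w β ⊆ Va κ w α := by
  intro y hy
  obtain ⟨h1, γ, hγ, h2⟩ := (mem_Va ((KK.ord κ).trans hα hβ)).1 hy
  exact (mem_Va hα).2 ⟨h1, γ, ((KK.ord κ).mem hα).trans hβ hγ, h2⟩

theorem Va_trans {α : ZFSet.{u}} (hα : α ∈ κ) : (Va κ w α).IsTransitive := by
  intro y hy z hz
  obtain ⟨h1, γ, hγ, h2⟩ := (mem_Va hα).1 hy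
  exact Va_mono hα hγ (h2 hz)

theorem Va_rank : ∀ {α : ZFSet.{u}}, α ∈ κ → ∀ y ∈ Va κ w α, ZFSet.rank y < ZFSet.rank α := by
  intro α
  induction α using ZFSet.inductionOn with
  | h α ih =>
    intro hα y hy
    obtain ⟨h1, γ, hγ, h2⟩ := (mem_Va hα).1 hy
    have hγκ := (KK.ord κ).trans hα hγ
    refine lt_of_le_of_lt ?_ (ZFSet.rank_lt_of_mem hγ)
    exact ZFSet.rank_le_iff.2 fun _ hz => ih γ hγ hγκ _ (h2 hz)

/-- The universe of sets in `V` of rank below `κ`. -/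
def KV (κ w : ZFSet.{u}) : ZFSet.{u} := ⋃₀ (img (fun α => fapp (Vh κ w) α) κ)

theorem mem_KV {x : ZFSet.{u}} : x ∈ KV κ w ↔ ∃ α ∈ κ, x ∈ Va κ w α := by
  unfold KV
  rw [ZFSet.mem_sUnion]
  constructor
  · rintro ⟨z, hz, hx⟩
    obtain ⟨α, hα, rfl⟩ := mem_img.1 hz
    exact ⟨α, hα, hx⟩
  · rintro ⟨α, hα, hx⟩
    exact ⟨_, mem_img.2 ⟨α, hα, rfl⟩, hx⟩

theorem KV_mem (hw : w ∈ V) : KV κ w ∈ V := by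
  haveI : Fact (Vh κ w ∈ V) := ⟨Vh_mem hw⟩
  unfold KV
  exact Tm.mem_out (N := V) inferInstance

theorem Va_mem (hw : w ∈ V) {α : ZFSet.{u}} (hα : α ∈ κ) : Va κ w α ∈ V := by
  haveI : Fact (Vh κ w ∈ V) := ⟨Vh_mem hw⟩
  haveI : Fact (α ∈ V) := ⟨PM.mem hκV.out hα⟩
  unfold Va
  exact Tm.mem_out (N := V) inferInstance

/-- Subsets of levels are in the universe. -/
theorem HV.next (H : HV κ V N w) {α y : ZFSet.{u}} (hα : α ∈ κ) (hy : y ∈ V) (hs : y ⊆ Va κ w α) :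
    y ∈ Va κ w (insert α α) := by
  refine (mem_Va (KK.succ hα)).2 ⟨(H.iff y).2 ⟨hy, ?_⟩, α, ZFSet.mem_insert _ _, hs⟩
  have h1 : ZFSet.rank y ≤ ZFSet.rank α := ZFSet.rank_le_iff.2 fun _ hz => Va_rank hα _ (hs hz)
  exact lt_of_lt_of_le (lt_of_le_of_lt h1 (ZFSet.rank_lt_of_mem hα)) (le_self_add)

theorem HV.nextK (H : HV κ V N w) {α y : ZFSet.{u}} (hα : α ∈ κ) (hy : y ∈ V)
    (hs : y ⊆ Va κ w α) : y ∈ KV κ w := mem_KV.2 ⟨_, KK.succ hα, H.next hα hy hs⟩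

theorem KV_trans : (KV κ w).IsTransitive := by
  intro y hy z hz
  obtain ⟨α, hα, h⟩ := mem_KV.1 hy
  exact mem_KV.2 ⟨α, hα, (Va_trans hα) y h hz⟩

theorem HV.w_sub (H : HV κ V N w) {x : ZFSet.{u}} (hx : x ∈ KV κ w) : x ∈ V :=
  PM.mem (KV_mem H.wV) hx

/-- Levels are small. -/
theorem HV.Va_small (H : HV κ V N w) : ∀ {α : ZFSet.{u}}, α ∈ κ → Small κ V (Va κ w α) := by
  intro α
  have hκ := KK.ord κ
  induction α using ZFSet.inductionOn with
  | h α ih =>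
    intro hα
    haveI : Fact (w ∈ V) := ⟨H.wV⟩
    haveI : Fact (w ∈ N) := ⟨H.sub H.wV⟩
    rcases small_or (κ := κ) (Va_mem (V := V) H.wV hα) with ⟨θ, hθ, f, hf, _, h2, _⟩ | ⟨f, hf, h1, h2⟩
    · exact ⟨θ, hθ, f, hf, fun y hy => h2.2 y hy⟩
    exfalso
    haveI : Fact (f ∈ N) := ⟨H.sub hf⟩
    haveI : Fact (α ∈ N) := ⟨PM.mem hκN.out hα⟩
    haveI : Fact (Vh κ w ∈ N) := ⟨Vh_mem (V := N) (H.sub H.wV)⟩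
    have hs : ∀ i ∈ κ, mu α (fun β => fapp f i ⊆ fapp (Vh κ w) β) ∈ α ∧
        fapp f i ⊆ Va κ w (mu α (fun β => fapp f i ⊆ fapp (Vh κ w) β)) := by
      intro i hi
      obtain ⟨_, γ, hγ, h⟩ := (mem_Va hα).1 (h2 i hi)
      have := mu_spec (hκ.mem hα) (Q := fun β => fapp f i ⊆ fapp (Vh κ w) β) hγ h
      exact ⟨this.1, this.2.1⟩
    refine H.small_un hf h1 hα (c := fun i => mu α (fun β => fapp f i ⊆ fapp (Vh κ w) β))
      (fun i hi => (hs i hi).1) ?_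
    intro β hβ
    have hβκ := hκ.trans hα hβ
    haveI : Fact (Va κ w β ∈ V) := ⟨Va_mem (V := V) H.wV hβκ⟩
    have hP : ZFSet.sep (fun y => y ⊆ Va κ w β) w ∈ V := Tm.mem_out (N := V) inferInstance
    refine ⟨ZFSet.sep (fun y => y ⊆ Va κ w β) w, ?_, fun i hi e => ZFSet.mem_sep.2 ⟨((mem_Va hα).1 (h2 i hi)).1, e ▸ (hs i hi).2⟩⟩
    rcases small_or (κ := κ) hP with ⟨θ, hθ, f, hf, _, h2, _⟩ | ⟨f, hf, h1, h2⟩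
    · exact ⟨θ, hθ, f, hf, fun y hy => h2.2 y hy⟩
    · exact (H.small_pow (ih β hβ hβκ) hf h1 fun i hi => (ZFSet.mem_sep.1 (h2 i hi)).2).elim

/-- Rank of an element of the universe. -/
def rho (κ w x : ZFSet.{u}) : ZFSet.{u} := mu κ (fun α => x ∈ fapp (Vh κ w) α)

theorem rho_spec {x : ZFSet.{u}} (hx : x ∈ KV κ w) : rho κ w x ∈ κ ∧ x ∈ Va κ w (rho κ w x) := by
  obtain ⟨α, hα, h⟩ := mem_KV.1 hx
  have := mu_spec (KK.ord κ) (Q := fun α => x ∈ fapp (Vh κ w) α) hα h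
  exact ⟨this.1, this.2.1⟩

theorem Va_le {α β x : ZFSet.{u}} (hα : α ∈ κ) (hβ : β ∈ κ) (h : β ⊆ α) (hx : x ∈ Va κ w β) :
    x ∈ Va κ w α := by
  rcases (IsOrd.sub_iff ((KK.ord κ).mem hβ) ((KK.ord κ).mem hα)).1 h with e | e
  · exact e ▸ hx
  · exact Va_mono hα e hx

/-- Small subsets of the universe are in it. -/
theorem HV.Ksub (H : HV κ V N w) {y : ZFSet.{u}} (hy : y ∈ V) (hs : y ⊆ KV κ w)
    (hsm : Small κ V y) : y ∈ KV κ w ∧ ∃ α ∈ κ, y ⊆ Va κ w α := by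
  have hκ := KK.ord κ
  obtain ⟨ν, hν, f, hf, h⟩ := hsm
  haveI : Fact (f ∈ N) := ⟨H.sub hf⟩
  haveI : Fact (y ∈ N) := ⟨H.sub hy⟩
  haveI : Fact (Vh κ w ∈ N) := ⟨Vh_mem (V := N) (H.sub H.wV)⟩
  obtain ⟨β, hβ, hb⟩ := reg H.R (c := fun i => if fapp f i ∈ y then
      mu κ (fun α => fapp f i ∈ fapp (Vh κ w) α) else ∅) (by
        haveI : Fact ((∅ : ZFSet.{u}) ∈ N) := ⟨PM.empty N⟩
        infer_instance) hν (by
        intro i hi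
        split_ifs with h
        · exact (rho_spec (hs h)).1
        · exact KK.nn 0)
  have : y ⊆ Va κ w β := by
    intro z hz
    obtain ⟨i, hi, rfl⟩ := h z hz
    have h1 := hb i hi
    rw [if_pos hz] at h1
    exact Va_mono hβ h1 (rho_spec (hs hz)).2
  exact ⟨H.nextK hβ hy this, β, hβ, this⟩

theorem HV.ord_sub (H : HV κ V N w) : ∀ {α : ZFSet.{u}}, α ∈ κ → α ⊆ Va κ w α := by
  intro α
  induction α using ZFSet.inductionOn with
  | h α ih =>
    intro hα β hβ
    have hβκ := (KK.ord κ).trans hα hβ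
    refine (mem_Va hα).2 ⟨(H.iff β).2 ⟨PM.mem hκV.out hβκ, ?_⟩, β, hβ, ih β hβ hβκ⟩
    exact lt_of_lt_of_le (ZFSet.rank_lt_of_mem hβκ) le_self_add

theorem HV.ordK (H : HV κ V N w) {α : ZFSet.{u}} (hα : α ∈ κ) : α ∈ KV κ w :=
  H.nextK hα (PM.mem hκV.out hα) (H.ord_sub hα)

theorem Va_dir {α β : ZFSet.{u}} (hα : α ∈ κ) (hβ : β ∈ κ) :
    ∃ γ ∈ κ, Va κ w α ⊆ Va κ w γ ∧ Va κ w β ⊆ Va κ w γ := by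
  rcases IsOrd.tri ((KK.ord κ).mem hα) ((KK.ord κ).mem hβ) with h | h | h
  · exact ⟨β, hβ, Va_mono hβ h, fun _ h => h⟩
  · exact ⟨β, hβ, by rw [h], fun _ h => h⟩
  · exact ⟨α, hα, fun _ h => h, Va_mono hα h⟩

theorem HV.pairK (H : HV κ V N w) {x y : ZFSet.{u}} (hx : x ∈ KV κ w) (hy : y ∈ KV κ w) :
    ({x, y} : ZFSet.{u}) ∈ KV κ w := by
  obtain ⟨α, hα, h1⟩ := mem_KV.1 hx
  obtain ⟨β, hβ, h2⟩ := mem_KV.1 hy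
  obtain ⟨γ, hγ, s1, s2⟩ := Va_dir (w := w) hα hβ
  refine H.nextK hγ (hV.out.2.2.1 x (H.w_sub hx) y (H.w_sub hy)) ?_
  intro z hz
  rcases ZFSet.mem_pair.1 hz with rfl | rfl
  · exact s1 h1
  · exact s2 h2

theorem HV.isTransModel (H : HV κ V N w) : IsTransModel (KV κ w) := by
  have hκ := KK.ord κ
  haveI : Fact (KV κ w ∈ V) := ⟨KV_mem H.wV⟩
  haveI : Fact (KV κ w ∈ N) := ⟨H.sub (KV_mem H.wV)⟩
  haveI : Fact (Vh κ w ∈ N) := ⟨Vh_mem (V := N) (H.sub H.wV)⟩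
  refine ⟨KV_trans, H.ordK KK.om, fun x hx y hy => H.pairK hx hy, ?_, ?_, ?_, ?_⟩
  · intro x hx
    obtain ⟨α, hα, h⟩ := mem_KV.1 hx
    refine H.nextK hα (hV.out.2.2.2.1 x (H.w_sub hx)) ?_
    intro z hz
    obtain ⟨y, hy, hz⟩ := ZFSet.mem_sUnion.1 hz
    exact Va_trans hα y (Va_trans hα x h hy) hz
  · intro φ v hv a ha
    obtain ⟨α, hα, h⟩ := mem_KV.1 ha
    haveI : ∀ n, Fact (v n ∈ V) := fun n => ⟨H.w_sub (hv n)⟩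
    refine ⟨ZFSet.sep (fun x => Sat (KV κ w).toSet φ (Function.update v 0 x)) a, ?_,
      fun x => ZFSet.mem_sep⟩
    refine H.nextK hα ?_ (fun z hz => Va_trans hα a h (ZFSet.mem_sep.1 hz).1)
    have d : Dfn V (fun u => Sat (KV κ w).toSet φ (fun n => if n = 0 then u 0 else v n)) := by
      refine relSat φ (fun n u => if n = 0 then u 0 else v n) ?_
      intro n
      by_cases h0 : n = 0
      · simp only [h0, if_true]; infer_instance
      · simp only [h0, if_false]; infer_instance
    have := PM.sepv (P := fun x _ => Sat (KV κ w).toSet φ (fun n => if n = 0 then x else v n)) d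
      (v := fun _ => κ) (fun _ => hκV.out) (H.w_sub ha)
    convert this using 5
    rename_i x n
    by_cases h0 : n = 0
    · subst h0; simp
    · simp [h0]
  · intro φ v hv a ha hex
    haveI : ∀ n, Fact (v n ∈ N) := fun n => ⟨H.sub (H.w_sub (hv n))⟩
    obtain ⟨α, hα, h⟩ := mem_KV.1 ha
    obtain ⟨ν, hν, f, hf, hs⟩ := H.Va_small hα
    haveI : Fact (f ∈ N) := ⟨H.sub hf⟩
    haveI : Fact (a ∈ N) := ⟨H.sub (H.w_sub ha)⟩
    haveI : Fact ((∅ : ZFSet.{u}) ∈ N) := ⟨PM.empty N⟩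
    let vv : ZFSet.{u} → ZFSet.{u} → ℕ → ZFSet.{u} := fun x y n =>
      if n = 1 then y else if n = 0 then x else v n
    have evv : ∀ x y, vv x y = Function.update (Function.update v 0 x) 1 y := by
      intro x y
      funext n
      by_cases h1 : n = 1
      · subst h1; simp [vv]
      · by_cases h0 : n = 0
        · subst h0; simp [vv]
        · simp [vv, h1, h0]
    have d : Dfn N (fun u => Sat (KV κ w).toSet φ (vv (u 0) (u 1))) := by
      refine relSat φ (fun n u => vv (u 0) (u 1) n) ?_
      intro n
      by_cases h1 : n = 1
      · simp only [vv, h1, if_true]; infer_instance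
      · by_cases h0 : n = 0
        · subst h0; simp only [vv, h1, if_true, if_false]; infer_instance
        · simp only [vv, h1, h0, if_false]; infer_instance
    have d2 : Dfn N (fun u => Sat (KV κ w).toSet φ (vv (fapp f (u 2)) (u 0))) :=
      Dfn.comp2 (R := fun x y => Sat (KV κ w).toSet φ (vv x y)) d inferInstance inferInstance
    obtain ⟨β, hβ, hb⟩ := reg H.R (c := fun i => if fapp f i ∈ a then
      mu κ (fun α => ∃ y, y ∈ fapp (Vh κ w) α ∧ Sat (KV κ w).toSet φ (vv (fapp f i) y)) else ∅)
      inferInstance hν (by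
        intro i hi
        split_ifs with h
        · obtain ⟨y, hy, hs⟩ := hex _ h
          obtain ⟨α, hα, h⟩ := mem_KV.1 hy
          refine (mu_spec hκ hα ⟨y, h, ?_⟩).1
          rw [evv]; exact hs
        · exact KK.nn 0)
    refine ⟨Va κ w β, H.nextK hβ (Va_mem H.wV hβ) (fun _ h => h), ?_⟩
    intro x hx
    obtain ⟨i, hi, rfl⟩ := hs x (Va_trans hα a h hx)
    have h1 := hb i hi
    rw [if_pos hx] at h1
    obtain ⟨y, hy, hs⟩ := hex _ hx
    obtain ⟨α, hα, h⟩ := mem_KV.1 hy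
    obtain ⟨h2, ⟨y', hy', h3⟩, _⟩ := mu_spec hκ (Q := fun α => ∃ y, y ∈ fapp (Vh κ w) α ∧
      Sat (KV κ w).toSet φ (vv (fapp f i) y)) hα ⟨y, h, by rw [evv]; exact hs⟩
    exact ⟨y', Va_mono hβ h1 hy', by rw [← evv]; exact h3⟩
  · intro x hx
    obtain ⟨r, hr, hw⟩ := hV.out.2.2.2.2.2.2 x (H.w_sub hx)
    refine ⟨r, ?_, hw⟩
    obtain ⟨α, hα, h⟩ := mem_KV.1 hx
    have e : ∀ a ∈ Va κ w α, ∀ b ∈ Va κ w α, ({a, b} : ZFSet.{u}) ∈ Va κ w (insert α α) := by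
      intro a ha b hb
      refine H.next hα (hV.out.2.2.1 a (H.w_sub (mem_KV.2 ⟨α, hα, ha⟩)) b
        (H.w_sub (mem_KV.2 ⟨α, hα, hb⟩))) ?_
      intro z hz
      rcases ZFSet.mem_pair.1 hz with rfl | rfl <;> assumption
    refine H.nextK (KK.succ (KK.succ hα)) hr ?_
    intro p hp
    obtain ⟨a, ha, b, hb, rfl⟩ := hw.1 p hp
    have ha' := Va_trans hα x h ha
    have hb' := Va_trans hα x h hb
    refine H.next (KK.succ hα) (PM.mem hr hp) ?_
    intro z hz
    rcases ZFSet.mem_pair.1 hz with rfl | rfl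
    · have := e a ha' a ha'
      rwa [ZFSet.pair_eq_singleton] at this
    · exact e a ha' b hb'

end

section
variable {κ V N w : ZFSet.{u}} [hk : KK κ] [hN : PM N] [hκN : Fact (κ ∈ N)]
  [hV : PM V] [hκV : Fact (κ ∈ V)]

/-- The universe has size `κ` in `V`. -/
theorem HV.enumK (H : HV κ V N w) : ∃ gK ∈ V, IsZFunc κ gK ∧ SurjOnto gK κ (KV κ w) := by
  have hκ := KK.ord κ
  obtain ⟨θ, hθ, ho, f, hf, h1, h2, h3⟩ := PM.enum (N := V) (KV_mem (κ := κ) H.wV)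
  haveI : Fact (f ∈ V) := ⟨hf⟩
  haveI : Fact (θ ∈ V) := ⟨hθ⟩
  haveI : Fact (Vh κ w ∈ V) := ⟨Vh_mem H.wV⟩
  haveI : Fact (KV κ w ∈ V) := ⟨KV_mem H.wV⟩
  set K := KV κ w with hK
  let ix : ZFSet.{u} → ZFSet.{u} := fun x => inv f θ x
  have hix : ∀ x ∈ K, ix x ∈ θ ∧ fapp f (ix x) = x := by
    intro x hx
    obtain ⟨i, hi, rfl⟩ := h2.2 x hx
    show inv f θ (fapp f i) ∈ θ ∧ fapp f (inv f θ (fapp f i)) = _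
    rw [inv_eq h3 hi]; exact ⟨hi, rfl⟩
  let L : ZFSet.{u} → ZFSet.{u} → Prop := fun x y => rho κ w x ∈ rho κ w y ∨
    (rho κ w x = rho κ w y ∧ inv f θ x ∈ inv f θ y)
  let E := ZFSet.sep (fun q => ∃ x, x ∈ K ∧ ∃ y, y ∈ K ∧ (q = ZFSet.pair x y ∧
    (rho κ w x ∈ rho κ w y ∨ (rho κ w x = rho κ w y ∧ inv f θ x ∈ inv f θ y)))) (ZFSet.prod K K)
  have hE : E ∈ V := by
    show ZFSet.sep (fun q => ∃ x, x ∈ K ∧ ∃ y, y ∈ K ∧ (q = ZFSet.pair x y ∧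
     (rho κ w x ∈ rho κ w y ∨ (rho κ w x = rho κ w y ∧ inv f θ x ∈ inv f θ y)))) (ZFSet.prod K K) ∈ V
    unfold rho
    exact Tm.mem_out (N := V) inferInstance
  have mE : ∀ x ∈ K, ∀ y ∈ K, (ZFSet.pair x y ∈ E ↔ L x y) := by
    intro x hx y hy
    constructor
    · intro h
      obtain ⟨x', _, y', _, e, h⟩ := (ZFSet.mem_sep.1 h).2
      obtain ⟨rfl, rfl⟩ := ZFSet.pair_inj.1 e
      exact h
    · intro h
      exact ZFSet.mem_sep.2 ⟨ZFSet.pair_mem_prod.2 ⟨hx, hy⟩, x, hx, y, hy, rfl, h⟩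
  have or : ∀ x ∈ K, IsOrd (rho κ w x) := fun x hx => hκ.mem (rho_spec hx).1
  have oi : ∀ x ∈ K, IsOrd (ix x) := fun x hx => ho.mem (hix x hx).1
  have iwf : IWF V K E := by
    intro X _ hXK hne
    obtain ⟨x, hx⟩ : ∃ x, x ∈ X := by
      by_contra h0; exact hne ((ZFSet.eq_empty X).2 fun y hy => h0 ⟨y, hy⟩)
    obtain ⟨ρ, hρ, ⟨x1, hx1, e1⟩, hm⟩ := ord_least (θ := κ) (fun ρ => ∃ x ∈ X, rho κ w x = ρ)
      (rho_spec (hXK hx)).1 ⟨x, hx, rfl⟩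
    obtain ⟨j, hj, ⟨x2, hx2, e2, e3⟩, hm2⟩ := ord_least (θ := θ)
      (fun j => ∃ x ∈ X, rho κ w x = ρ ∧ ix x = j) (hix _ (hXK hx1)).1 ⟨x1, hx1, e1, rfl⟩
    refine ⟨x2, hx2, fun y hy h => ?_⟩
    rcases (mE y (hXK hy) x2 (hXK hx2)).1 h with h | ⟨h, h'⟩
    · exact hm _ (rho_spec (hXK hy)).1 (e2 ▸ h) ⟨y, hy, rfl⟩
    · exact hm2 _ (hix _ (hXK hy)).1 (e3 ▸ h') ⟨y, hy, h.trans e2, rfl⟩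
  obtain ⟨p, hp, hc⟩ := exists_collapse (KV_mem (κ := κ) H.wV) hE iwf
  have inj : InjOnZ p K := by
    refine hc.inj ?_
    intro x hx y hy
    rw [mE x hx y hy, mE y hy x hx]
    rcases (or x hx).tri (or y hy) with h | h | h
    · exact Or.inr (Or.inl (Or.inl h))
    · rcases (oi x hx).tri (oi y hy) with h' | h' | h'
      · exact Or.inr (Or.inl (Or.inr ⟨h, h'⟩))
      · left
        rw [← (hix x hx).2, ← (hix y hy).2, h']
      · exact Or.inr (Or.inr (Or.inr ⟨h.symm, h'⟩))
    · exact Or.inr (Or.inr (Or.inl h))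
  have ord : ∀ x ∈ K, IsOrd (fapp p x) := by
    refine hc.isOrd ?_
    intro x hx y hy z hz
    rw [mE x hx y hy, mE y hy z hz, mE x hx z hz]
    rintro (a | ⟨a, a'⟩) (b | ⟨b, b'⟩)
    · exact Or.inl ((or z hz).trans b a)
    · exact Or.inl (b ▸ a)
    · exact Or.inl (a ▸ b)
    · exact Or.inr ⟨a.trans b, (oi z hz).trans b' a'⟩
  have lt : ∀ x ∈ K, fapp p x ∈ κ := by
    intro x hx
    rcases (ord x hx).mem_or_sub hκ with h | h
    · exact h
    exfalso
    have hr := rho_spec hx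
    obtain ⟨ν, hν, g, hg, hs⟩ := H.Va_small hr.1
    haveI : Fact (p ∈ N) := ⟨H.sub hp⟩
    haveI : Fact (g ∈ N) := ⟨H.sub hg⟩
    haveI : Fact ((∅ : ZFSet.{u}) ∈ N) := ⟨PM.empty N⟩
    obtain ⟨β, hβ, hb⟩ := reg H.R (c := fun i => if fapp p (fapp g i) ∈ κ then fapp p (fapp g i) else ∅)
      inferInstance hν (by
        intro i hi
        split_ifs with h
        · exact h
        · exact KK.nn 0)
    obtain ⟨y, hy, hyx, e⟩ := hc.exists_of hx (h hβ)
    have hyV : y ∈ Va κ w (rho κ w x) := by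
      rcases (mE y hy x hx).1 hyx with h | ⟨h, _⟩
      · exact Va_mono hr.1 h (rho_spec hy).2
      · exact h ▸ (rho_spec hy).2
    obtain ⟨i, hi, rfl⟩ := hs y hyV
    have := hb i hi
    rw [e, if_pos hβ] at this
    exact ZFSet.mem_irrefl _ this
  haveI : Fact (p ∈ V) := ⟨hp⟩
  refine ⟨lam κ (fun i => inv p K i), Tm.mem_out (N := V) inferInstance, isZFunc_lam _ _, ?_, ?_⟩
  · intro i hi
    rw [fapp_lam hi]
    by_cases h : ∃ x ∈ K, fapp p x = i
    · obtain ⟨x, hx, rfl⟩ := h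
      rw [inv_eq inj hx]; exact hx
    · have : ZFSet.sep (fun x => fapp p x = i) K = (∅ : ZFSet) :=
        (ZFSet.eq_empty _).2 fun y hy => h ⟨y, (ZFSet.mem_sep.1 hy).1, (ZFSet.mem_sep.1 hy).2⟩
      unfold inv
      rw [this, ZFSet.sUnion_empty]
      exact H.ordK (KK.nn 0)
  · intro x hx
    refine ⟨fapp p x, lt x hx, ?_⟩
    rw [fapp_lam (lt x hx), inv_eq inj hx]

end

/-- Change the value of the function `v` at `i` to `x`. -/
def upd (v i x : ZFSet.{u}) : ZFSet.{u} :=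
  insert (ZFSet.pair i x) (ZFSet.sep (fun q => ∀ y, y ∈ (⋃₀ (⋃₀ v) : ZFSet.{u}) → ¬ q = ZFSet.pair i y) v)

instance Tm.upd {N : ZFSet.{u}} [hN : PM N] {s t r : (ℕ → ZFSet) → ZFSet} [hs : Tm N s] [ht : Tm N t]
    [hr : Tm N r] : Tm N (fun v => MPaper.upd (s v) (t v) (r v)) := by
  have h1 : Tm N (fun v => t (fun n => v (n + 1))) := ht.rename Nat.succ
  have h2 : Tm N (fun v => s (fun n => v (n + 1))) := hs.rename Nat.succ
  have h3 : Tm N (fun v => t (fun n => v (n + 2))) := ht.rename (fun n => n + 2)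
  unfold MPaper.upd
  infer_instance

theorem mem_ss {v i y : ZFSet.{u}} (h : ZFSet.pair i y ∈ v) : y ∈ (⋃₀ (⋃₀ v) : ZFSet.{u}) :=
  ZFSet.mem_sUnion.2 ⟨{i, y}, ZFSet.mem_sUnion.2 ⟨_, h, by simp [ZFSet.pair]⟩, by simp⟩

theorem pair_mem_upd {v i x j y : ZFSet.{u}} :
    ZFSet.pair j y ∈ upd v i x ↔ (j = i ∧ y = x) ∨ (j ≠ i ∧ ZFSet.pair j y ∈ v) := by
  unfold upd
  rw [ZFSet.mem_insert_iff, ZFSet.mem_sep, ZFSet.pair_inj]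
  constructor
  · rintro (h | ⟨h1, h2⟩)
    · exact Or.inl h
    · refine Or.inr ⟨?_, h1⟩
      rintro rfl
      exact h2 y (mem_ss h1) rfl
  · rintro (h | ⟨h1, h2⟩)
    · exact Or.inl h
    · exact Or.inr ⟨h2, fun z _ e => h1 (ZFSet.pair_inj.1 e).1⟩

theorem fapp_congr {f g a : ZFSet.{u}} (h : ∀ b, ZFSet.pair a b ∈ f ↔ ZFSet.pair a b ∈ g) :
    fapp f a = fapp g a := by
  unfold fapp
  congr 1
  ext b
  rw [ZFSet.mem_sep, ZFSet.mem_sep, h]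
  exact ⟨fun ⟨_, h'⟩ => ⟨mem_ss h', h'⟩, fun ⟨_, h'⟩ => ⟨mem_ss ((h b).2 h'), h'⟩⟩

theorem fapp_upd_same (v i x : ZFSet.{u}) : fapp (upd v i x) i = x := by
  refine fapp_of (pair_mem_upd.2 (Or.inl ⟨rfl, rfl⟩)) fun c hc => ?_
  rcases pair_mem_upd.1 hc with h | h
  · exact h.2
  · exact absurd rfl h.1

theorem fapp_upd_ne (v x : ZFSet.{u}) {i j : ZFSet.{u}} (h : j ≠ i) : fapp (upd v i x) j = fapp v j := by
  refine fapp_congr fun b => ?_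
  rw [pair_mem_upd]
  tauto

/-- The assignment coded by `v`. -/
def av (v : ZFSet.{u}) (n : ℕ) : ZFSet.{u} := fapp v (nn n)

theorem av_upd (v x : ZFSet.{u}) (n : ℕ) : av (upd v (nn n) x) = Function.update (av v) n x := by
  funext m
  by_cases h : m = n
  · subst h
    rw [Function.update_self]; exact fapp_upd_same _ _ _
  · rw [Function.update_of_ne h]
    exact fapp_upd_ne _ _ fun e => h (nn_inj e)

/-- One step in the recursive definition of the truth predicate. -/
def TP (κ K c g : ZFSet.{u}) : ZFSet.{u} :=
  if pl κ c = nn 1 then ZFSet.sep (fun v => fapp v (pl κ (pR κ c)) ∈ fapp v (pR κ (pR κ c))) K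
  else if pl κ c = nn 2 then ZFSet.sep (fun v => fapp v (pl κ (pR κ c)) = fapp v (pR κ (pR κ c))) K
  else if pl κ c = nn 3 then
    ZFSet.sep (fun v => v ∈ fapp g (pl κ (pR κ c)) → v ∈ fapp g (pR κ (pR κ c))) K
  else if pl κ c = nn 4 then ZFSet.sep (fun v => ¬ v ∈ fapp g (pl κ (pR κ c))) K
  else ZFSet.sep (fun v => ∀ x, x ∈ K → upd v (pl κ (pR κ c)) x ∈ fapp g (pR κ (pR κ c))) K

/-- The truth predicate. -/
def TT (κ K : ZFSet.{u}) : ZFSet.{u} := recF κ (fun c g => TP κ K c g)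

section
variable {κ K V : ZFSet.{u}} [hk : KK κ] [hV : PM V] [hκV : Fact (κ ∈ V)]

set_option synthInstance.maxHeartbeats 400000 in
set_option synthInstance.maxSize 100000 in
theorem TT_mem (hK : K ∈ V) : TT κ K ∈ V := by
  haveI : Fact (K ∈ V) := ⟨hK⟩
  unfold TT TP
  exact Tm.mem_out (N := V) inferInstance

theorem TT_fapp {c : ZFSet.{u}} (hc : c ∈ κ) : fapp (TT κ K) c = TP κ K c (lam c (fapp (TT κ K))) :=
  recF_fapp (KK.ord κ).1 hc

theorem code_aux {t : ℕ} (ht : t ≠ 0) {i j : ZFSet.{u}} (hi : i ∈ κ) (hj : j ∈ κ) :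
    pr κ (nn t) (pr κ i j) ∈ κ ∧ pl κ (pr κ (nn t) (pr κ i j)) = nn t ∧
    pl κ (pR κ (pr κ (nn t) (pr κ i j))) = i ∧ pR κ (pR κ (pr κ (nn t) (pr κ i j))) = j ∧
    i ∈ pr κ (nn t) (pr κ i j) ∧ j ∈ pr κ (nn t) (pr κ i j) := by
  have h0 : nn t ≠ (∅ : ZFSet.{u}) := by
    intro h
    exact ht (nn_inj (h.trans (show (∅ : ZFSet.{u}) = nn 0 from rfl)))
  have hij := pr_mem (κ := κ) hi hj
  have hm := mem_pr3 (κ := κ) (KK.nn t) hi hj h0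
  refine ⟨pr_mem (KK.nn t) hij, pl_pr (KK.nn t) hij, ?_, ?_, hm.1, hm.2⟩
  · rw [pR_pr (KK.nn t) hij, pl_pr hi hj]
  · rw [pR_pr (KK.nn t) hij, pR_pr hi hj]

theorem nn_ne {a b : ℕ} (h : a ≠ b) : (nn a : ZFSet.{u}) ≠ nn b := fun e => h (nn_inj e)

theorem TT_spec [hK : PM K] (hκK : κ ⊆ K) (φ : Fml) :
    ∃ c ∈ κ, ∀ v ∈ K, (v ∈ fapp (TT κ K) c ↔ Sat K.toSet φ (av v)) := by
  induction φ with
  | mem i j =>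
    obtain ⟨h1, h2, h3, h4, h5, h6⟩ := code_aux (κ := κ) (t := 1) (by decide) (KK.nn i) (KK.nn j)
    refine ⟨_, h1, fun v hv => ?_⟩
    rw [TT_fapp h1, TP, if_pos h2, h3, h4, ZFSet.mem_sep]
    exact ⟨fun h => h.2, fun h => ⟨hv, h⟩⟩
  | eq i j =>
    obtain ⟨h1, h2, h3, h4, h5, h6⟩ := code_aux (κ := κ) (t := 2) (by decide) (KK.nn i) (KK.nn j)
    refine ⟨_, h1, fun v hv => ?_⟩
    rw [TT_fapp h1, TP, h2, if_neg (nn_ne (by decide)), if_pos rfl, h3, h4, ZFSet.mem_sep]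
    exact ⟨fun h => h.2, fun h => ⟨hv, h⟩⟩
  | impl φ ψ ih1 ih2 =>
    obtain ⟨i, hi, e1⟩ := ih1
    obtain ⟨j, hj, e2⟩ := ih2
    obtain ⟨h1, h2, h3, h4, h5, h6⟩ := code_aux (κ := κ) (t := 3) (by decide) hi hj
    refine ⟨_, h1, fun v hv => ?_⟩
    rw [TT_fapp h1, TP, h2, if_neg (nn_ne (by decide)), if_neg (nn_ne (by decide)), if_pos rfl, h3, h4,
      ZFSet.mem_sep, fapp_lam h5, fapp_lam h6, e1 v hv, e2 v hv]
    exact ⟨fun h => h.2, fun h => ⟨hv, h⟩⟩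
  | neg φ ih1 =>
    obtain ⟨i, hi, e1⟩ := ih1
    obtain ⟨h1, h2, h3, h4, h5, h6⟩ := code_aux (κ := κ) (t := 4) (by decide) hi hi
    refine ⟨_, h1, fun v hv => ?_⟩
    rw [TT_fapp h1, TP, h2, if_neg (nn_ne (by decide)), if_neg (nn_ne (by decide)),
      if_neg (nn_ne (by decide)), if_pos rfl, h3,
      ZFSet.mem_sep, fapp_lam h5, e1 v hv]
    exact ⟨fun h => h.2, fun h => ⟨hv, h⟩⟩
  | all n φ ih1 =>
    obtain ⟨j, hj, e1⟩ := ih1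
    obtain ⟨h1, h2, h3, h4, h5, h6⟩ := code_aux (κ := κ) (t := 5) (by decide) (KK.nn n) hj
    refine ⟨_, h1, fun v hv => ?_⟩
    have hu : ∀ x ∈ K, upd v (nn n) x ∈ K := by
      intro x hx
      haveI : Fact (x ∈ K) := ⟨hx⟩
      haveI : Fact (v ∈ K) := ⟨hv⟩
      exact Tm.mem_out (N := K) inferInstance
    rw [TT_fapp h1, TP, h2, if_neg (nn_ne (by decide)), if_neg (nn_ne (by decide)),
      if_neg (nn_ne (by decide)), if_neg (nn_ne (by decide)), h3, h4,
      ZFSet.mem_sep, fapp_lam h6]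
    constructor
    · rintro ⟨_, h⟩ x hx
      have := (e1 _ (hu x hx)).1 (h x hx)
      rwa [av_upd] at this
    · intro h
      refine ⟨hv, fun x hx => (e1 _ (hu x hx)).2 ?_⟩
      rw [av_upd]
      exact h x hx

/-- Witness for the failure of the formula with code `c` at `v`, changed in the coordinate `i`. -/
def wf (κ T gK c i v : ZFSet.{u}) : ZFSet.{u} :=
  fapp gK (mu κ (fun j => ¬ upd v i (fapp gK j) ∈ fapp T c))

theorem wf_mem {T gK c i v : ZFSet.{u}} (h0 : ∅ ∈ K) (hg : IsZFunc κ gK) (hs : SurjOnto gK κ K) : wf κ T gK c i v ∈ K := by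
  unfold wf
  by_cases h : ∃ j ∈ κ, ¬ upd v i (fapp gK j) ∈ fapp T c
  · obtain ⟨j, hj, h⟩ := h
    exact hs.1 _ (mu_spec (KK.ord κ) hj h).1
  · rw [mu_none (KK.ord κ) fun j hj h' => h ⟨j, hj, h'⟩, hg.off (ZFSet.mem_irrefl _)]
    exact h0

theorem wf_spec {T gK c i v : ZFSet.{u}} (hs : SurjOnto gK κ K) {x : ZFSet.{u}} (hx : x ∈ K)
    (h : ¬ upd v i x ∈ fapp T c) : ¬ upd v i (wf κ T gK c i v) ∈ fapp T c := by
  obtain ⟨j, hj, rfl⟩ := hs.2 x hx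
  exact (mu_spec (Q := fun j => ¬ upd v i (fapp gK j) ∈ fapp T c) (KK.ord κ) hj h).2.1

end

instance Tm.wf {N κ T gK : ZFSet.{u}} [hN : PM N] [Fact (κ ∈ N)] [Fact (T ∈ N)] [Fact (gK ∈ N)] {s t r : (ℕ → ZFSet) → ZFSet} [hs : Tm N s] [ht : Tm N t]
    [hr : Tm N r] : Tm N (fun v => MPaper.wf κ T gK (s v) (t v) (r v)) := by
  have h1 : Tm N (fun v => t (fun n => v (n + 1))) := ht.rename Nat.succ
  have h2 : Tm N (fun v => s (fun n => v (n + 1))) := hs.rename Nat.succ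
  have h3 : Tm N (fun v => r (fun n => v (n + 1))) := hr.rename Nat.succ
  unfold MPaper.wf
  infer_instance

section
variable {κ : ZFSet.{u}} [hk : KK κ]

theorem pl_mem (c : ZFSet.{u}) : pl κ c ∈ κ := by
  by_cases h : ∃ a ∈ κ, ∃ b ∈ κ, pr κ a b = c
  · obtain ⟨a, ha, b, hb, rfl⟩ := h
    rw [pl_pr ha hb]; exact ha
  · have : ZFSet.sep (fun a => ∃ b, b ∈ κ ∧ pr κ a b = c) κ = (∅ : ZFSet) :=
      (ZFSet.eq_empty _).2 fun y hy => h ⟨y, (ZFSet.mem_sep.1 hy).1, (ZFSet.mem_sep.1 hy).2⟩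
    unfold pl
    rw [this, ZFSet.sUnion_empty]
    exact KK.nn 0

theorem pR_mem (c : ZFSet.{u}) : pR κ c ∈ κ := by
  by_cases h : ∃ a ∈ κ, ∃ b ∈ κ, pr κ a b = c
  · obtain ⟨a, ha, b, hb, rfl⟩ := h
    rw [pR_pr ha hb]; exact hb
  · have : ZFSet.sep (fun b => ∃ a, a ∈ κ ∧ pr κ a b = c) κ = (∅ : ZFSet) :=
      (ZFSet.eq_empty _).2 fun y hy => by
        obtain ⟨h1, a, ha, e⟩ := ZFSet.mem_sep.1 hy
        exact h ⟨a, ha, y, h1, e⟩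
    unfold pR
    rw [this, ZFSet.sUnion_empty]
    exact KK.nn 0
end

/-- The working context. -/
structure Cx (κ V N M U K gK A : ZFSet.{u}) : Prop where
  g : Good κ N M U
  sub : V ⊆ N
  hseq : OmegaSeqClosedPair V N
  sa : ∀ {P : ZFSet.{u} → ZFSet.{u} → Prop}, Dfn M (fun v => P (v 0) (v 1)) →
    Dfn V (fun v => P (v 0) (v 1)) → ZFSet.sep (fun i => ae κ U (fun ξ => P i ξ)) κ ∈ V
  KV : ∀ x ∈ K, x ∈ V
  κK : κ ⊆ K
  Ksub : ∀ y ∈ V, y ⊆ K → Small κ V y → y ∈ K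
  gf : IsZFunc κ gK
  gs : SurjOnto gK κ K
  Aκ : A ⊆ κ

/-- Two-sided membership facts used as instances. -/
class CI (κ V N M K gK A : ZFSet.{u}) : Prop where
  κN : κ ∈ N
  κV : κ ∈ V
  κM : κ ∈ M
  K_V : K ∈ V
  K_M : K ∈ M
  gV : gK ∈ V
  gM : gK ∈ M
  AV : A ∈ V
  AM : A ∈ M

section
variable {κ V N : ZFSet.{u}} [hk : KK κ] [hN : PM N] [hκN : Fact (κ ∈ N)]
  [hV : PM V] [hκV : Fact (κ ∈ V)]

theorem exists_cx {w A δ : ZFSet.{u}} (H : HV κ V N w) (hseq : OmegaSeqClosedPair V N)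
    (happ : ApproxProperty δ V.toSet N.toSet) (hδ : δ ∈ κ) (hA : A ∈ V) (hAκ : A ⊆ κ) :
    ∃ M U K gK, PM M ∧ PM K ∧ CI κ V N M K gK A ∧ Cx κ V N M U K gK A := by
  have hκ := KK.ord κ
  obtain ⟨gK, hgV, hgf, hgs⟩ := H.enumK
  haveI : Fact (gK ∈ N) := ⟨H.sub hgV⟩
  let R1 := ZFSet.sep (fun q => ∃ a, a ∈ κ ∧ ∃ b, b ∈ κ ∧ (q = ZFSet.pair a b ∧ fapp gK a ∈ fapp gK b)) (ZFSet.prod κ κ)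
  have hR1 : R1 ∈ N := Tm.mem_out (N := N) inferInstance
  have hR1s : R1 ⊆ ZFSet.prod κ κ := fun z hz => (ZFSet.mem_sep.1 hz).1
  have mR : ∀ a ∈ κ, ∀ b ∈ κ, (ZFSet.pair a b ∈ R1 ↔ fapp gK a ∈ fapp gK b) := by
    intro a ha b hb
    constructor
    · intro h
      obtain ⟨x', _, y', _, e, h⟩ := (ZFSet.mem_sep.1 h).2
      obtain ⟨rfl, rfl⟩ := ZFSet.pair_inj.1 e
      exact h
    · intro h
      exact ZFSet.mem_sep.2 ⟨ZFSet.pair_mem_prod.2 ⟨ha, hb⟩, a, ha, b, hb, rfl, h⟩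
  obtain ⟨M, U, hM, hκM, g, hAM, hRM, _⟩ := exists_good3 H.R (H.sub hA) hAκ hR1 hR1s hR1 hR1s
  have iwf : IWF M κ R1 := by
    intro X _ hXκ hne
    obtain ⟨x, hx⟩ : ∃ x, x ∈ X := by
      by_contra h0; exact hne ((ZFSet.eq_empty X).2 fun y hy => h0 ⟨y, hy⟩)
    have hI : img (fun i => fapp gK i) X ≠ ∅ := by
      intro h
      have : fapp gK x ∈ (∅ : ZFSet.{u}) := h ▸ mem_img.2 ⟨x, hx, rfl⟩
      exact ZFSet.notMem_empty _ this
    obtain ⟨y, hy, hm⟩ := ZFSet.regularity _ hI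
    obtain ⟨z, hz, rfl⟩ := mem_img.1 hy
    refine ⟨z, hz, fun t ht h => ?_⟩
    have h1 := (mR t (hXκ ht) z (hXκ hz)).1 h
    have : fapp gK t ∈ (img (fun i => fapp gK i) X) ∩ fapp gK z :=
      ZFSet.mem_inter.2 ⟨mem_img.2 ⟨t, ht, rfl⟩, h1⟩
    rw [hm] at this
    exact ZFSet.notMem_empty _ this
  obtain ⟨p, hp, hc⟩ := exists_collapse hκM.out hRM iwf
  have hc' : IsCollapse κ R1 gK := by
    refine ⟨hgf, fun x hx => ?_⟩
    ext z
    rw [mem_img]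
    constructor
    · intro hz
      obtain ⟨i, hi, rfl⟩ := hgs.2 z (KV_trans _ (hgs.1 x hx) hz)
      exact ⟨i, mem_prd.2 ⟨hi, (mR i hi x hx).2 hz⟩, rfl⟩
    · rintro ⟨i, hi, rfl⟩
      obtain ⟨h1, h2⟩ := mem_prd.1 hi
      exact (mR i h1 x hx).1 h2
  have hgM : gK ∈ M := hc'.unique hc ▸ hp
  haveI : Fact (gK ∈ M) := ⟨hgM⟩
  have eK : img (fun i => fapp gK i) κ = KV κ w := by
    ext z
    rw [mem_img]
    exact ⟨by rintro ⟨i, hi, rfl⟩; exact hgs.1 i hi, fun hz => hgs.2 z hz⟩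
  have hKM : KV κ w ∈ M := eK ▸ Tm.mem_out (N := M) inferInstance
  refine ⟨M, U, KV κ w, gK, hM, ⟨H.isTransModel⟩, ⟨hκN.out, hκV.out, hκM.out, KV_mem H.wV, hKM, hgV, hgM, hA, hAM⟩,
    ⟨g, H.sub, hseq, fun h1 h2 => g.sa H.sub happ hδ H.R h1 h2, fun x hx => H.w_sub hx, fun x hx => H.ordK hx,
      fun y h1 h2 h3 => (H.Ksub h1 h2 h3).1, hgf, hgs, hAκ⟩⟩

end

/-- pairs `(i,α)` with `α` in the `i`-th element of the stage (on a large set) -/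
def Bst (κ U a : ZFSet.{u}) : ZFSet.{u} :=
  ZFSet.sep (fun c => ae κ U (fun ξ => pR κ c ∈ fapp a (pr κ (pl κ c) ξ))) κ

/-- indices of the elements of the stage which represent members of the filter -/
def Sst (κ U a : ZFSet.{u}) : ZFSet.{u} :=
  ZFSet.sep (fun i => ae κ U (fun ξ => fapp a (pr κ i ξ) ⊆ ξ)) κ ∩
    ZFSet.sep (fun i => ae κ U (fun α => pr κ i α ∈ Bst κ U a)) κ

/-- code components -/
def a1 (κ γ : ZFSet.{u}) : ZFSet.{u} := pl κ (pR κ γ)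
def a2 (κ γ : ZFSet.{u}) : ZFSet.{u} := pl κ (pR κ (pR κ γ))
def a3 (κ γ : ZFSet.{u}) : ZFSet.{u} := pR κ (pR κ (pR κ γ))
/-- code constructor -/
def cd (κ : ZFSet.{u}) (t : ℕ) (a b c : ZFSet.{u}) : ZFSet.{u} := pr κ (nn t) (pr κ a (pr κ b c))

instance Tm.a1 {N κ : ZFSet.{u}} [PM N] [Fact (κ ∈ N)] {s : (ℕ → ZFSet) → ZFSet} [Tm N s] :
    Tm N (fun v => MPaper.a1 κ (s v)) := by unfold MPaper.a1; infer_instance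
instance Tm.a2 {N κ : ZFSet.{u}} [PM N] [Fact (κ ∈ N)] {s : (ℕ → ZFSet) → ZFSet} [Tm N s] :
    Tm N (fun v => MPaper.a2 κ (s v)) := by unfold MPaper.a2; infer_instance
instance Tm.a3 {N κ : ZFSet.{u}} [PM N] [Fact (κ ∈ N)] {s : (ℕ → ZFSet) → ZFSet} [Tm N s] :
    Tm N (fun v => MPaper.a3 κ (s v)) := by unfold MPaper.a3; infer_instance
instance TT_F {N κ K : ZFSet.{u}} [KK κ] [PM N] [Fact (κ ∈ N)] [h : Fact (K ∈ N)] : Fact (TT κ K ∈ N) :=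
  ⟨TT_mem h.out⟩

/-- the element with code `γ` of the next stage, at `ξ` -/
def ps (κ K gK A a S γ ξ : ZFSet.{u}) : ZFSet.{u} :=
  if pl κ γ = nn 1 then upd (fapp a (pr κ (a1 κ γ) ξ)) (a2 κ γ) (fapp a (pr κ (a3 κ γ) ξ))
  else if pl κ γ = nn 2 then wf κ (TT κ K) gK (a1 κ γ) (a2 κ γ) (fapp a (pr κ (a3 κ γ) ξ))
  else if pl κ γ = nn 3 then fapp (fapp a (pr κ (a1 κ γ) ξ)) (a2 κ γ)
  else if pl κ γ = nn 4 then a1 κ γ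
  else if pl κ γ = nn 5 then ξ
  else if pl κ γ = nn 6 then A ∩ ξ
  else if pl κ γ = nn 7 then img (fun b => fapp a (pr κ b ξ)) (S ∩ ξ)
  else fapp a (pr κ (a1 κ γ) ξ)

/-- the next stage -/
def Ps (κ K gK A a S : ZFSet.{u}) : ZFSet.{u} :=
  lam κ (fun q => ps κ K gK A a S (pl κ q) (pR κ q))

set_option synthInstance.maxHeartbeats 400000 in
set_option synthInstance.maxSize 100000 in
instance Tm.Ps {N κ K gK A : ZFSet.{u}} [KK κ] [PM N] [Fact (κ ∈ N)] [Fact (K ∈ N)] [Fact (gK ∈ N)]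
    [Fact (A ∈ N)] {s t : (ℕ → ZFSet) → ZFSet} [hs : Tm N s] [ht : Tm N t] :
    Tm N (fun v => MPaper.Ps κ K gK A (s v) (t v)) := by
  refine Tm.comp2 (F := fun a b => MPaper.Ps κ K gK A a b) ?_ hs ht
  unfold MPaper.Ps ps
  infer_instance

instance Tm.Sst {N κ U : ZFSet.{u}} [KK κ] [PM N] [Fact (κ ∈ N)] [Fact (U ∈ N)]
    {s : (ℕ → ZFSet) → ZFSet} [hs : Tm N s] :
    Tm N (fun v => MPaper.Sst κ U (s v)) := by
  refine Tm.comp1 (F := fun a => MPaper.Sst κ U a) ?_ hs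
  unfold MPaper.Sst Bst
  infer_instance

/-- the sequence of stages -/
def sq (κ U K gK A : ZFSet.{u}) : ZFSet.{u} :=
  recF ZFSet.omega (fun n g => if n = ∅ then ∅ else
    Ps κ K gK A (fapp g (⋃₀ n)) (Sst κ U (fapp g (⋃₀ n))))

/-- the stages -/
def bs (κ U K gK A : ZFSet.{u}) : ℕ → ZFSet.{u}
  | 0 => ∅
  | n + 1 => Ps κ K gK A (bs κ U K gK A n) (Sst κ U (bs κ U K gK A n))

theorem sUnion_nn (n : ℕ) : (⋃₀ (nn (n + 1)) : ZFSet.{u}) = nn n := by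
  ext z
  rw [ZFSet.mem_sUnion]
  constructor
  · rintro ⟨y, hy, hz⟩
    obtain ⟨m, hm, rfl⟩ := mem_nn.1 hy
    obtain ⟨k, hk, rfl⟩ := mem_nn.1 hz
    exact nn_mem_nn.2 (by omega)
  · intro h
    exact ⟨nn n, nn_mem_nn.2 (by omega), h⟩

theorem sq_nn (κ U K gK A : ZFSet.{u}) (n : ℕ) : fapp (sq κ U K gK A) (nn n) = bs κ U K gK A n := by
  induction n with
  | zero =>
    unfold sq
    rw [recF_fapp isOrd_omega.1 (nn_mem_omega 0)]
    exact if_pos rfl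
  | succ n ih =>
    have h : ¬ (nn (n + 1) : ZFSet.{u}) = ∅ := fun e => nn_ne (a := n + 1) (b := 0) (by omega) e
    have e : fapp (lam (nn (n + 1)) (fapp (sq κ U K gK A))) (nn n) = bs κ U K gK A n := by
      rw [fapp_lam (nn_mem_nn.2 (by omega)), ih]
    have := recF_fapp (Φ := (fun n g => if n = ∅ then ∅ else
      Ps κ K gK A (fapp g (⋃₀ n)) (Sst κ U (fapp g (⋃₀ n))))) isOrd_omega.1 (nn_mem_omega (n + 1))
    refine this.trans ?_
    rw [if_neg h, sUnion_nn]
    show Ps κ K gK A (fapp (lam (nn (n + 1)) (fapp (sq κ U K gK A))) (nn n)) _ = _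
    have e' : Sst κ U (fapp (lam (nn (n + 1)) (fapp (sq κ U K gK A))) (nn n)) = Sst κ U (bs κ U K gK A n) := by rw [e]
    rw [e]
    exact congrArg _ e'

section
variable {κ V N M U K gK A : ZFSet.{u}} [hk : KK κ] [hN : PM N] [hV : PM V] [hM : PM M] [hK : PM K]
  [hκN : Fact (κ ∈ N)] [hκV : Fact (κ ∈ V)] [hκM : Fact (κ ∈ M)] [hKV : Fact (K ∈ V)] [hKM : Fact (K ∈ M)]
  [hgV : Fact (gK ∈ V)] [hgM : Fact (gK ∈ M)] [hAV : Fact (A ∈ V)] [hAM : Fact (A ∈ M)]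

theorem Cx.B_V (X : Cx κ V N M U K gK A) {a : ZFSet.{u}} (h1 : a ∈ V) (h2 : a ∈ M) : Bst κ U a ∈ V := by
  haveI : Fact (a ∈ V) := ⟨h1⟩
  haveI : Fact (a ∈ M) := ⟨h2⟩
  exact X.sa (P := fun c ξ => pR κ c ∈ fapp a (pr κ (pl κ c) ξ)) inferInstance inferInstance

theorem Cx.B_M (X : Cx κ V N M U K gK A) {a : ZFSet.{u}} (h2 : a ∈ M) : Bst κ U a ∈ M := by
  haveI : Fact (a ∈ M) := ⟨h2⟩
  exact X.g.uq (P := fun c ξ => pR κ c ∈ fapp a (pr κ (pl κ c) ξ)) inferInstance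

theorem Cx.S_V (X : Cx κ V N M U K gK A) {a : ZFSet.{u}} (h1 : a ∈ V) (h2 : a ∈ M) : Sst κ U a ∈ V := by
  haveI : Fact (a ∈ V) := ⟨h1⟩
  haveI : Fact (a ∈ M) := ⟨h2⟩
  haveI : Fact (Bst κ U a ∈ V) := ⟨X.B_V h1 h2⟩
  haveI : Fact (Bst κ U a ∈ M) := ⟨X.B_M h2⟩
  haveI : Fact (ZFSet.sep (fun i => ae κ U (fun ξ => fapp a (pr κ i ξ) ⊆ ξ)) κ ∈ V) :=
    ⟨X.sa (P := fun i ξ => fapp a (pr κ i ξ) ⊆ ξ) inferInstance inferInstance⟩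
  haveI : Fact (ZFSet.sep (fun i => ae κ U (fun α => pr κ i α ∈ Bst κ U a)) κ ∈ V) :=
    ⟨X.sa (P := fun i α => pr κ i α ∈ Bst κ U a) inferInstance inferInstance⟩
  exact Tm.mem_out (N := V) (Tm.inter (hs := Tm.const) (ht := Tm.const))

theorem Cx.S_M (X : Cx κ V N M U K gK A) {a : ZFSet.{u}} (h2 : a ∈ M) : Sst κ U a ∈ M := by
  haveI : Fact (a ∈ M) := ⟨h2⟩
  haveI : Fact (Bst κ U a ∈ M) := ⟨X.B_M h2⟩
  haveI : Fact (ZFSet.sep (fun i => ae κ U (fun ξ => fapp a (pr κ i ξ) ⊆ ξ)) κ ∈ M) :=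
    ⟨X.g.uq (P := fun i ξ => fapp a (pr κ i ξ) ⊆ ξ) inferInstance⟩
  haveI : Fact (ZFSet.sep (fun i => ae κ U (fun α => pr κ i α ∈ Bst κ U a)) κ ∈ M) :=
    ⟨X.g.uq (P := fun i α => pr κ i α ∈ Bst κ U a) inferInstance⟩
  exact Tm.mem_out (N := M) (Tm.inter (hs := Tm.const) (ht := Tm.const))

theorem Cx.ps_K (X : Cx κ V N M U K gK A) {a S γ ξ : ZFSet.{u}} (h1 : a ∈ V) (hS : S ∈ V)
    (hv : ∀ q, fapp a q ∈ K) (hξ : ξ ∈ κ) : ps κ K gK A a S γ ξ ∈ K := by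
  have f2 : Fact (a2 κ γ ∈ K) := ⟨X.κK (pl_mem _)⟩
  have ff : ∀ q, Fact (fapp a q ∈ K) := fun q => ⟨hv q⟩
  haveI : Fact (a ∈ V) := ⟨h1⟩
  haveI : Fact (S ∈ V) := ⟨hS⟩
  haveI : Fact (ξ ∈ V) := ⟨PM.mem hκV.out hξ⟩
  unfold ps
  split_ifs
  · haveI := ff (pr κ (a1 κ γ) ξ)
    haveI := ff (pr κ (a3 κ γ) ξ)
    exact Tm.mem_out (N := K) (Tm.upd (hs := Tm.const) (ht := Tm.const) (hr := Tm.const))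
  · exact wf_mem (PM.empty K) X.gf X.gs
  · haveI := ff (pr κ (a1 κ γ) ξ)
    exact Tm.mem_out (N := K) (Tm.fapp (hs := Tm.const) (ht := Tm.const))
  · exact X.κK (pl_mem _)
  · exact X.κK hξ
  · refine X.Ksub _ (Tm.mem_out (N := V) inferInstance) (fun z hz => X.κK (X.Aκ (ZFSet.mem_inter.1 hz).1))
      ⟨ξ, hξ, lam ξ (fun i => i), Tm.mem_out (N := V) inferInstance, fun y hy => ⟨y, (ZFSet.mem_inter.1 hy).2, ?_⟩⟩
    rw [fapp_lam (ZFSet.mem_inter.1 hy).2]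
  · refine X.Ksub _ (Tm.mem_out (N := V) inferInstance) (fun z hz => ?_)
      ⟨ξ, hξ, lam ξ (fun i => fapp a (pr κ i ξ)), Tm.mem_out (N := V) inferInstance, fun y hy => ?_⟩
    · obtain ⟨b, _, rfl⟩ := mem_img.1 hz
      exact hv _
    · obtain ⟨b, hb, rfl⟩ := mem_img.1 hy
      refine ⟨b, (ZFSet.mem_inter.1 hb).2, ?_⟩
      rw [fapp_lam (ZFSet.mem_inter.1 hb).2]
  · exact hv _

theorem Cx.bs (X : Cx κ V N M U K gK A) (n : ℕ) : bs κ U K gK A n ∈ V ∧ bs κ U K gK A n ∈ M ∧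
    ∀ q, fapp (bs κ U K gK A n) q ∈ K := by
  induction n with
  | zero =>
    refine ⟨PM.empty V, PM.empty M, fun q => ?_⟩
    show fapp ∅ q ∈ K
    rw [fapp_none fun c => ZFSet.notMem_empty _]
    exact PM.empty K
  | succ n ih =>
    obtain ⟨h1, h2, h3⟩ := ih
    have hS1 := X.S_V h1 h2
    have hS2 := X.S_M h2
    haveI : Fact (MPaper.bs κ U K gK A n ∈ V) := ⟨h1⟩
    haveI : Fact (MPaper.bs κ U K gK A n ∈ M) := ⟨h2⟩
    haveI : Fact (Sst κ U (MPaper.bs κ U K gK A n) ∈ V) := ⟨hS1⟩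
    haveI : Fact (Sst κ U (MPaper.bs κ U K gK A n) ∈ M) := ⟨hS2⟩
    refine ⟨Tm.mem_out (N := V) (Tm.Ps (hs := Tm.const) (ht := Tm.const)),
      Tm.mem_out (N := M) (Tm.Ps (hs := Tm.const) (ht := Tm.const)), fun q => ?_⟩
    show fapp (Ps _ _ _ _ _ _) q ∈ K
    unfold Ps
    by_cases hq : q ∈ κ
    · rw [fapp_lam hq]
      exact X.ps_K h1 hS1 h3 (pR_mem _)
    · rw [(isZFunc_lam _ _).off hq]
      exact PM.empty K

theorem Cx.sq_N (X : Cx κ V N M U K gK A) : sq κ U K gK A ∈ N := by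
  haveI : Fact (K ∈ N) := ⟨X.sub hKV.out⟩
  haveI : Fact (gK ∈ N) := ⟨X.sub hgV.out⟩
  haveI : Fact (A ∈ N) := ⟨X.sub hAV.out⟩
  haveI : Fact (U ∈ N) := ⟨X.g.UN⟩
  unfold sq
  exact Tm.mem_out (N := N) inferInstance

theorem Cx.sq_V (X : Cx κ V N M U K gK A) : sq κ U K gK A ∈ V := by
  refine X.hseq _ X.sq_N (recF_isZFunc _ _) fun n hn => ?_
  obtain ⟨m, rfl⟩ := mem_omega.1 hn
  rw [sq_nn]
  exact (X.bs m).1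

/-- evaluation of the element with index `d` -/
def ev (κ s d ξ : ZFSet.{u}) : ZFSet.{u} := fapp (fapp s (pl κ d)) (pr κ (pR κ d) ξ)

theorem ev_junk {d : ZFSet.{u}} (h : pl κ d ∉ ZFSet.omega) (ξ : ZFSet.{u}) :
    ev κ (sq κ U K gK A) d ξ = ∅ := by
  unfold ev sq
  rw [(recF_isZFunc _ _).off h, fapp_none fun c => ZFSet.notMem_empty _]

theorem ev_pr (n : ℕ) {β : ZFSet.{u}} (hβ : β ∈ κ) (ξ : ZFSet.{u}) :
    ev κ (sq κ U K gK A) (pr κ (nn n) β) ξ = fapp (bs κ U K gK A n) (pr κ β ξ) := by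
  unfold ev
  rw [pl_pr (KK.nn n) hβ, pR_pr (KK.nn n) hβ, sq_nn]

theorem Cx.ev_K (X : Cx κ V N M U K gK A) (d ξ : ZFSet.{u}) : ev κ (sq κ U K gK A) d ξ ∈ K := by
  by_cases h : pl κ d ∈ ZFSet.omega
  · obtain ⟨n, hn⟩ := mem_omega.1 h
    unfold ev
    rw [hn, sq_nn]
    exact (X.bs n).2.2 _
  · rw [ev_junk h]; exact PM.empty K

theorem Cx.ev_Tm (X : Cx κ V N M U K gK A) (d : ZFSet.{u}) (i : ℕ) :
    Tm M (fun v => ev κ (sq κ U K gK A) d (v i)) := by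
  haveI : Fact (pR κ d ∈ M) := ⟨PM.mem hκM.out (pR_mem _)⟩
  by_cases h : pl κ d ∈ ZFSet.omega
  · obtain ⟨n, hn⟩ := mem_omega.1 h
    unfold ev
    rw [hn, sq_nn]
    haveI : Fact (MPaper.bs κ U K gK A n ∈ M) := ⟨(X.bs n).2.1⟩
    infer_instance
  · simp only [ev_junk h]; infer_instance

theorem cd_aux (t : ℕ) {a b c : ZFSet.{u}} (ha : a ∈ κ) (hb : b ∈ κ) (hc : c ∈ κ) :
    cd κ t a b c ∈ κ ∧ pl κ (cd κ t a b c) = nn t ∧ a1 κ (cd κ t a b c) = a ∧ a2 κ (cd κ t a b c) = b ∧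
      a3 κ (cd κ t a b c) = c := by
  have h1 := pr_mem (κ := κ) hb hc
  have h2 := pr_mem (κ := κ) ha h1
  unfold cd a1 a2 a3
  rw [pR_pr (KK.nn t) h2, pl_pr (KK.nn t) h2, pR_pr ha h1, pl_pr ha h1, pl_pr hb hc, pR_pr hb hc]
  exact ⟨pr_mem (KK.nn t) h2, rfl, rfl, rfl, rfl⟩

/-- evaluation in a successor stage -/
theorem ev_cd (n t : ℕ) {a b c ξ : ZFSet.{u}} (ha : a ∈ κ) (hb : b ∈ κ) (hc : c ∈ κ) (hξ : ξ ∈ κ) :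
    ev κ (sq κ U K gK A) (pr κ (nn (n + 1)) (cd κ t a b c)) ξ =
      ps κ K gK A (bs κ U K gK A n) (Sst κ U (bs κ U K gK A n)) (cd κ t a b c) ξ := by
  have h := cd_aux (κ := κ) t ha hb hc
  rw [ev_pr _ h.1]
  show fapp (Ps _ _ _ _ _ _) _ = _
  unfold Ps
  rw [fapp_lam (pr_mem h.1 hξ), pl_pr h.1 hξ, pR_pr h.1 hξ]

end

section
variable {κ V N M U K gK A : ZFSet.{u}} [hk : KK κ] [hN : PM N] [hV : PM V] [hM : PM M] [hK : PM K]
  [hκN : Fact (κ ∈ N)] [hκV : Fact (κ ∈ V)] [hκM : Fact (κ ∈ M)] [hKV : Fact (K ∈ V)] [hKM : Fact (K ∈ M)]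
  [hgV : Fact (gK ∈ V)] [hgM : Fact (gK ∈ M)] [hAV : Fact (A ∈ V)] [hAM : Fact (A ∈ M)]

/-- evaluation -/
def Cx.e (X : Cx κ V N M U K gK A) (d ξ : ZFSet.{u}) : ZFSet.{u} := ev κ (sq κ U K gK A) d ξ

theorem Cx.e_K (X : Cx κ V N M U K gK A) (d ξ : ZFSet.{u}) : X.e d ξ ∈ K := X.ev_K d ξ

instance Cx.e_Tm (X : Cx κ V N M U K gK A) (d : ZFSet.{u}) {t : (ℕ → ZFSet) → ZFSet} [ht : Tm M t] :
    Tm M (fun v => X.e d (t v)) := Tm.comp1 (F := fun x => X.e d x) (X.ev_Tm d 0) ht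

theorem Cx.norm (X : Cx κ V N M U K gK A) (d : ZFSet.{u}) :
    ∃ n : ℕ, ∃ β ∈ κ, ∀ ξ ∈ κ, X.e d ξ = X.e (pr κ (nn n) β) ξ := by
  by_cases h : pl κ d ∈ ZFSet.omega
  · obtain ⟨n, hn⟩ := mem_omega.1 h
    refine ⟨n, pR κ d, pR_mem _, fun ξ hξ => ?_⟩
    unfold Cx.e ev
    rw [pl_pr (KK.nn n) (pR_mem _), pR_pr (KK.nn n) (pR_mem _), hn]
  · refine ⟨0, nn 0, KK.nn 0, fun ξ hξ => ?_⟩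
    unfold Cx.e
    rw [ev_junk h, ev_pr 0 (KK.nn 0)]
    exact (fapp_none fun c => ZFSet.notMem_empty _).symm

theorem Cx.lift1 (X : Cx κ V N M U K gK A) (n : ℕ) {β : ZFSet.{u}} (hβ : β ∈ κ) :
    cd κ 0 β (nn 0) (nn 0) ∈ κ ∧ ∀ ξ ∈ κ, X.e (pr κ (nn n) β) ξ = X.e (pr κ (nn (n + 1)) (cd κ 0 β (nn 0) (nn 0))) ξ := by
  have h := cd_aux (κ := κ) 0 hβ (KK.nn 0) (KK.nn 0)
  refine ⟨h.1, fun ξ hξ => ?_⟩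
  unfold Cx.e
  rw [ev_cd n 0 hβ (KK.nn 0) (KK.nn 0) hξ, ev_pr n hβ]
  unfold ps
  have e1 : pl κ (cd κ 0 β (nn 0) (nn 0)) = nn 0 := h.2.1
  have e2 : a1 κ (cd κ 0 β (nn 0) (nn 0)) = β := h.2.2.1
  rw [e1, if_neg (nn_ne (by decide)), if_neg (nn_ne (by decide)), if_neg (nn_ne (by decide)),
    if_neg (nn_ne (by decide)), if_neg (nn_ne (by decide)), if_neg (nn_ne (by decide)),
    if_neg (nn_ne (by decide)), e2]

theorem Cx.lift (X : Cx κ V N M U K gK A) (n k : ℕ) {β : ZFSet.{u}} (hβ : β ∈ κ) :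
    ∃ γ ∈ κ, ∀ ξ ∈ κ, X.e (pr κ (nn n) β) ξ = X.e (pr κ (nn (n + k)) γ) ξ := by
  induction k with
  | zero => exact ⟨β, hβ, fun _ _ => rfl⟩
  | succ k ih =>
    obtain ⟨γ, hγ, h⟩ := ih
    obtain ⟨h1, h2⟩ := X.lift1 (n + k) hγ
    exact ⟨_, h1, fun ξ hξ => (h ξ hξ).trans (h2 ξ hξ)⟩

theorem Cx.lift2 (X : Cx κ V N M U K gK A) (n : ℕ) (d : ZFSet.{u}) :
    ∃ m : ℕ, n ≤ m ∧ ∀ m', m ≤ m' → ∃ γ ∈ κ, ∀ ξ ∈ κ, X.e d ξ = X.e (pr κ (nn m') γ) ξ := by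
  obtain ⟨m, β, hβ, h⟩ := X.norm d
  refine ⟨max n m, le_max_left _ _, fun m' hm' => ?_⟩
  obtain ⟨γ, hγ, h'⟩ := X.lift m (m' - m) hβ
  have : m + (m' - m) = m' := by have := le_max_right n m; omega
  rw [this] at h'
  exact ⟨γ, hγ, fun ξ hξ => (h ξ hξ).trans (h' ξ hξ)⟩

theorem Cx.c_upd (X : Cx κ V N M U K gK A) (d h : ZFSet.{u}) {b : ZFSet.{u}} (hb : b ∈ κ) :
    ∃ k ∈ κ, ∀ ξ ∈ κ, X.e k ξ = upd (X.e d ξ) b (X.e h ξ) := by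
  obtain ⟨m, _, h1⟩ := X.lift2 0 d
  obtain ⟨m', hm', h2⟩ := X.lift2 m h
  obtain ⟨β, hβ, e1⟩ := h1 m' hm'
  obtain ⟨γ, hγ, e2⟩ := h2 m' le_rfl
  have c := cd_aux (κ := κ) 1 hβ hb hγ
  refine ⟨pr κ (nn (m' + 1)) (cd κ 1 β b γ), pr_mem (KK.nn _) c.1, fun ξ hξ => ?_⟩
  rw [e1 ξ hξ, e2 ξ hξ]
  unfold Cx.e
  rw [ev_cd m' 1 hβ hb hγ hξ, ev_pr m' hβ, ev_pr m' hγ]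
  unfold ps
  rw [if_pos c.2.1, c.2.2.1, c.2.2.2.1, c.2.2.2.2]

theorem Cx.c_wf (X : Cx κ V N M U K gK A) (d : ZFSet.{u}) {c b : ZFSet.{u}} (hc : c ∈ κ) (hb : b ∈ κ) :
    ∃ k ∈ κ, ∀ ξ ∈ κ, X.e k ξ = wf κ (TT κ K) gK c b (X.e d ξ) := by
  obtain ⟨m, _, h1⟩ := X.lift2 0 d
  obtain ⟨β, hβ, e1⟩ := h1 m le_rfl
  have c := cd_aux (κ := κ) 2 hc hb hβ
  refine ⟨pr κ (nn (m + 1)) (cd κ 2 _ b β), pr_mem (KK.nn _) c.1, fun ξ hξ => ?_⟩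
  rw [e1 ξ hξ]
  unfold Cx.e
  rw [ev_cd m 2 hc hb hβ hξ, ev_pr m hβ]
  unfold ps
  rw [c.2.1, if_neg (nn_ne (by decide)), if_pos rfl, c.2.2.1, c.2.2.2.1, c.2.2.2.2]

theorem Cx.fapp_stage (X : Cx κ V N M U K gK A) (m : ℕ) {β b : ZFSet.{u}} (hβ : β ∈ κ) (hb : b ∈ κ) :
    cd κ 3 β b (nn 0) ∈ κ ∧ ∀ ξ ∈ κ, X.e (pr κ (nn (m + 1)) (cd κ 3 β b (nn 0))) ξ = fapp (X.e (pr κ (nn m) β) ξ) b := by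
  have c := cd_aux (κ := κ) 3 hβ hb (KK.nn 0)
  refine ⟨c.1, fun ξ hξ => ?_⟩
  unfold Cx.e
  rw [ev_cd m 3 hβ hb (KK.nn 0) hξ, ev_pr m hβ]
  unfold ps
  have e1 : pl κ (cd κ 3 β b (nn 0)) = nn 3 := c.2.1
  have e2 : a1 κ (cd κ 3 β b (nn 0)) = β := c.2.2.1
  have e3 : a2 κ (cd κ 3 β b (nn 0)) = b := c.2.2.2.1
  rw [e1, if_neg (nn_ne (by decide)), if_neg (nn_ne (by decide)), if_pos rfl, e2, e3]

theorem Cx.c_fapp (X : Cx κ V N M U K gK A) (d : ZFSet.{u}) {b : ZFSet.{u}} (hb : b ∈ κ) :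
    ∃ k ∈ κ, ∀ ξ ∈ κ, X.e k ξ = fapp (X.e d ξ) b := by
  obtain ⟨m, _, h1⟩ := X.lift2 0 d
  obtain ⟨β, hβ, e1⟩ := h1 m le_rfl
  obtain ⟨h, h'⟩ := X.fapp_stage m hβ hb
  refine ⟨pr κ (nn (m + 1)) _, pr_mem (KK.nn _) h, fun ξ hξ => ?_⟩
  rw [e1 ξ hξ, h' ξ hξ]

theorem Cx.c_const (X : Cx κ V N M U K gK A) {a : ZFSet.{u}} (ha : a ∈ κ) :
    ∃ k ∈ κ, ∀ ξ ∈ κ, X.e k ξ = a := by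
  have c := cd_aux (κ := κ) 4 ha ha ha
  refine ⟨pr κ (nn (0 + 1)) (cd κ 4 a a a), pr_mem (KK.nn _) c.1, fun ξ hξ => ?_⟩
  unfold Cx.e
  rw [ev_cd 0 4 ha ha ha hξ]
  unfold ps
  rw [c.2.1, if_neg (nn_ne (by decide)), if_neg (nn_ne (by decide)), if_neg (nn_ne (by decide)), if_pos rfl, c.2.2.1]

theorem Cx.c_id (X : Cx κ V N M U K gK A) : ∃ k ∈ κ, ∀ ξ ∈ κ, X.e k ξ = ξ := by
  have ha := KK.nn (κ := κ) 0
  have c := cd_aux (κ := κ) 5 ha ha ha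
  refine ⟨pr κ (nn (0 + 1)) (cd κ 5 _ _ _), pr_mem (KK.nn _) c.1, fun ξ hξ => ?_⟩
  unfold Cx.e
  rw [ev_cd 0 5 ha ha ha hξ]
  unfold ps
  rw [c.2.1, if_neg (nn_ne (by decide)), if_neg (nn_ne (by decide)), if_neg (nn_ne (by decide)),
    if_neg (nn_ne (by decide)), if_pos rfl]

theorem Cx.c_A (X : Cx κ V N M U K gK A) : ∃ k ∈ κ, ∀ ξ ∈ κ, X.e k ξ = A ∩ ξ := by
  have ha := KK.nn (κ := κ) 0
  have c := cd_aux (κ := κ) 6 ha ha ha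
  refine ⟨pr κ (nn (0 + 1)) (cd κ 6 _ _ _), pr_mem (KK.nn _) c.1, fun ξ hξ => ?_⟩
  unfold Cx.e
  rw [ev_cd 0 6 ha ha ha hξ]
  unfold ps
  rw [c.2.1, if_neg (nn_ne (by decide)), if_neg (nn_ne (by decide)), if_neg (nn_ne (by decide)),
    if_neg (nn_ne (by decide)), if_neg (nn_ne (by decide)), if_pos rfl]

theorem Cx.c_S (X : Cx κ V N M U K gK A) (m : ℕ) : ∃ k ∈ κ, ∀ ξ ∈ κ, X.e k ξ =
    img (fun b => X.e (pr κ (nn m) b) ξ) (Sst κ U (MPaper.bs κ U K gK A m) ∩ ξ) := by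
  have ha := KK.nn (κ := κ) 0
  have c := cd_aux (κ := κ) 7 ha ha ha
  refine ⟨pr κ (nn (m + 1)) (cd κ 7 _ _ _), pr_mem (KK.nn _) c.1, fun ξ hξ => ?_⟩
  unfold Cx.e
  rw [ev_cd m 7 ha ha ha hξ]
  unfold ps
  rw [c.2.1, if_neg (nn_ne (by decide)), if_neg (nn_ne (by decide)), if_neg (nn_ne (by decide)),
    if_neg (nn_ne (by decide)), if_neg (nn_ne (by decide)), if_neg (nn_ne (by decide)), if_pos rfl]
  refine img_congr fun b hb => ?_
  rw [ev_pr m ((KK.ord κ).trans hξ (ZFSet.mem_inter.1 hb).2)]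

end

section
variable {κ V N M U K gK A : ZFSet.{u}} [hk : KK κ] [hN : PM N] [hV : PM V] [hM : PM M] [hK : PM K]
  [hκN : Fact (κ ∈ N)] [hκV : Fact (κ ∈ V)] [hκM : Fact (κ ∈ M)] [hKV : Fact (K ∈ V)] [hKM : Fact (K ∈ M)]
  [hgV : Fact (gK ∈ V)] [hgM : Fact (gK ∈ M)] [hAV : Fact (A ∈ V)] [hAM : Fact (A ∈ M)]

instance Tm.ev {N κ : ZFSet.{u}} [PM N] [Fact (κ ∈ N)] {r s t : (ℕ → ZFSet) → ZFSet}
    [hr : Tm N r] [hs : Tm N s] [ht : Tm N t] :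
    Tm N (fun v => MPaper.ev κ (r v) (s v) (t v)) := by
  unfold MPaper.ev; infer_instance

theorem Cx.trunc_M (X : Cx κ V N M U K gK A) (n : ℕ) :
    lam (nn n) (fun i => fapp (sq κ U K gK A) i) ∈ M := by
  induction n with
  | zero =>
    have : lam (nn 0) (fun i => fapp (sq κ U K gK A) i) = ∅ := by
      refine (ZFSet.eq_empty _).2 fun y hy => ?_
      obtain ⟨x, hx, _⟩ := mem_lam.1 hy
      exact ZFSet.notMem_empty _ hx
    rw [this]; exact PM.empty M
  | succ n ih =>
    have : lam (nn (n + 1)) (fun i => fapp (sq κ U K gK A) i) =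
        insert (ZFSet.pair (nn n) (MPaper.bs κ U K gK A n)) (lam (nn n) (fun i => fapp (sq κ U K gK A) i)) := by
      ext z
      rw [ZFSet.mem_insert_iff, mem_lam, mem_lam, nn, ← sq_nn]
      simp only [ZFSet.mem_insert_iff, or_and_right, exists_or, exists_eq_left]
    rw [this]
    haveI : Fact (lam (nn n) (fun i => fapp (sq κ U K gK A) i) ∈ M) := ⟨ih⟩
    haveI : Fact (MPaper.bs κ U K gK A n ∈ M) := ⟨(X.bs n).2.1⟩
    exact Tm.mem_out (N := M) (Tm.insert (hs := Tm.pair (hs := Tm.const) (ht := Tm.const)) (ht := Tm.const))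

theorem ev_trunc (d : ZFSet.{u}) : ∃ n : ℕ, ∀ m, n ≤ m → ∀ ξ,
    ev κ (lam (nn m) (fun i => fapp (sq κ U K gK A) i)) d ξ = ev κ (sq κ U K gK A) d ξ := by
  by_cases h : pl κ d ∈ ZFSet.omega
  · obtain ⟨n, hn⟩ := mem_omega.1 h
    refine ⟨n + 1, fun m hm ξ => ?_⟩
    unfold ev
    rw [hn, fapp_lam (nn_mem_nn.2 (by omega))]
  · refine ⟨0, fun m _ ξ => ?_⟩
    rw [ev_junk h]
    unfold ev
    rw [(isZFunc_lam _ _).off, fapp_none fun c => ZFSet.notMem_empty _]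
    intro h'
    obtain ⟨k, _, e⟩ := mem_nn.1 h'
    exact h (e ▸ nn_mem_omega k)

set_option synthInstance.maxHeartbeats 400000 in
theorem Cx.Ehat (X : Cx κ V N M U K gK A) :
    ZFSet.sep (fun c => ae κ U (fun ξ => X.e (pl κ c) ξ ∈ X.e (pR κ c) ξ)) κ ∈ V := by
  set s := sq κ U K gK A with hs
  haveI : Fact (s ∈ V) := ⟨X.sq_V⟩
  haveI : Fact (s ∈ N) := ⟨X.sq_N⟩
  haveI : Fact (U ∈ N) := ⟨X.g.UN⟩
  let L := lam ZFSet.omega (fun n => ZFSet.sep (fun c => ae κ U (fun ξ =>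
    ev κ (lam n (fun i => fapp s i)) (pl κ c) ξ ∈ ev κ (lam n (fun i => fapp s i)) (pR κ c) ξ)) κ)
  have hLN : L ∈ N := Tm.mem_out (N := N) inferInstance
  have hLV : L ∈ V := by
    refine X.hseq _ hLN (isZFunc_lam _ _) fun n hn => ?_
    show fapp (lam _ _) _ ∈ V
    rw [fapp_lam hn]
    obtain ⟨m, rfl⟩ := mem_omega.1 hn
    haveI : Fact (lam (nn m) (fun i => fapp s i) ∈ M) := ⟨X.trunc_M m⟩
    haveI : Fact (lam (nn m) (fun i => fapp s i) ∈ V) := ⟨Tm.mem_out (N := V) inferInstance⟩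
    generalize lam (nn m) (fun i => fapp s i) = t at *
    exact X.sa (P := fun c ξ => ev κ t (pl κ c) ξ ∈ ev κ t (pR κ c) ξ) inferInstance inferInstance
  haveI : Fact (L ∈ V) := ⟨hLV⟩
  have e : ZFSet.sep (fun c => ae κ U (fun ξ => X.e (pl κ c) ξ ∈ X.e (pR κ c) ξ)) κ =
      ZFSet.sep (fun c => ∃ n, n ∈ ZFSet.omega ∧ ∀ m, m ∈ ZFSet.omega → (n ⊆ m → c ∈ fapp L m)) κ := by
    ext c
    rw [ZFSet.mem_sep, ZFSet.mem_sep]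
    refine and_congr_right fun hc => ?_
    obtain ⟨n1, h1⟩ := ev_trunc (κ := κ) (U := U) (K := K) (gK := gK) (A := A) (pl κ c)
    obtain ⟨n2, h2⟩ := ev_trunc (κ := κ) (U := U) (K := K) (gK := gK) (A := A) (pR κ c)
    have key : ∀ m, n1 ≤ m → n2 ≤ m → (c ∈ fapp L (nn m) ↔ ae κ U (fun ξ => X.e (pl κ c) ξ ∈ X.e (pR κ c) ξ)) := by
      intro m hm1 hm2
      show c ∈ fapp (lam _ _) _ ↔ _
      rw [fapp_lam (nn_mem_omega m), ZFSet.mem_sep, and_iff_right hc]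
      simp only [h1 m hm1, h2 m hm2, hs]
      rfl
    constructor
    · intro h
      refine ⟨nn (max n1 n2), nn_mem_omega _, fun m hm hsub => ?_⟩
      obtain ⟨k, rfl⟩ := mem_omega.1 hm
      have hle : max n1 n2 ≤ k := by
        by_contra hlt
        have := hsub (nn_mem_nn.2 (not_le.1 hlt))
        exact ZFSet.mem_irrefl _ this
      exact (key k (le_trans (le_max_left _ _) hle) (le_trans (le_max_right _ _) hle)).2 h
    · rintro ⟨n, hn, h⟩
      obtain ⟨k, rfl⟩ := mem_omega.1 hn
      refine (key (max k (max n1 n2)) (by omega) (by omega)).1 (h _ (nn_mem_omega _) fun z hz => ?_)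
      obtain ⟨j, hj, rfl⟩ := mem_nn.1 hz
      exact nn_mem_nn.2 (by omega)
  rw [e]
  exact Tm.mem_out (N := V) inferInstance

theorem Cx.exists_E (X : Cx κ V N M U K gK A) : ∃ E ∈ V, ∀ k ∈ κ, ∀ l ∈ κ,
    (ZFSet.pair k l ∈ E ↔ ae κ U (fun ξ => X.e k ξ ∈ X.e l ξ)) := by
  have h0 := X.Ehat
  set H := ZFSet.sep (fun c => ae κ U (fun ξ => X.e (pl κ c) ξ ∈ X.e (pR κ c) ξ)) κ with hH
  haveI : Fact (H ∈ V) := ⟨h0⟩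
  refine ⟨ZFSet.sep (fun q => ∃ a, a ∈ κ ∧ ∃ b, b ∈ κ ∧ (q = ZFSet.pair a b ∧ pr κ a b ∈ H)) (ZFSet.prod κ κ),
    Tm.mem_out (N := V) inferInstance, fun k hk l hl => ?_⟩
  rw [ZFSet.mem_sep, ZFSet.pair_mem_prod, and_iff_right ⟨hk, hl⟩]
  have e : pr κ k l ∈ H ↔ ae κ U (fun ξ => X.e k ξ ∈ X.e l ξ) := by
    rw [hH, ZFSet.mem_sep, and_iff_right (pr_mem hk hl), pl_pr hk hl, pR_pr hk hl]
  rw [← e]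
  constructor
  · rintro ⟨a, _, b, _, e, h⟩
    obtain ⟨rfl, rfl⟩ := ZFSet.pair_inj.1 e
    exact h
  · intro h
    exact ⟨k, hk, l, hl, rfl, h⟩

set_option synthInstance.maxHeartbeats 400000 in
theorem Cx.E_iwf (X : Cx κ V N M U K gK A) {E : ZFSet.{u}} (hE : E ∈ V) (hE' : ∀ k ∈ κ, ∀ l ∈ κ,
    (ZFSet.pair k l ∈ E ↔ ae κ U (fun ξ => X.e k ξ ∈ X.e l ξ))) : IWF V κ E := by
  intro Y hY hYκ hne
  by_contra hno
  push Not at hno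
  obtain ⟨y0, hy0⟩ : ∃ x, x ∈ Y := by
    by_contra h0; exact hne ((ZFSet.eq_empty Y).2 fun y hy => h0 ⟨y, hy⟩)
  set s := sq κ U K gK A with hs
  haveI : Fact (s ∈ N) := ⟨X.sq_N⟩
  haveI : Fact (E ∈ N) := ⟨X.sub hE⟩
  haveI : Fact (Y ∈ N) := ⟨X.sub hY⟩
  haveI : Fact (y0 ∈ N) := ⟨PM.mem (X.sub hY) hy0⟩
  haveI : Fact (IsOrd κ) := ⟨KK.ord κ⟩
  let Φ : ZFSet.{u} → ZFSet.{u} → ZFSet.{u} := fun n g => if n = ∅ then y0 else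
    mu κ (fun y => y ∈ Y ∧ ZFSet.pair y (fapp g (⋃₀ n)) ∈ E)
  let d := recF ZFSet.omega (fun n g => if n = ∅ then y0 else
    mu κ (fun y => y ∈ Y ∧ ZFSet.pair y (fapp g (⋃₀ n)) ∈ E))
  have hd : d ∈ N := Tm.mem_out (N := N) inferInstance
  haveI : Fact (d ∈ N) := ⟨hd⟩
  have d0 : fapp d (nn 0) = y0 := by
    refine (recF_fapp (Φ := Φ) isOrd_omega.1 (nn_mem_omega 0)).trans ?_
    exact if_pos rfl
  have dS : ∀ n, fapp d (nn (n + 1)) = mu κ (fun y => y ∈ Y ∧ ZFSet.pair y (fapp d (nn n)) ∈ E) := by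
    intro n
    refine (recF_fapp (Φ := Φ) isOrd_omega.1 (nn_mem_omega (n + 1))).trans ?_
    refine (if_neg (fun e => nn_ne (a := n + 1) (b := 0) (by omega) e)).trans ?_
    rw [sUnion_nn, fapp_lam (nn_mem_nn.2 (by omega))]
  have hdY : ∀ n, fapp d (nn n) ∈ Y := by
    intro n
    induction n with
    | zero => rw [d0]; exact hy0
    | succ n ih =>
      rw [dS]
      obtain ⟨z, hz, hz'⟩ := hno _ ih
      exact (mu_spec (Q := fun y => y ∈ Y ∧ ZFSet.pair y (fapp d (nn n)) ∈ E) (KK.ord κ) (hYκ hz) ⟨hz, hz'⟩).2.1.1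
  have hdE : ∀ n, ZFSet.pair (fapp d (nn (n + 1))) (fapp d (nn n)) ∈ E := by
    intro n
    rw [dS]
    obtain ⟨z, hz, hz'⟩ := hno _ (hdY n)
    exact (mu_spec (Q := fun y => y ∈ Y ∧ ZFSet.pair y (fapp d (nn n)) ∈ E) (KK.ord κ) (hYκ hz) ⟨hz, hz'⟩).2.1.2
  let f := lam ZFSet.omega (fun n => ZFSet.sep (fun ξ => ev κ s (fapp d (insert n n)) ξ ∈ ev κ s (fapp d n) ξ) κ)
  have hf : f ∈ N := Tm.mem_out (N := N) inferInstance
  obtain ⟨ξ, hξ⟩ := X.g.oi f hf (isZFunc_lam _ _) fun n hn => by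
    show fapp (lam _ _) _ ∈ U
    rw [fapp_lam hn]
    obtain ⟨m, rfl⟩ := mem_omega.1 hn
    exact (hE' _ (hYκ (hdY (m + 1))) _ (hYκ (hdY m))).1 (hdE m)
  have hstep : ∀ m, ev κ s (fapp d (nn (m + 1))) ξ ∈ ev κ s (fapp d (nn m)) ξ := by
    intro m
    have h : ξ ∈ fapp (lam _ _) (nn m) := hξ _ (nn_mem_omega m)
    rw [fapp_lam (nn_mem_omega m)] at h
    exact (ZFSet.mem_sep.1 h).2
  have : ∀ a : ZFSet.{u}, ∀ m, ev κ s (fapp d (nn m)) ξ ≠ a := fun a => by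
    refine ZFSet.inductionOn a fun a ih m e => ?_
    exact ih _ (e ▸ hstep m) (m + 1) rfl
  exact this _ 0 rfl
end

/-! ### Uniformly definable predicates over transitive structures -/

/-- `P` is expressed by one formula in all transitive structures. -/
class Un (P : ZFSet.{u} → (ℕ → ZFSet.{u}) → Prop) : Prop where
  out : ∃ φ : Fml, ∀ D : ZFSet.{u}, D.IsTransitive → ∀ v : ℕ → ZFSet.{u}, (∀ n, v n ∈ D) →
    (Sat D.toSet φ v ↔ P D v)

theorem Un.congr {P Q : ZFSet.{u} → (ℕ → ZFSet.{u}) → Prop} (h : Un P)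
    (hPQ : ∀ D : ZFSet.{u}, D.IsTransitive → ∀ v : ℕ → ZFSet.{u}, (∀ n, v n ∈ D) → (P D v ↔ Q D v)) : Un Q := by
  obtain ⟨φ, h⟩ := h.out
  exact ⟨φ, fun D hD v hv => (h D hD v hv).trans (hPQ D hD v hv)⟩

theorem Un.sat (φ : Fml) (ρ : ℕ → ℕ) : Un.{u} (fun D v => Sat D.toSet φ (fun n => v (ρ n))) := by
  obtain ⟨ψ, h⟩ := Sat_rename.{u} φ ρ
  exact ⟨ψ, fun D _ v _ => h _ v⟩

instance Un.mem (i j : ℕ) : Un.{u} (fun D v => v i ∈ v j) := ⟨.mem i j, fun D _ v _ => Iff.rfl⟩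
instance Un.eq (i j : ℕ) : Un.{u} (fun D v => v i = v j) := ⟨.eq i j, fun D _ v _ => Iff.rfl⟩
instance Un.not {P : ZFSet.{u} → (ℕ → ZFSet.{u}) → Prop} [h : Un P] : Un (fun D v => ¬ P D v) := by
  obtain ⟨φ, h⟩ := h.out
  exact ⟨.neg φ, fun D hD v hv => by simp only [Sat, h D hD v hv]⟩
instance Un.imp {P Q : ZFSet.{u} → (ℕ → ZFSet.{u}) → Prop} [h : Un P] [h' : Un Q] :
    Un (fun D v => P D v → Q D v) := by
  obtain ⟨φ, h⟩ := h.out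
  obtain ⟨ψ, h'⟩ := h'.out
  exact ⟨.impl φ ψ, fun D hD v hv => by simp only [Sat, h D hD v hv, h' D hD v hv]⟩
instance Un.and {P Q : ZFSet.{u} → (ℕ → ZFSet.{u}) → Prop} [h : Un P] [h' : Un Q] :
    Un (fun D v => P D v ∧ Q D v) :=
  Un.congr (P := fun D v => ¬ (P D v → ¬ Q D v)) inferInstance fun D _ v _ => by tauto
instance Un.or {P Q : ZFSet.{u} → (ℕ → ZFSet.{u}) → Prop} [h : Un P] [h' : Un Q] :
    Un (fun D v => P D v ∨ Q D v) :=
  Un.congr (P := fun D v => (¬ P D v → Q D v)) inferInstance fun D _ v _ => by tauto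
instance Un.iff {P Q : ZFSet.{u} → (ℕ → ZFSet.{u}) → Prop} [h : Un P] [h' : Un Q] :
    Un (fun D v => (P D v ↔ Q D v)) :=
  Un.congr (P := fun D v => (P D v → Q D v) ∧ (Q D v → P D v)) inferInstance fun D _ v _ => by tauto
instance Un.allD {P : ZFSet.{u} → ZFSet.{u} → (ℕ → ZFSet.{u}) → Prop}
    [h : Un (fun D v => P D (v 0) (fun n => v (n + 1)))] :
    Un (fun D v => ∀ x, x ∈ D → P D x v) := by
  obtain ⟨φ, h⟩ := h.out
  obtain ⟨χ, hχ⟩ := Sat_all.{u} φ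
  refine ⟨χ, fun D hD v hv => (hχ _ v).trans ?_⟩
  exact forall₂_congr fun x hx => h D hD (vc x v) (vc_mem hx hv)
instance Un.exD {P : ZFSet.{u} → ZFSet.{u} → (ℕ → ZFSet.{u}) → Prop}
    [h : Un (fun D v => P D (v 0) (fun n => v (n + 1)))] :
    Un (fun D v => ∃ x, x ∈ D ∧ P D x v) :=
  Un.congr (P := fun D v => ¬ ∀ x, x ∈ D → ¬ P D x v) inferInstance fun D _ v _ => by push Not; rfl
instance Un.all {P : ZFSet.{u} → ZFSet.{u} → (ℕ → ZFSet.{u}) → Prop} (i : ℕ)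
    [h : Un (fun D v => P D (v 0) (fun n => v (n + 1)))] :
    Un (fun D v => ∀ x, x ∈ v i → P D x v) :=
  Un.congr (P := fun D v => ∀ x, x ∈ D → (x ∈ v i → P D x v)) inferInstance fun D hD v hv =>
    ⟨fun h x hx => h x (hD _ (hv i) hx) hx, fun h x _ hx => h x hx⟩
instance Un.ex {P : ZFSet.{u} → ZFSet.{u} → (ℕ → ZFSet.{u}) → Prop} (i : ℕ)
    [h : Un (fun D v => P D (v 0) (fun n => v (n + 1)))] :
    Un (fun D v => ∃ x, x ∈ v i ∧ P D x v) :=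
  Un.congr (P := fun D v => ¬ ∀ x, x ∈ v i → ¬ P D x v) inferInstance fun D _ v _ => by push Not; rfl
instance Un.subs (i j : ℕ) : Un.{u} (fun D v => v i ⊆ v j) :=
  Un.congr (P := fun D v => ∀ x, x ∈ v i → x ∈ v j) inferInstance fun D _ v _ => Iff.rfl
instance Un.upair (i j k : ℕ) : Un.{u} (fun D v => v i = ({v j, v k} : ZFSet.{u})) :=
  Un.congr (P := fun D v => v j ∈ v i ∧ v k ∈ v i ∧ ∀ x, x ∈ v i → (x = v j ∨ x = v k)) inferInstance
    fun D _ v _ => by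
      constructor
      · rintro ⟨h1, h2, h3⟩
        ext z
        rw [ZFSet.mem_pair]
        exact ⟨h3 z, by rintro (rfl | rfl) <;> assumption⟩
      · intro h
        rw [h]
        simp [ZFSet.mem_pair]
instance Un.pair (i j k : ℕ) : Un.{u} (fun D v => v i = ZFSet.pair (v j) (v k)) :=
  Un.congr (P := fun D v => (∃ a, a ∈ v i ∧ (a = ({v j, v j} : ZFSet.{u}) ∧ ∃ b, b ∈ v i ∧
      (b = ({v j, v k} : ZFSet.{u}) ∧ v i = ({a, b} : ZFSet.{u}))))) inferInstance
    fun D _ v _ => by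
      have e : ({v j, v j} : ZFSet.{u}) = {v j} := by ext z; simp [ZFSet.mem_pair]
      constructor
      · rintro ⟨a, _, rfl, b, _, rfl, h⟩
        rw [h, e]; rfl
      · intro h
        refine ⟨_, ?_, rfl, _, ?_, rfl, ?_⟩
        · rw [h, e]; simp [ZFSet.pair, ZFSet.mem_pair]
        · rw [h]; simp [ZFSet.pair, ZFSet.mem_pair]
        · rw [h, e]; rfl
instance Un.pair_mem (i j k : ℕ) : Un.{u} (fun D v => ZFSet.pair (v j) (v k) ∈ v i) :=
  Un.congr (P := fun D v => ∃ a, a ∈ v i ∧ a = ZFSet.pair (v j) (v k)) inferInstance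
    fun D _ v _ => by simp
instance Un.isTransitive (i : ℕ) : Un.{u} (fun D v => (v i).IsTransitive) :=
  Un.congr (P := fun D v => ∀ x, x ∈ v i → x ⊆ v i) inferInstance fun D _ v _ => Iff.rfl
instance Un.isOrd (i : ℕ) : Un.{u} (fun D v => IsOrd (v i)) :=
  Un.congr (P := fun D v => (v i).IsTransitive ∧ ∀ x, x ∈ v i → x.IsTransitive) inferInstance fun D _ v _ => Iff.rfl

section
variable {κ V N M U K gK A : ZFSet.{u}} [hk : KK κ] [hN : PM N] [hV : PM V] [hM : PM M] [hK : PM K]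
  [hκN : Fact (κ ∈ N)] [hκV : Fact (κ ∈ V)] [hκM : Fact (κ ∈ M)] [hKV : Fact (K ∈ V)] [hKM : Fact (K ∈ M)]
  [hgV : Fact (gK ∈ V)] [hgM : Fact (gK ∈ M)] [hAV : Fact (A ∈ V)] [hAM : Fact (A ∈ M)]

/-- `p` is the collapse of the reduced power -/
structure Cx.Pj (X : Cx κ V N M U K gK A) (p : ZFSet.{u}) : Prop where
  pV : p ∈ V
  f : IsZFunc κ p
  mem : ∀ k ∈ κ, ∀ z, z ∈ fapp p k ↔ ∃ l ∈ κ, ae κ U (fun ξ => X.e l ξ ∈ X.e k ξ) ∧ fapp p l = z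

theorem Cx.exists_Pj (X : Cx κ V N M U K gK A) : ∃ p, X.Pj p := by
  obtain ⟨E, hE, hE'⟩ := X.exists_E
  obtain ⟨p, hp, hc⟩ := exists_collapse hκV.out hE (X.E_iwf hE hE')
  refine ⟨p, hp, hc.1, fun k hk z => ⟨fun h => ?_, ?_⟩⟩
  · obtain ⟨y, hy, h1, h2⟩ := hc.exists_of hk h
    exact ⟨y, hy, (hE' _ hy _ hk).1 h1, h2⟩
  · rintro ⟨l, hl, h, rfl⟩
    exact hc.mem_of hk hl ((hE' _ hl _ hk).2 h)

theorem Cx.tuple (X : Cx κ V N M U K gK A) (k : ℕ → ZFSet.{u}) (B : ℕ) :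
    ∃ h ∈ κ, ∀ ξ ∈ κ, ∀ i < B, av (X.e h ξ) i = X.e (k i) ξ := by
  induction B with
  | zero => exact ⟨nn 0, KK.nn 0, fun _ _ i hi => absurd hi (Nat.not_lt_zero _)⟩
  | succ B ih =>
    obtain ⟨h, hh, e⟩ := ih
    obtain ⟨h', hh', e'⟩ := X.c_upd h (k B) (KK.nn B)
    refine ⟨h', hh', fun ξ hξ i hi => ?_⟩
    rw [e' ξ hξ, av_upd]
    by_cases hiB : i = B
    · subst hiB; simp
    · rw [Function.update_of_ne hiB]
      exact e ξ hξ i (by omega)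

theorem Cx.skolem (X : Cx κ V N M U K gK A) (φ : Fml) (n : ℕ) (k : ℕ → ZFSet.{u}) :
    ∃ j ∈ κ, ∀ ξ ∈ κ, (∃ x ∈ K, ¬ Sat K.toSet φ (Function.update (fun i => X.e (k i) ξ) n x)) →
      ¬ Sat K.toSet φ (Function.update (fun i => X.e (k i) ξ) n (X.e j ξ)) := by
  obtain ⟨B, hB⟩ := Sat_bound.{u} φ
  obtain ⟨h, hh, eh⟩ := X.tuple k B
  obtain ⟨c, hc, hT⟩ := TT_spec X.κK φ
  obtain ⟨j, hj, ej⟩ := X.c_wf h hc (KK.nn n)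
  refine ⟨j, hj, fun ξ hξ => ?_⟩
  have key : ∀ x ∈ K, (upd (X.e h ξ) (nn n) x ∈ fapp (TT κ K) c ↔
      Sat K.toSet φ (Function.update (fun i => X.e (k i) ξ) n x)) := by
    intro x hx
    haveI : Fact (x ∈ K) := ⟨hx⟩
    haveI : Fact (X.e h ξ ∈ K) := ⟨X.e_K h ξ⟩
    rw [hT _ (Tm.mem_out (N := K) (Tm.upd (hs := Tm.const) (ht := Tm.const) (hr := Tm.const))), av_upd]
    refine hB _ _ _ fun i hi => ?_
    by_cases hin : i = n
    · subst hin; simp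
    · rw [Function.update_of_ne hin, Function.update_of_ne hin]
      exact eh ξ hξ i hi
  rintro ⟨x, hx, hnot⟩
  rw [← key _ (X.e_K j ξ), ej ξ hξ]
  exact wf_spec X.gs hx (fun h' => hnot ((key x hx).1 h'))

theorem Cx.satM (X : Cx κ V N M U K gK A) (φ : Fml) (k : ℕ → ZFSet.{u}) :
    Dfn M (fun v => Sat K.toSet φ (fun i => X.e (k i) (v 0))) :=
  relSat φ (fun i v => X.e (k i) (v 0)) (fun i => inferInstance)

theorem Cx.unM (X : Cx κ V N M U K gK A) {P : ZFSet.{u} → (ℕ → ZFSet.{u}) → Prop} (h : Un P)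
    (k : ℕ → ZFSet.{u}) : Dfn M (fun v => P K (fun i => X.e (k i) (v 0))) := by
  obtain ⟨φ, h⟩ := h.out
  exact (X.satM φ k).congr fun v _ => h K hK.out.1 _ fun i => X.e_K _ _

theorem Cx.Pj.eq_of {X : Cx κ V N M U K gK A} {p : ZFSet.{u}} (Y : X.Pj p) {k l : ZFSet.{u}} (hk : k ∈ κ)
    (hl : l ∈ κ) (h : ae κ U (fun ξ => X.e k ξ = X.e l ξ)) : fapp p k = fapp p l := by
  have key : ∀ k ∈ κ, ∀ l ∈ κ, ae κ U (fun ξ => X.e k ξ = X.e l ξ) → ∀ z ∈ fapp p k, z ∈ fapp p l := by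
    intro k hk l hl h z hz
    obtain ⟨j, hj, h1, h2⟩ := (Y.mem k hk z).1 hz
    exact (Y.mem l hl z).2 ⟨j, hj, by
      refine X.g.mono inferInstance ?_ (X.g.and h h1)
      rintro ξ _ ⟨h, h'⟩
      rwa [← h], h2⟩
  ext z
  exact ⟨key k hk l hl h z, key l hl k hk (X.g.mono inferInstance (fun ξ _ h => Eq.symm h) h) z⟩

theorem Cx.Pj.ae_eq {X : Cx κ V N M U K gK A} {p : ZFSet.{u}} (Y : X.Pj p) : ∀ a : ZFSet.{u},
    ∀ k ∈ κ, ∀ l ∈ κ, fapp p k = a → fapp p l = a → ae κ U (fun ξ => X.e k ξ = X.e l ξ) := by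
  intro a
  refine ZFSet.inductionOn a fun a ih k hk l hl e1 e2 => ?_
  by_contra hno
  have key : ∀ k ∈ κ, ∀ l ∈ κ, fapp p k = a → fapp p l = a → ∀ j ∈ κ,
      ae κ U (fun ξ => X.e j ξ ∈ X.e k ξ) → ae κ U (fun ξ => X.e j ξ ∈ X.e l ξ) := by
    intro k hk l hl e1 e2 j hj h
    have h1 : fapp p j ∈ fapp p k := (Y.mem k hk _).2 ⟨j, hj, h, rfl⟩
    have h2 : fapp p j ∈ fapp p l := by rw [e2, ← e1]; exact h1
    obtain ⟨i, hi, h3, h4⟩ := (Y.mem l hl _).1 h2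
    have h5 := ih (fapp p j) (e1 ▸ h1) i hi j hj h4 rfl
    refine X.g.mono inferInstance ?_ (X.g.and h5 h3)
    rintro ξ _ ⟨h, h'⟩
    rwa [← h]
  have hno' : ae κ U (fun ξ => ¬ X.e k ξ = X.e l ξ) := (X.g.not_iff inferInstance).2 hno
  let φ : Fml := .neg (.impl (.impl (.mem 2 0) (.mem 2 1)) (.neg (.impl (.mem 2 1) (.mem 2 0))))
  obtain ⟨j, hj, hs⟩ := X.skolem φ 2 (fun i => if i = 0 then k else l)
  have hφ : ∀ ξ x, (¬ Sat K.toSet φ (Function.update (fun i => X.e (if i = 0 then k else l) ξ) 2 x)) ↔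
      ¬ (x ∈ X.e k ξ ↔ x ∈ X.e l ξ) := by
    intro ξ x
    simp only [φ, Sat, Function.update, eq_rec_constant, dite_eq_ite]
    simp
    tauto
  have hd : ae κ U (fun ξ => ¬ (X.e j ξ ∈ X.e k ξ ↔ X.e j ξ ∈ X.e l ξ)) := by
    refine X.g.mono inferInstance (fun ξ hξ h => ?_) hno'
    rw [← hφ]
    apply hs ξ hξ
    by_contra hall
    push Not at hall
    apply h
    have hKt : K.IsTransitive := hK.out.1
    ext z
    constructor
    · intro hz
      by_contra hz'
      exact (hφ ξ z).2 (fun h' => hz' (h'.1 hz)) (hall z (hKt _ (X.e_K k ξ) hz))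
    · intro hz
      by_contra hz'
      exact (hφ ξ z).2 (fun h' => hz' (h'.2 hz)) (hall z (hKt _ (X.e_K l ξ) hz))
  rw [X.g.not_iff inferInstance] at hd
  apply hd
  by_cases h1 : ae κ U (fun ξ => X.e j ξ ∈ X.e k ξ)
  · have h2 := key k hk l hl e1 e2 j hj h1
    exact X.g.mono inferInstance (fun ξ _ h => iff_of_true h.1 h.2) (X.g.and h1 h2)
  · have h2 : ¬ ae κ U (fun ξ => X.e j ξ ∈ X.e l ξ) := fun h => h1 (key l hl k hk e2 e1 j hj h)
    rw [← X.g.not_iff inferInstance] at h1 h2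
    exact X.g.mono inferInstance (fun ξ _ h => iff_of_false h.1 h.2) (X.g.and h1 h2)

theorem Cx.Pj.eq_iff {X : Cx κ V N M U K gK A} {p : ZFSet.{u}} (Y : X.Pj p) {k l : ZFSet.{u}} (hk : k ∈ κ)
    (hl : l ∈ κ) : fapp p k = fapp p l ↔ ae κ U (fun ξ => X.e k ξ = X.e l ξ) :=
  ⟨fun h => Y.ae_eq _ k hk l hl h rfl, Y.eq_of hk hl⟩

theorem Cx.Pj.mem_iff {X : Cx κ V N M U K gK A} {p : ZFSet.{u}} (Y : X.Pj p) {k l : ZFSet.{u}} (hk : k ∈ κ)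
    (hl : l ∈ κ) : fapp p k ∈ fapp p l ↔ ae κ U (fun ξ => X.e k ξ ∈ X.e l ξ) := by
  rw [Y.mem l hl]
  constructor
  · rintro ⟨j, hj, h1, h2⟩
    refine X.g.mono inferInstance ?_ (X.g.and ((Y.eq_iff hj hk).1 h2) h1)
    rintro ξ _ ⟨h, h'⟩
    rwa [← h]
  · intro h
    exact ⟨k, hk, h, rfl⟩

/-- the ultrapower-like model -/
def Mf (κ p : ZFSet.{u}) : ZFSet.{u} := img (fun k => fapp p k) κ

theorem mem_Mf {p x : ZFSet.{u}} : x ∈ Mf κ p ↔ ∃ k ∈ κ, fapp p k = x := mem_img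

theorem Cx.Pj.los {X : Cx κ V N M U K gK A} {p : ZFSet.{u}} (Y : X.Pj p) (φ : Fml) : ∀ (k : ℕ → ZFSet.{u}),
    (∀ n, k n ∈ κ) → (Sat (Mf κ p).toSet φ (fun n => fapp p (k n)) ↔
      ae κ U (fun ξ => Sat K.toSet φ (fun n => X.e (k n) ξ))) := by
  induction φ with
  | mem i j => exact fun k hk => Y.mem_iff (hk i) (hk j)
  | eq i j => exact fun k hk => Y.eq_iff (hk i) (hk j)
  | neg φ ih =>
    intro k hk
    have := X.g.not_iff (P := fun ξ => Sat K.toSet φ (fun n => X.e (k n) ξ)) (X.satM φ k)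
    simp only [Sat]
    rw [ih k hk, this]
  | impl φ ψ ih1 ih2 =>
    intro k hk
    simp only [Sat]
    rw [ih1 k hk, ih2 k hk]
    haveI h1 := X.satM φ k
    haveI h2 := X.satM ψ k
    constructor
    · intro h
      by_cases hφ : ae κ U (fun ξ => Sat K.toSet φ (fun n => X.e (k n) ξ))
      · exact X.g.mono inferInstance (fun ξ _ h _ => h) (h hφ)
      · rw [← X.g.not_iff (P := fun ξ => Sat K.toSet φ (fun n => X.e (k n) ξ)) h1] at hφ
        exact X.g.mono inferInstance (fun ξ _ h h' => absurd h' h) hφ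
    · intro h h'
      exact X.g.mono inferInstance (fun ξ _ h => h.1 h.2) (X.g.and h h')
  | all n φ ih =>
    intro k hk
    have e1 : ∀ (j : ZFSet.{u}), Function.update (fun n => fapp p (k n)) n (fapp p j) =
        fun i => fapp p (Function.update k n j i) := by
      intro j; funext i; by_cases h : i = n
      · subst h; simp
      · simp [Function.update_of_ne h]
    have e2 : ∀ (j ξ : ZFSet.{u}), Function.update (fun n => X.e (k n) ξ) n (X.e j ξ) =
        fun i => X.e (Function.update k n j i) ξ := by
      intro j ξ; funext i; by_cases h : i = n
      · subst h; simp
      · simp [Function.update_of_ne h]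
    have hu : ∀ j ∈ κ, ∀ i, Function.update k n j i ∈ κ := by
      intro j hj i; by_cases h : i = n
      · subst h; simpa using hj
      · simpa [Function.update_of_ne h] using hk i
    haveI hall := X.satM (.all n φ) k
    simp only [Sat] at hall ⊢
    constructor
    · intro h
      by_contra hno
      obtain ⟨j, hj, hs⟩ := X.skolem φ n k
      rw [← X.g.not_iff (P := fun ξ => ∀ x ∈ K.toSet, Sat K.toSet φ (Function.update (fun n => X.e (k n) ξ) n x)) hall] at hno
      have h1 := h (fapp p j) (mem_Mf.2 ⟨j, hj, rfl⟩)
      rw [e1, ih _ (hu j hj)] at h1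
      obtain ⟨ξ, hξ, h2, h3⟩ := X.g.exists_of (X.g.and hno h1)
      rw [← e2] at h3
      push Not at h2
      exact hs ξ hξ h2 h3
    · intro h x hx
      obtain ⟨j, hj, rfl⟩ := mem_Mf.1 hx
      rw [e1, ih _ (hu j hj)]
      refine X.g.mono (X.satM φ _) (fun ξ hξ h' => ?_) h
      rw [← e2]
      exact h' _ (X.e_K j ξ)

theorem Cx.Pj.trans {X : Cx κ V N M U K gK A} {p : ZFSet.{u}} (Y : X.Pj p) : (Mf κ p).IsTransitive := by
  intro a ha z hz
  obtain ⟨k, hk, rfl⟩ := mem_Mf.1 ha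
  obtain ⟨l, hl, _, rfl⟩ := (Y.mem k hk z).1 hz
  exact mem_Mf.2 ⟨l, hl, rfl⟩

theorem Cx.Pj.un {X : Cx κ V N M U K gK A} {p : ZFSet.{u}} (Y : X.Pj p)
    {P : ZFSet.{u} → (ℕ → ZFSet.{u}) → Prop} (h : Un P) {k : ℕ → ZFSet.{u}} (hk : ∀ n, k n ∈ κ) :
    P (Mf κ p) (fun n => fapp p (k n)) ↔ ae κ U (fun ξ => P K (fun n => X.e (k n) ξ)) := by
  obtain ⟨φ, h⟩ := h.out
  rw [← h _ Y.trans _ (fun n => mem_Mf.2 ⟨_, hk n, rfl⟩), Y.los φ k hk]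
  have : (fun ξ => Sat K.toSet φ (fun n => X.e (k n) ξ)) = (fun ξ => P K (fun n => X.e (k n) ξ)) := by
    funext ξ
    exact propext (h K hK.out.1 _ fun n => X.e_K _ _)
  rw [this]

theorem Cx.Pj.transfer {X : Cx κ V N M U K gK A} {p : ZFSet.{u}} (Y : X.Pj p)
    {P : ZFSet.{u} → (ℕ → ZFSet.{u}) → Prop} (h : Un P) (hP : ∀ v : ℕ → ZFSet.{u}, (∀ n, v n ∈ K) → P K v)
    (v : ℕ → ZFSet.{u}) (hv : ∀ n, v n ∈ Mf κ p) : P (Mf κ p) v := by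
  choose k hk e using fun n => mem_Mf.1 (hv n)
  have : v = fun n => fapp p (k n) := funext fun n => (e n).symm
  rw [this, Y.un h hk]
  exact X.g.all (X.unM h k) fun ξ _ => hP _ fun n => X.e_K _ _
end

section
variable {κ V N M U K gK A : ZFSet.{u}} [hk : KK κ] [hN : PM N] [hV : PM V] [hM : PM M] [hK : PM K]
  [hκN : Fact (κ ∈ N)] [hκV : Fact (κ ∈ V)] [hκM : Fact (κ ∈ M)] [hKV : Fact (K ∈ V)] [hKM : Fact (K ∈ M)]
  [hgV : Fact (gK ∈ V)] [hgM : Fact (gK ∈ M)] [hAV : Fact (A ∈ V)] [hAM : Fact (A ∈ M)]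

theorem Cx.Pj.pi_const {X : Cx κ V N M U K gK A} {p : ZFSet.{u}} (Y : X.Pj p) (α : ZFSet.{u}) :
    α ∈ κ → ∀ k ∈ κ, ae κ U (fun ξ => X.e k ξ = α) → fapp p k = α := by
  refine ZFSet.inductionOn α fun α ih hα k hk h => ?_
  have hκ := KK.ord κ
  haveI : Fact (α ∈ M) := ⟨PM.mem hκM.out hα⟩
  ext z
  rw [Y.mem k hk]
  constructor
  · rintro ⟨l, hl, h1, rfl⟩
    have h2 : ae κ U (fun ξ => X.e l ξ ∈ α) := by
      refine X.g.mono inferInstance ?_ (X.g.and h h1)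
      rintro ξ _ ⟨h, h'⟩
      rwa [← h]
    obtain ⟨γ, hγ, h3⟩ := X.g.pigeon (c := fun ξ => X.e l ξ) inferInstance hα h2
    rw [ih γ hγ (hκ.trans hα hγ) l hl h3]
    exact hγ
  · intro hz
    obtain ⟨l, hl, e⟩ := X.c_const (hκ.trans hα hz)
    haveI : Fact (z ∈ M) := ⟨PM.mem hκM.out (hκ.trans hα hz)⟩
    refine ⟨l, hl, ?_, ih z hz (hκ.trans hα hz) l hl (X.g.all inferInstance e)⟩
    refine X.g.mono inferInstance (fun ξ hξ h => ?_) h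
    rw [e ξ hξ, h]
    exact hz

theorem Cx.Pj.exists_const {X : Cx κ V N M U K gK A} {p : ZFSet.{u}} (Y : X.Pj p) {α : ZFSet.{u}} (hα : α ∈ κ) :
    ∃ k ∈ κ, (∀ ξ ∈ κ, X.e k ξ = α) ∧ fapp p k = α := by
  haveI : Fact (α ∈ M) := ⟨PM.mem hκM.out hα⟩
  obtain ⟨l, hl, e⟩ := X.c_const hα
  exact ⟨l, hl, e, Y.pi_const α hα l hl (X.g.all inferInstance e)⟩

theorem Cx.Pj.mem_pi {X : Cx κ V N M U K gK A} {p : ZFSet.{u}} (Y : X.Pj p) {α k : ZFSet.{u}} (hα : α ∈ κ)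
    (hk : k ∈ κ) : α ∈ fapp p k ↔ ae κ U (fun ξ => α ∈ X.e k ξ) := by
  haveI : Fact (α ∈ M) := ⟨PM.mem hκM.out hα⟩
  obtain ⟨l, hl, e, e'⟩ := Y.exists_const hα
  have h1 := Y.mem_iff hl hk
  rw [e'] at h1
  rw [h1]
  constructor
  · exact X.g.mono inferInstance (fun ξ hξ h => by rwa [← e ξ hξ])
  · exact X.g.mono inferInstance (fun ξ hξ h => by rwa [e ξ hξ])

/-- members of an element which is represented by a function with `e k ξ ⊆ ξ` -/
theorem Cx.Pj.pi_sub {X : Cx κ V N M U K gK A} {p : ZFSet.{u}} (Y : X.Pj p) {k : ZFSet.{u}}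
    (hk : k ∈ κ) (h : ae κ U (fun ξ => X.e k ξ ⊆ ξ)) : fapp p k ⊆ κ := by
  intro z hz
  obtain ⟨l, hl, h1, rfl⟩ := (Y.mem k hk z).1 hz
  have h2 : ae κ U (fun ξ => X.e l ξ ∈ ξ) := by
    refine X.g.mono inferInstance ?_ (X.g.and h h1)
    rintro ξ _ ⟨h, h'⟩
    exact h h'
  obtain ⟨γ, hγ, h3⟩ := X.g.normal (c := fun ξ => X.e l ξ) inferInstance h2
  rw [Y.pi_const γ hγ l hl h3]
  exact hγ

theorem Cx.Pj.pi_id {X : Cx κ V N M U K gK A} {p : ZFSet.{u}} (Y : X.Pj p) {k : ZFSet.{u}}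
    (hk : k ∈ κ) (h : ∀ ξ ∈ κ, X.e k ξ = ξ) : fapp p k = κ := by
  ext z
  constructor
  · exact fun hz => Y.pi_sub hk (X.g.all inferInstance fun ξ hξ => by rw [h ξ hξ]) hz
  · intro hz
    haveI : Fact (z ∈ M) := ⟨PM.mem hκM.out hz⟩
    rw [Y.mem_pi hz hk]
    exact X.g.mono inferInstance (fun ξ hξ h' => by rwa [h ξ hξ]) (X.g.aetail hz)

theorem Cx.Pj.κ_mem {X : Cx κ V N M U K gK A} {p : ZFSet.{u}} (Y : X.Pj p) : κ ∈ Mf κ p := by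
  obtain ⟨k, hk, h⟩ := X.c_id
  exact mem_Mf.2 ⟨k, hk, Y.pi_id hk h⟩

theorem Cx.Pj.A_mem {X : Cx κ V N M U K gK A} {p : ZFSet.{u}} (Y : X.Pj p) : A ∈ Mf κ p := by
  obtain ⟨k, hk, h⟩ := X.c_A
  refine mem_Mf.2 ⟨k, hk, ?_⟩
  have hs := Y.pi_sub hk (X.g.all inferInstance fun ξ hξ => by
    rw [h ξ hξ]; exact fun z hz => (ZFSet.mem_inter.1 hz).2)
  ext z
  constructor
  · intro hz
    rw [Y.mem_pi (hs hz) hk] at hz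
    obtain ⟨ξ, hξ, h'⟩ := X.g.exists_of hz
    rw [h ξ hξ] at h'
    exact (ZFSet.mem_inter.1 h').1
  · intro hz
    haveI : Fact (z ∈ M) := ⟨PM.mem hκM.out (X.Aκ hz)⟩
    rw [Y.mem_pi (X.Aκ hz) hk]
    exact X.g.mono inferInstance (fun ξ hξ h' => by rw [h ξ hξ]; exact ZFSet.mem_inter.2 ⟨hz, h'⟩)
      (X.g.aetail (X.Aκ hz))

theorem PM.wo {x : ZFSet.{u}} (hx : x ∈ K) : ∃ θ, θ ∈ K ∧ (IsOrd θ ∧ ∃ f, f ∈ K ∧ ∃ r, r ∈ K ∧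
    ((∀ a, a ∈ x → ∃ i, i ∈ θ ∧ ZFSet.pair i a ∈ f) ∧ (∀ i, i ∈ θ → ∀ a, a ∈ x → ∀ b, b ∈ x →
      (ZFSet.pair i a ∈ f → ZFSet.pair i b ∈ f → a = b)) ∧
      (∀ q, q ∈ r → ∃ a, a ∈ x ∧ ∃ b, b ∈ x ∧ q = ZFSet.pair a b) ∧
      (∀ i, i ∈ θ → ∀ j, j ∈ θ → ∀ a, a ∈ x → ∀ b, b ∈ x → (ZFSet.pair i a ∈ f → ZFSet.pair j b ∈ f →
        (ZFSet.pair a b ∈ r ↔ i ∈ j))))) := by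
  obtain ⟨θ, hθ, hθo, f, hf, hz, hs, hi⟩ := PM.enum hx
  haveI : Fact (x ∈ K) := ⟨hx⟩
  haveI : Fact (f ∈ K) := ⟨hf⟩
  haveI : Fact (θ ∈ K) := ⟨hθ⟩
  refine ⟨θ, hθ, hθo, f, hf, ZFSet.sep (fun q => ∃ i, i ∈ θ ∧ ∃ j, j ∈ θ ∧ (i ∈ j ∧ q = ZFSet.pair (fapp f i) (fapp f j)))
    (ZFSet.prod x x), Tm.mem_out (N := K) inferInstance, ?_, ?_, ?_, ?_⟩
  · intro a ha
    obtain ⟨i, hi, rfl⟩ := hs.2 a ha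
    exact ⟨i, hi, hz.mem hi⟩
  · intro i hi a _ b _ h1 h2
    rw [← (hz.eq h1).2, ← (hz.eq h2).2]
  · intro q hq
    obtain ⟨_, i, hi, j, hj, _, rfl⟩ := ZFSet.mem_sep.1 hq
    exact ⟨_, hs.1 i hi, _, hs.1 j hj, rfl⟩
  · intro i hi' j hj a ha b hb h1 h2
    have e1 := (hz.eq h1).2
    have e2 := (hz.eq h2).2
    subst e1 e2
    rw [ZFSet.mem_sep, ZFSet.pair_mem_prod, and_iff_right ⟨ha, hb⟩]
    constructor
    · rintro ⟨i', hi'', j', hj', h, e⟩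
      obtain ⟨e1, e2⟩ := ZFSet.pair_inj.1 e
      rw [hi _ hi' _ hi'' e1, hi _ hj _ hj' e2]
      exact h
    · intro h
      exact ⟨i, hi', j, hj, h, rfl⟩

theorem wo_of {D x : ZFSet.{u}} (h : ∃ θ, θ ∈ D ∧ (IsOrd θ ∧ ∃ f, f ∈ D ∧ ∃ r, r ∈ D ∧
    ((∀ a, a ∈ x → ∃ i, i ∈ θ ∧ ZFSet.pair i a ∈ f) ∧ (∀ i, i ∈ θ → ∀ a, a ∈ x → ∀ b, b ∈ x →
      (ZFSet.pair i a ∈ f → ZFSet.pair i b ∈ f → a = b)) ∧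
      (∀ q, q ∈ r → ∃ a, a ∈ x ∧ ∃ b, b ∈ x ∧ q = ZFSet.pair a b) ∧
      (∀ i, i ∈ θ → ∀ j, j ∈ θ → ∀ a, a ∈ x → ∀ b, b ∈ x → (ZFSet.pair i a ∈ f → ZFSet.pair j b ∈ f →
        (ZFSet.pair a b ∈ r ↔ i ∈ j)))))) : ∃ r ∈ D, IsWellOrderOn x r := by
  obtain ⟨θ, _, hθ, f, _, r, hr, h1, h2, h3, h4⟩ := h
  refine ⟨r, hr, h3, ?_, ?_, ?_, ?_⟩
  · intro a ha b hb
    obtain ⟨i, hi, hia⟩ := h1 a ha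
    obtain ⟨j, hj, hjb⟩ := h1 b hb
    rcases (hθ.mem hi).tri (hθ.mem hj) with h | h | h
    · exact Or.inr (Or.inl ((h4 i hi j hj a ha b hb hia hjb).2 h))
    · subst h; exact Or.inl (h2 i hi a ha b hb hia hjb)
    · exact Or.inr (Or.inr ((h4 j hj i hi b hb a ha hjb hia).2 h))
  · intro a ha b hb c hc hab hbc
    obtain ⟨i, hi, hia⟩ := h1 a ha
    obtain ⟨j, hj, hjb⟩ := h1 b hb
    obtain ⟨k, hk, hkc⟩ := h1 c hc
    refine (h4 i hi k hk a ha c hc hia hkc).2 ?_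
    exact (hθ.mem hk).trans ((h4 j hj k hk b hb c hc hjb hkc).1 hbc) ((h4 i hi j hj a ha b hb hia hjb).1 hab)
  · intro a ha haa
    obtain ⟨i, hi, hia⟩ := h1 a ha
    exact ZFSet.mem_irrefl _ ((h4 i hi i hi a ha a ha hia hia).1 haa)
  · rintro S hS ⟨a, ha⟩
    obtain ⟨i, hi, hia⟩ := h1 a (hS ha)
    obtain ⟨j, hj, ⟨b, hb, hjb⟩, hm⟩ := ord_least (θ := θ) (fun i => ∃ a ∈ S, ZFSet.pair i a ∈ f) hi ⟨a, ha, hia⟩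
    refine ⟨b, hb, fun c hc hcb => ?_⟩
    obtain ⟨k, hk, hkc⟩ := h1 c (hS hc)
    exact hm k hk ((h4 k hk j hj c (hS hc) b (hS hb) hkc hjb).1 hcb) ⟨c, hc, hkc⟩

theorem Cx.Pj.isTransModel {X : Cx κ V N M U K gK A} {p : ZFSet.{u}} (Y : X.Pj p) : IsTransModel (Mf κ p) := by
  have ht := Y.trans
  have hKt : K.IsTransitive := hK.out.1
  refine ⟨ht, ?_, ?_, ?_, ?_, ?_, ?_⟩
  · obtain ⟨k, hk, _, e⟩ := Y.exists_const (KK.om (κ := κ))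
    exact mem_Mf.2 ⟨k, hk, e⟩
  · intro x hx y hy
    obtain ⟨z, hz, e⟩ := Y.transfer (P := fun D v => ∃ z, z ∈ D ∧ z = ({v 0, v 1} : ZFSet.{u})) inferInstance
      (fun v hv => ⟨_, PM.pair2 (hv 0) (hv 1), rfl⟩) (vc x (fun _ => y)) (vc_mem hx fun _ => hy)
    exact e ▸ hz
  · intro x hx
    obtain ⟨z, hz, h1, h2⟩ := Y.transfer (P := fun D v => ∃ z, z ∈ D ∧ ((∀ y, y ∈ v 0 → y ⊆ z) ∧
        ∀ t, t ∈ z → ∃ y, y ∈ v 0 ∧ t ∈ y)) inferInstance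
      (fun v hv => ⟨_, hK.out.2.2.2.1 _ (hv 0), fun y hy z hz => ZFSet.mem_sUnion.2 ⟨y, hy, hz⟩,
        fun t ht => ZFSet.mem_sUnion.1 ht⟩) (fun _ => x) (fun _ => hx)
    have : (⋃₀ x : ZFSet.{u}) = z := by
      ext t
      rw [ZFSet.mem_sUnion]
      exact ⟨fun ⟨y, hy, h⟩ => h1 y hy h, fun h => h2 t h⟩
    rw [this]; exact hz
  · intro φ v hv a ha
    haveI : Un.{u} (fun D v => Sat D.toSet φ (Function.update (fun n => v (n + 1 + 1 + 1)) 0 (v 0))) := by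
      refine (Un.sat φ (fun n => if n = 0 then 0 else n + 3)).congr fun D _ v _ => ?_
      have : (fun n => v (if n = 0 then 0 else n + 3)) = Function.update (fun n => v (n + 1 + 1 + 1)) 0 (v 0) := by
        funext n; by_cases h : n = 0
        · subst h; simp
        · simp [h]
      rw [this]
    obtain ⟨b, hb, h⟩ := Y.transfer (P := fun D v => ∃ b, b ∈ D ∧ ∀ x, x ∈ D → (x ∈ b ↔ (x ∈ v 0 ∧
        Sat D.toSet φ (Function.update (fun n => v (n + 1)) 0 x)))) inferInstance
      (fun v hv => by
        obtain ⟨b, hb, h⟩ := hK.out.2.2.2.2.1 φ (fun n => v (n + 1)) (fun n => hv _) (v 0) (hv 0)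
        exact ⟨b, hb, fun x _ => h x⟩) (vc a v) (vc_mem ha hv)
    refine ⟨b, hb, fun x => ?_⟩
    constructor
    · intro hx; exact (h x (ht _ hb hx)).1 hx
    · intro hx; exact (h x (ht _ ha hx.1)).2 hx
  · intro φ v hv a ha
    have key : ∀ ρ : ℕ → ℕ, ∀ i j, Un.{u} (fun D v => Sat D.toSet φ
        (Function.update (Function.update (fun n => v (ρ n)) 0 (v i)) 1 (v j))) := by
      intro ρ i j
      refine (Un.sat φ (fun n => if n = 0 then i else if n = 1 then j else ρ n)).congr fun D _ v _ => ?_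
      have : (fun n => v (if n = 0 then i else if n = 1 then j else ρ n)) =
          Function.update (Function.update (fun n => v (ρ n)) 0 (v i)) 1 (v j) := by
        funext n; by_cases h : n = 0
        · subst h; simp
        · by_cases h' : n = 1
          · subst h'; simp
          · simp [h, h']
      rw [this]
    haveI k1 := key (fun n => n + 1 + 1 + 1) 1 0
    haveI k2 := key (fun n => n + 1 + 1 + 1 + 1) 1 0
    exact Y.transfer (P := fun D v => (∀ x, x ∈ v 0 → ∃ y, y ∈ D ∧
        Sat D.toSet φ (Function.update (Function.update (fun n => v (n + 1)) 0 x) 1 y)) →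
        ∃ b, b ∈ D ∧ ∀ x, x ∈ v 0 → ∃ y, y ∈ b ∧
        Sat D.toSet φ (Function.update (Function.update (fun n => v (n + 1)) 0 x) 1 y)) inferInstance
      (fun v hv => hK.out.2.2.2.2.2.1 φ (fun n => v (n + 1)) (fun n => hv _) (v 0) (hv 0)) (vc a v) (vc_mem ha hv)
  · intro x hx
    refine wo_of (Y.transfer (P := fun D v => ∃ θ, θ ∈ D ∧ (IsOrd θ ∧ ∃ f, f ∈ D ∧ ∃ r, r ∈ D ∧
      ((∀ a, a ∈ v 0 → ∃ i, i ∈ θ ∧ ZFSet.pair i a ∈ f) ∧ (∀ i, i ∈ θ → ∀ a, a ∈ v 0 → ∀ b, b ∈ v 0 →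
      (ZFSet.pair i a ∈ f → ZFSet.pair i b ∈ f → a = b)) ∧
      (∀ q, q ∈ r → ∃ a, a ∈ v 0 ∧ ∃ b, b ∈ v 0 ∧ q = ZFSet.pair a b) ∧
      (∀ i, i ∈ θ → ∀ j, j ∈ θ → ∀ a, a ∈ v 0 → ∀ b, b ∈ v 0 → (ZFSet.pair i a ∈ f → ZFSet.pair j b ∈ f →
        (ZFSet.pair a b ∈ r ↔ i ∈ j)))))) ?_ (fun v hv => PM.wo (hv 0)) (fun _ => x) (fun _ => hx))
    infer_instance
end

section
variable {κ V N M U K gK A : ZFSet.{u}} [hk : KK κ] [hN : PM N] [hV : PM V] [hM : PM M] [hK : PM K]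
  [hκN : Fact (κ ∈ N)] [hκV : Fact (κ ∈ V)] [hκM : Fact (κ ∈ M)] [hKV : Fact (K ∈ V)] [hKM : Fact (K ∈ M)]
  [hgV : Fact (gK ∈ V)] [hgM : Fact (gK ∈ M)] [hAV : Fact (A ∈ V)] [hAM : Fact (A ∈ M)]

theorem Cx.Pj.sub_iff {X : Cx κ V N M U K gK A} {p : ZFSet.{u}} (Y : X.Pj p) {k : ZFSet.{u}} (hk : k ∈ κ) :
    fapp p k ⊆ κ ↔ ae κ U (fun ξ => X.e k ξ ⊆ ξ) := by
  refine ⟨fun h => ?_, Y.pi_sub hk⟩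
  obtain ⟨i, hi, e⟩ := X.c_id
  have h1 := Y.un (Un.subs 0 1) (k := vc k (fun _ => i)) (vc_mem hk fun _ => hi)
  have h2 : fapp p (vc k (fun _ => i) 0) ⊆ fapp p (vc k (fun _ => i) 1) := by
    show fapp p k ⊆ fapp p i
    rw [Y.pi_id hi e]; exact h
  have h3 : ae κ U (fun ξ => X.e k ξ ⊆ X.e i ξ) := h1.1 h2
  refine X.g.mono inferInstance (fun ξ hξ h => ?_) h3
  rwa [e ξ hξ] at h

theorem Cx.Pj.pi_eq {X : Cx κ V N M U K gK A} {p : ZFSet.{u}} (Y : X.Pj p) {k : ZFSet.{u}} (hk : k ∈ κ)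
    (h : fapp p k ⊆ κ) : fapp p k = ZFSet.sep (fun α => ae κ U (fun ξ => α ∈ X.e k ξ)) κ := by
  ext z
  rw [ZFSet.mem_sep]
  exact ⟨fun hz => ⟨h hz, (Y.mem_pi (h hz) hk).1 hz⟩, fun hz => (Y.mem_pi hz.1 hk).2 hz.2⟩

theorem Cx.Pj.sub_M {X : Cx κ V N M U K gK A} {p : ZFSet.{u}} (Y : X.Pj p) {x : ZFSet.{u}} (hx : x ∈ Mf κ p)
    (h : x ⊆ κ) : x ∈ M := by
  obtain ⟨k, hk, rfl⟩ := mem_Mf.1 hx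
  rw [Y.pi_eq hk h]
  exact X.g.uq (P := fun α ξ => α ∈ X.e k ξ) inferInstance

theorem Cx.Pj.S_iff {X : Cx κ V N M U K gK A} {p : ZFSet.{u}} (Y : X.Pj p) (n : ℕ) {β : ZFSet.{u}} (hβ : β ∈ κ) :
    β ∈ Sst κ U (MPaper.bs κ U K gK A n) ↔ fapp p (pr κ (nn n) β) ∈ U := by
  have hd : pr κ (nn n) β ∈ κ := pr_mem (KK.nn n) hβ
  have e : ∀ ξ, fapp (MPaper.bs κ U K gK A n) (pr κ β ξ) = X.e (pr κ (nn n) β) ξ := fun ξ =>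
    (ev_pr n hβ ξ).symm
  have e1 : (fun ξ => fapp (MPaper.bs κ U K gK A n) (pr κ β ξ) ⊆ ξ) = (fun ξ => X.e (pr κ (nn n) β) ξ ⊆ ξ) := by
    funext ξ; rw [e]
  have e2 : ZFSet.sep (fun α => pr κ β α ∈ Bst κ U (MPaper.bs κ U K gK A n)) κ =
      ZFSet.sep (fun α => ae κ U (fun ξ => α ∈ X.e (pr κ (nn n) β) ξ)) κ := by
    ext α
    rw [ZFSet.mem_sep, ZFSet.mem_sep]
    refine and_congr_right fun hα => ?_
    unfold Bst
    rw [ZFSet.mem_sep, and_iff_right (pr_mem hβ hα), pl_pr hβ hα, pR_pr hβ hα]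
    have : (fun ξ => α ∈ fapp (MPaper.bs κ U K gK A n) (pr κ β ξ)) = (fun ξ => α ∈ X.e (pr κ (nn n) β) ξ) := by
      funext ξ; rw [e]
    rw [this]
  have h1 : β ∈ Sst κ U (MPaper.bs κ U K gK A n) ↔ (fapp p (pr κ (nn n) β) ⊆ κ ∧
      ZFSet.sep (fun α => ae κ U (fun ξ => α ∈ X.e (pr κ (nn n) β) ξ)) κ ∈ U) := by
    unfold Sst
    rw [ZFSet.mem_inter, ZFSet.mem_sep, ZFSet.mem_sep, and_iff_right hβ, and_iff_right hβ, e1, Y.sub_iff hd]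
    show _ ∧ ZFSet.sep _ κ ∈ U ↔ _
    rw [e2]
  rw [h1]
  constructor
  · rintro ⟨h, h'⟩
    rw [Y.pi_eq hd h]; exact h'
  · intro h
    have hs := (X.g.uf.1 _ h).2
    refine ⟨hs, ?_⟩
    rw [← Y.pi_eq hd hs]; exact h

theorem Cx.Pj.normed {X : Cx κ V N M U K gK A} {p : ZFSet.{u}} (Y : X.Pj p) {k : ZFSet.{u}} (hk : k ∈ κ) :
    ∃ n : ℕ, ∃ β ∈ κ, fapp p k = fapp p (pr κ (nn n) β) := by
  obtain ⟨n, β, hβ, e⟩ := X.norm k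
  exact ⟨n, β, hβ, Y.eq_of hk (pr_mem (KK.nn n) hβ) (X.g.all inferInstance e)⟩

theorem Cx.Pj.Uf_V {X : Cx κ V N M U K gK A} {p : ZFSet.{u}} (Y : X.Pj p) : U ∩ Mf κ p ∈ V := by
  haveI : Fact (p ∈ V) := ⟨Y.pV⟩
  haveI : Fact (U ∈ N) := ⟨X.g.UN⟩
  let s := sq κ U K gK A
  haveI : Fact (s ∈ N) := ⟨X.sq_N⟩
  let L := lam ZFSet.omega (fun n => Sst κ U (fapp s n))
  have hL : L ∈ N := Tm.mem_out (N := N) inferInstance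
  have hLn : ∀ n : ℕ, fapp L (nn n) = Sst κ U (MPaper.bs κ U K gK A n) := by
    intro n
    rw [fapp_lam (nn_mem_omega n), sq_nn]
  have hLV : L ∈ V := by
    refine X.hseq _ hL (isZFunc_lam _ _) fun n hn => ?_
    obtain ⟨m, rfl⟩ := mem_omega.1 hn
    rw [hLn]
    exact X.S_V (X.bs m).1 (X.bs m).2.1
  haveI : Fact (L ∈ V) := ⟨hLV⟩
  have h1 : ZFSet.sep (fun z => ∃ n, n ∈ ZFSet.omega ∧ ∃ β, β ∈ fapp L n ∧ fapp p (pr κ n β) = z)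
      (img (fun k => fapp p k) κ) ∈ V := Tm.mem_out (N := V) inferInstance
  convert h1 using 1
  ext z
  rw [ZFSet.mem_inter, ZFSet.mem_sep]
  constructor
  · rintro ⟨hz, hm⟩
    refine ⟨hm, ?_⟩
    obtain ⟨k, hk, rfl⟩ := mem_Mf.1 hm
    obtain ⟨n, β, hβ, e⟩ := Y.normed hk
    refine ⟨nn n, nn_mem_omega n, β, ?_, e.symm⟩
    rw [hLn, Y.S_iff n hβ, ← e]
    exact hz
  · rintro ⟨hm, n, hn, β, hβ, rfl⟩
    obtain ⟨m, rfl⟩ := mem_omega.1 hn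
    refine ⟨?_, hm⟩
    rw [hLn] at hβ
    have hβκ : β ∈ κ := (ZFSet.mem_sep.1 (ZFSet.mem_inter.1 hβ).1).1
    exact (Y.S_iff m hβκ).1 hβ

/-- membership of pairs of ordinals -/
theorem Cx.Pj.pair_iff {X : Cx κ V N M U K gK A} {p : ZFSet.{u}} (Y : X.Pj p) {k a b : ZFSet.{u}} (hk : k ∈ κ)
    (ha : a ∈ κ) (hb : b ∈ κ) : ZFSet.pair a b ∈ fapp p k ↔ ae κ U (fun ξ => ZFSet.pair a b ∈ X.e k ξ) := by
  haveI : Fact (a ∈ M) := ⟨PM.mem hκM.out ha⟩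
  haveI : Fact (b ∈ M) := ⟨PM.mem hκM.out hb⟩
  obtain ⟨i, hi, e, e'⟩ := Y.exists_const ha
  obtain ⟨j, hj, f, f'⟩ := Y.exists_const hb
  have h1 := Y.un (Un.pair_mem 0 1 2) (k := vc k (vc i (fun _ => j))) (vc_mem hk (vc_mem hi fun _ => hj))
  have h2 : ZFSet.pair (fapp p i) (fapp p j) ∈ fapp p k ↔
    ae κ U (fun ξ => ZFSet.pair (X.e i ξ) (X.e j ξ) ∈ X.e k ξ) := h1
  rw [e', f'] at h2
  rw [h2]
  constructor
  · exact X.g.mono inferInstance (fun ξ hξ h => by rwa [e ξ hξ, f ξ hξ] at h)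
  · exact X.g.mono inferInstance (fun ξ hξ h => by rwa [e ξ hξ, f ξ hξ])

theorem Cx.Pj.fapp_code {X : Cx κ V N M U K gK A} {p : ZFSet.{u}} (Y : X.Pj p) (n : ℕ) {β a : ZFSet.{u}}
    (hβ : β ∈ κ) (ha : a ∈ κ) (hf : IsZFunc κ (fapp p (pr κ (nn n) β))) :
    fapp p (pr κ (nn (n + 1)) (cd κ 3 β a (nn 0))) = fapp (fapp p (pr κ (nn n) β)) a := by
  haveI : Fact (a ∈ M) := ⟨PM.mem hκM.out ha⟩
  have hd : pr κ (nn n) β ∈ κ := pr_mem (KK.nn n) hβ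
  haveI : PM (Mf κ p) := ⟨Y.isTransModel⟩
  haveI : Fact (fapp p (pr κ (nn n) β) ∈ Mf κ p) := ⟨mem_Mf.2 ⟨_, hd, rfl⟩⟩
  haveI : Fact (a ∈ Mf κ p) := ⟨PM.mem Y.κ_mem ha⟩
  have hy : fapp (fapp p (pr κ (nn n) β)) a ∈ Mf κ p := Tm.mem_out (N := Mf κ p) (Tm.fapp (hs := Tm.const) (ht := Tm.const))
  obtain ⟨l, hl, el⟩ := mem_Mf.1 hy
  obtain ⟨i, hi, e, e'⟩ := Y.exists_const ha
  obtain ⟨hc, hcd⟩ := X.fapp_stage n hβ ha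
  have hun : Un.{u} (fun D v => ZFSet.pair (v 1) (v 2) ∈ v 0 ∧ ∀ b, b ∈ D → (ZFSet.pair (v 1) b ∈ v 0 → b = v 2)) :=
    inferInstance
  have h1 := Y.un hun (k := vc (pr κ (nn n) β) (vc i (fun _ => l))) (vc_mem hd (vc_mem hi fun _ => hl))
  have h2 : ae κ U (fun ξ => ZFSet.pair (X.e i ξ) (X.e l ξ) ∈ X.e (pr κ (nn n) β) ξ ∧
      ∀ b, b ∈ K → (ZFSet.pair (X.e i ξ) b ∈ X.e (pr κ (nn n) β) ξ → b = X.e l ξ)) := by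
    refine h1.1 ?_
    show ZFSet.pair (fapp p i) (fapp p l) ∈ fapp p (pr κ (nn n) β) ∧
      ∀ b, b ∈ Mf κ p → (ZFSet.pair (fapp p i) b ∈ fapp p (pr κ (nn n) β) → b = fapp p l)
    rw [e', el]
    exact ⟨hf.mem ha, fun b _ hb => (hf.eq hb).2.symm⟩
  rw [← el]
  refine Y.eq_of (pr_mem (KK.nn _) hc) hl ?_
  refine X.g.mono inferInstance ?_ h2
  rintro ξ hξ ⟨h3, h4⟩
  rw [hcd ξ hξ]
  rw [e ξ hξ] at h3 h4
  refine fapp_of h3 fun c hc => h4 c ?_ hc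
  have hK1 : ZFSet.pair a c ∈ K := PM.mem (X.e_K _ _) hc
  have hK2 : ({a, c} : ZFSet.{u}) ∈ K := PM.mem hK1 (by unfold ZFSet.pair; simp)
  exact PM.mem hK2 (by simp)

set_option synthInstance.maxHeartbeats 400000 in
set_option synthInstance.maxSize 100000 in
theorem Cx.Pj.S_code {X : Cx κ V N M U K gK A} {p : ZFSet.{u}} (Y : X.Pj p) (m : ℕ) : ∃ k ∈ κ, ∀ z,
    z ∈ fapp p k ↔ ∃ b ∈ κ, fapp p (pr κ (nn m) b) ∈ U ∧ fapp p (pr κ (nn m) b) = z := by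
  obtain ⟨k, hk, e⟩ := X.c_S m
  refine ⟨k, hk, fun z => ?_⟩
  haveI : Fact (MPaper.bs κ U K gK A m ∈ M) := ⟨(X.bs m).2.1⟩
  haveI : Fact (Sst κ U (MPaper.bs κ U K gK A m) ∈ M) := ⟨X.S_M (X.bs m).2.1⟩
  have hS : ∀ b ∈ Sst κ U (MPaper.bs κ U K gK A m), b ∈ κ := fun b hb =>
    (ZFSet.mem_sep.1 (ZFSet.mem_inter.1 hb).1).1
  have ee : ∀ b ∈ κ, ∀ ξ, X.e (pr κ (nn m) b) ξ = fapp (MPaper.bs κ U K gK A m) (pr κ b ξ) := fun b hb ξ =>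
    ev_pr m hb ξ
  generalize hs : Sst κ U (MPaper.bs κ U K gK A m) = S at *
  generalize hB : MPaper.bs κ U K gK A m = B at *
  rw [Y.mem k hk]
  constructor
  · rintro ⟨l, hl, h, rfl⟩
    have tm : Tm M (fun v => mu (v 0) (fun b => b ∈ S ∧ X.e l (v 0) = fapp B (pr κ b (v 0)))) := inferInstance
    have tm' : Tm M (fun v => pr κ (mu (v 0) (fun b => b ∈ S ∧ X.e l (v 0) = fapp B (pr κ b (v 0)))) (v 0)) :=
      Tm.pr (hs := tm) (ht := inferInstance)
    have h1 : ae κ U (fun ξ => mu ξ (fun b => b ∈ S ∧ X.e l ξ = fapp B (pr κ b ξ)) ∈ ξ ∧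
        (mu ξ (fun b => b ∈ S ∧ X.e l ξ = fapp B (pr κ b ξ)) ∈ S ∧
        X.e l ξ = fapp B (pr κ (mu ξ (fun b => b ∈ S ∧ X.e l ξ = fapp B (pr κ b ξ))) ξ))) := by
      refine X.g.mono (@Dfn.and _ _ _ (Dfn.mem (hs := tm)) (@Dfn.and _ _ _ (Dfn.mem (hs := tm))
        (Dfn.eq (ht := Tm.fapp (hs := inferInstance) (ht := tm'))))) (fun ξ hξ h => ?_) h
      rw [e ξ hξ] at h
      obtain ⟨b, hb, h⟩ := mem_img.1 h
      obtain ⟨hbS, hbξ⟩ := ZFSet.mem_inter.1 hb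
      have := mu_spec ((KK.ord κ).mem hξ) (Q := fun b => b ∈ S ∧ X.e l ξ = fapp B (pr κ b ξ)) hbξ
        ⟨hbS, by rw [← h, ee b (hS b hbS)]⟩
      exact ⟨this.1, this.2.1⟩
    obtain ⟨γ, hγ, h2⟩ := X.g.normal (c := fun ξ => mu ξ (fun b => b ∈ S ∧ X.e l ξ = fapp B (pr κ b ξ)))
      inferInstance (X.g.mono inferInstance (fun ξ hξ h => h.1) h1)
    haveI : Fact (γ ∈ M) := ⟨PM.mem hκM.out hγ⟩
    obtain ⟨ξ, hξ, ⟨h3, h4, _⟩, h5⟩ := X.g.exists_of (X.g.and h1 h2)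
    have hγS : γ ∈ S := h5 ▸ h4
    have h6 : fapp p l = fapp p (pr κ (nn m) γ) := by
      refine Y.eq_of hl (pr_mem (KK.nn m) hγ) (X.g.mono inferInstance ?_ (X.g.and h1 h2))
      rintro ξ _ ⟨⟨_, _, h⟩, h'⟩
      rw [h'] at h
      rw [h, ee γ hγ]
    refine ⟨γ, hγ, ?_, h6.symm⟩
    rw [← Y.S_iff m hγ, hB, hs]
    exact hγS
  · rintro ⟨b, hb, hU, rfl⟩
    rw [← Y.S_iff m hb, hB, hs] at hU
    haveI : Fact (b ∈ M) := ⟨PM.mem hκM.out hb⟩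
    refine ⟨_, pr_mem (KK.nn m) hb, X.g.mono inferInstance (fun ξ hξ h => ?_) (X.g.aetail hb), rfl⟩
    rw [e ξ hξ]
    exact mem_img.2 ⟨b, ZFSet.mem_inter.2 ⟨hU, h⟩, rfl⟩

theorem Cx.Pj.wa {X : Cx κ V N M U K gK A} {p : ZFSet.{u}} (Y : X.Pj p) :
    WeaklyAmenable κ (Mf κ p) (U ∩ Mf κ p) := by
  rintro x hx ⟨f, hf, hfz, hcov⟩
  haveI : PM (Mf κ p) := ⟨Y.isTransModel⟩
  obtain ⟨k, hk, rfl⟩ := mem_Mf.1 hf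
  obtain ⟨n, β, hβ, e⟩ := Y.normed hk
  rw [e] at hfz hcov
  obtain ⟨k', hk', h⟩ := Y.S_code (n + 1)
  haveI : Fact (x ∈ Mf κ p) := ⟨hx⟩
  haveI : Fact (fapp p k' ∈ Mf κ p) := ⟨mem_Mf.2 ⟨k', hk', rfl⟩⟩
  have h1 : x ∩ fapp p k' ∈ Mf κ p := Tm.mem_out (N := Mf κ p) (Tm.inter (hs := Tm.const) (ht := Tm.const))
  convert h1 using 1
  ext z
  rw [ZFSet.mem_inter, ZFSet.mem_inter, ZFSet.mem_inter]
  refine and_congr_right fun hz => ?_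
  rw [h z]
  constructor
  · rintro ⟨hU, _⟩
    obtain ⟨a, ha, e⟩ := hcov z hz
    have h2 := Y.fapp_code n hβ ha hfz
    rw [e] at h2
    exact ⟨_, (X.fapp_stage n hβ ha).1, by rw [h2]; exact hU, h2⟩
  · rintro ⟨b, hb, hU, rfl⟩
    exact ⟨hU, PM.mem hx hz⟩

theorem Cx.Pj.uf {X : Cx κ V N M U K gK A} {p : ZFSet.{u}} (Y : X.Pj p) :
    IsMUltrafilter κ (Mf κ p) (U ∩ Mf κ p) := by
  haveI : PM (Mf κ p) := ⟨Y.isTransModel⟩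
  haveI : Fact (κ ∈ Mf κ p) := ⟨Y.κ_mem⟩
  have hsub : ∀ P : ZFSet.{u} → Prop, ZFSet.sep P κ ⊆ κ := fun P z hz => (ZFSet.mem_sep.1 hz).1
  refine ⟨?_, ?_, ?_, ?_, ?_, ?_, ?_⟩
  · intro a ha
    obtain ⟨h1, h2⟩ := ZFSet.mem_inter.1 ha
    exact ⟨h2, (X.g.uf.1 a h1).2⟩
  · intro α hα
    haveI : Fact (α ∈ Mf κ p) := ⟨PM.mem Y.κ_mem hα⟩
    refine ZFSet.mem_inter.2 ⟨X.g.uf.2.1 α hα, ?_⟩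
    unfold tailSet
    exact Tm.mem_out (N := Mf κ p) inferInstance
  · exact fun h => X.g.uf.2.2.1 (ZFSet.mem_inter.1 h).1
  · intro a ha b hb
    obtain ⟨h1, h2⟩ := ZFSet.mem_inter.1 ha
    obtain ⟨h3, h4⟩ := ZFSet.mem_inter.1 hb
    haveI : Fact (a ∈ Mf κ p) := ⟨h2⟩
    haveI : Fact (b ∈ Mf κ p) := ⟨h4⟩
    exact ZFSet.mem_inter.2 ⟨X.g.inter h1 h3, Tm.mem_out (N := Mf κ p) inferInstance⟩
  · intro a ha b hb hbκ hab
    exact ZFSet.mem_inter.2 ⟨X.g.up (ZFSet.mem_inter.1 ha).1 (Y.sub_M hb hbκ) hbκ hab, hb⟩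
  · intro b hb hbκ
    haveI : Fact (b ∈ Mf κ p) := ⟨hb⟩
    rcases X.g.uf.2.2.2.2.2.1 b (Y.sub_M hb hbκ) hbκ with h | h
    · exact Or.inl (ZFSet.mem_inter.2 ⟨h, hb⟩)
    · refine Or.inr (ZFSet.mem_inter.2 ⟨h, ?_⟩)
      unfold MPaper.compl
      exact Tm.mem_out (N := Mf κ p) inferInstance
  · intro f hf hz h
    have h := (ZFSet.mem_inter.1 h).1
    haveI : Fact (f ∈ Mf κ p) := ⟨hf⟩
    obtain ⟨k, hk, ek⟩ := mem_Mf.1 hf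
    have hR : ZFSet.sep (fun c => ae κ U (fun ξ => ZFSet.pair (pl κ c) (pR κ c) ∈ X.e k ξ)) κ ∈ M :=
      X.g.uq (P := fun c ξ => ZFSet.pair (pl κ c) (pR κ c) ∈ X.e k ξ) inferInstance
    have hRi : ∀ a ∈ κ, ∀ b ∈ κ, (pr κ a b ∈ ZFSet.sep (fun c => ae κ U (fun ξ => ZFSet.pair (pl κ c) (pR κ c) ∈ X.e k ξ)) κ ↔
        fapp f a = b) := by
      intro a ha b hb
      rw [ZFSet.mem_sep, and_iff_right (pr_mem ha hb), pl_pr ha hb, pR_pr ha hb, ← Y.pair_iff hk ha hb, ek]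
      exact ⟨fun h => (hz.eq h).2, fun h => h ▸ hz.mem ha⟩
    generalize ZFSet.sep (fun c => ae κ U (fun ξ => ZFSet.pair (pl κ c) (pR κ c) ∈ X.e k ξ)) κ = R at hR hRi
    haveI : Fact (R ∈ M) := ⟨hR⟩
    have hκ := KK.ord κ
    have hc : ∀ a ∈ κ, fapp f a ∈ κ → mu κ (fun b => pr κ a b ∈ R) = fapp f a := by
      intro a ha hfa
      have h1 := mu_spec hκ (Q := fun b => pr κ a b ∈ R) hfa ((hRi a ha _ hfa).2 rfl)
      exact ((hRi a ha _ h1.1).1 h1.2.1).symm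
    have h1 : ae κ U (fun a => mu κ (fun b => pr κ a b ∈ R) ∈ a) := by
      refine X.g.mono (P := fun a => fapp f a ∈ a) inferInstance (fun a ha h => ?_) h
      rw [hc a ha (hκ.trans ha h)]
      exact h
    obtain ⟨γ, hγ, h2⟩ := X.g.normal (c := fun a => mu κ (fun b => pr κ a b ∈ R)) inferInstance h1
    haveI : Fact (γ ∈ Mf κ p) := ⟨PM.mem Y.κ_mem hγ⟩
    have h3 : ZFSet.sep (fun ξ => fapp f ξ = γ) κ ∈ Mf κ p := Tm.mem_out (N := Mf κ p) inferInstance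
    refine ⟨γ, hγ, ZFSet.mem_inter.2 ⟨?_, h3⟩⟩
    refine X.g.up (X.g.and (P := fun a => fapp f a ∈ a) h h2) (Y.sub_M h3 (hsub _)) (hsub _) fun a ha => ?_
    obtain ⟨ha, h4, h5⟩ := ZFSet.mem_sep.1 ha
    refine ZFSet.mem_sep.2 ⟨ha, ?_⟩
    rw [← hc a ha (hκ.trans ha h4), h5]

theorem Cx.final (X : Cx κ V N M U K gK A) : ∃ M ∈ V, A ∈ M ∧ IsTransModel M ∧ κ ∈ M ∧
    (∃ f ∈ V, IsZFunc κ f ∧ SurjOnto f κ M) ∧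
    ∃ U ∈ V, IsMUltrafilter κ M U ∧ WeaklyAmenable κ M U ∧ OmegaOneIntersectingIn V U := by
  obtain ⟨p, Y⟩ := X.exists_Pj
  haveI : Fact (p ∈ V) := ⟨Y.pV⟩
  refine ⟨Mf κ p, ?_, Y.A_mem, Y.isTransModel, Y.κ_mem, ⟨p, Y.pV, Y.f, fun a ha => mem_Mf.2 ⟨a, ha, rfl⟩,
    fun b hb => mem_Mf.1 hb⟩, _, Y.Uf_V, Y.uf, Y.wa, ?_⟩
  · unfold Mf
    exact Tm.mem_out (N := V) inferInstance
  · intro f hf hz h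
    exact X.g.oi f (X.sub hf) hz fun n hn => (ZFSet.mem_inter.1 (h n hn)).1
end

theorem main_thm (κ δ V N : ZFSet.{u}) (hκ : IsCard κ) (hM : Practical κ V) (hM' : Practical κ N) (hsub : V ⊆ N)
    (hreg : IsRegularIn N.toSet δ) (happ : ApproxProperty δ V.toSet N.toSet)
    (hseq : OmegaSeqClosedPair V N) (hδκ : δ ∈ κ) (hR : RamseyCardIn N κ) : RamseyCardIn V κ := by
  intro A hA hAκ
  have hom : ZFSet.omega ∈ κ := by
    rcases (isOrd_omega).tri hreg.1.1 with h | h | h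
    · exact hκ.1.trans hδκ h
    · rw [h]; exact hδκ
    · exact absurd (hreg.2.1 h) (ZFSet.mem_irrefl _)
  haveI : KK κ := ⟨hκ, hom, V, hM.1, hM.2.1⟩
  haveI : PM V := ⟨hM.1⟩
  haveI : PM N := ⟨hM'.1⟩
  haveI : Fact (κ ∈ V) := ⟨hM.2.1⟩
  haveI : Fact (κ ∈ N) := ⟨hM'.2.1⟩
  obtain ⟨w, hw, hwi⟩ := hM.2.2
  obtain ⟨M, U, K, gK, hPM, hPK, hC, X⟩ := exists_cx (V := V) (N := N) ⟨hsub, hR, hw, hwi⟩ hseq happ hδκ hA hAκ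
  haveI : Fact (κ ∈ M) := ⟨hC.κM⟩
  haveI : Fact (K ∈ V) := ⟨hC.K_V⟩
  haveI : Fact (K ∈ M) := ⟨hC.K_M⟩
  haveI : Fact (gK ∈ V) := ⟨hC.gV⟩
  haveI : Fact (gK ∈ M) := ⟨hC.gM⟩
  haveI : Fact (A ∈ V) := ⟨hC.AV⟩
  haveI : Fact (A ∈ M) := ⟨hC.AM⟩
  exact X.final

/-- Suppose `ℳ` and `ℳ'` are practical for `κ`, the pair `ℳ ⊆ ℳ'` has the
`δ`-cover and `δ`-approximation properties for some regular cardinal `δ` of `ℳ'`, `ℳ` and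
`ℳ'` have the same ordinals, and `ℳ^ω ⊆ ℳ` holds in `ℳ'`. If `κ > δ` is Ramsey in `ℳ'`,
then `κ` was already Ramsey in `ℳ`. -/
theorem no_new_ramsey (κ δ ℳ ℳ' : ZFSet) (hκ : IsCard κ)
    (hM : Practical κ ℳ) (hM' : Practical κ ℳ') (hsub : ℳ ⊆ ℳ')
    (hreg : IsRegularIn ℳ'.toSet δ)
    (hcov : CoverProperty δ ℳ.toSet ℳ'.toSet)
    (happ : ApproxProperty δ ℳ.toSet ℳ'.toSet)
    (hord : SameOrdinals ℳ.toSet ℳ'.toSet)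
    (hseq : OmegaSeqClosedPair ℳ ℳ')
    (hδκ : δ ∈ κ) :
    RamseyCardIn ℳ' κ → RamseyCardIn ℳ κ := by
  exact main_thm κ δ ℳ ℳ' hκ hM hM' hsub hreg happ hseq hδκ

end MPaper
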